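/- Combined estimate of the nonlinear terms: there exists a constant C > 0 depending only on τ₀ such that, under the standing assumptions, ∑_{n≥0} ∑_{|α|=n} ( τⁿ Mₙ / ‖θ ⟨r⟩ⁿ ∂^α_h g‖_{L²} ) ∑_{j=1}^{7} |I^α_j| ≤ C τ^{−2} ( ‖g‖_{X_τ} + ⟨t⟩^{1/4} ‖g‖_{D_τ} ) ‖g‖_{Y_τ} + C τ^{−2} ( ‖g‖_{X_τ} + ⟨t⟩^{1/4} ‖g‖_{D_τ} ) ‖g‖_{X_τ}. -/

import Mathlib

open MeasureTheory Filter Set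

noncomputable section

/-- `⟨t⟩ = 1 + t` -/
def angT (t : ℝ) : ℝ := 1 + t

/-- `θ_λ(z) = exp (λ z² / (8⟨t⟩))`; `θ = θ₁`. -/
def thw (t lam z : ℝ) : ℝ := Real.exp (lam * z ^ 2 / (8 * angT t))

/-- `⟨r⟩ = √(x² + y² + 1)` -/
def angR (x y : ℝ) : ℝ := Real.sqrt (x ^ 2 + y ^ 2 + 1)

/-- `Mₙ = (n+1)⁴ / n!` -/
def Mfac (n : ℕ) : ℝ := ((n : ℝ) + 1) ^ 4 / (n.factorial : ℝ)

/-- `∂_x` -/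
def pdx (f : ℝ → ℝ → ℝ → ℝ) : ℝ → ℝ → ℝ → ℝ := fun x y z => deriv (fun x' => f x' y z) x
/-- `∂_y` -/
def pdy (f : ℝ → ℝ → ℝ → ℝ) : ℝ → ℝ → ℝ → ℝ := fun x y z => deriv (fun y' => f x y' z) y
/-- `∂_z` -/
def pdz (f : ℝ → ℝ → ℝ → ℝ) : ℝ → ℝ → ℝ → ℝ := fun x y z => deriv (fun z' => f x y z') z

/-- `∂^α_h = ∂_x^{α₁} ∂_y^{α₂}` for the multi-index `α = (a, b)` -/
def pdh (a b : ℕ) (f : ℝ → ℝ → ℝ → ℝ) : ℝ → ℝ → ℝ → ℝ := pdx^[a] (pdy^[b] f)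

/-- `r ∂_r = x ∂_x + y ∂_y` -/
def rdr (f : ℝ → ℝ → ℝ → ℝ) : ℝ → ℝ → ℝ → ℝ := fun x y z => x * pdx f x y z + y * pdy f x y z

/-- weighted `L²` norm over `ℝ² × (0,∞)` of `θ_λ ⟨r⟩ⁿ f` -/
def L2w (t lam : ℝ) (n : ℕ) (f : ℝ → ℝ → ℝ → ℝ) : ℝ :=
  Real.sqrt (∫ x : ℝ, ∫ y : ℝ, ∫ z in Ioi (0 : ℝ), (thw t lam z * angR x y ^ n * f x y z) ^ 2)

/-- weighted `L²_z` norm at fixed `(x, y)` of `θ_λ ⟨r⟩ⁿ f (x, y, ·)` -/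
def L2z (t lam : ℝ) (n : ℕ) (f : ℝ → ℝ → ℝ → ℝ) (x y : ℝ) : ℝ :=
  Real.sqrt (∫ z in Ioi (0 : ℝ), (thw t lam z * angR x y ^ n * f x y z) ^ 2)

/-- mixed `L^∞_h L²_z` norm of `θ_λ ⟨r⟩ⁿ f` -/
def LIh2z (t lam : ℝ) (n : ℕ) (f : ℝ → ℝ → ℝ → ℝ) : ℝ :=
  Real.sqrt (∫ z in Ioi (0 : ℝ), (⨆ p : ℝ × ℝ, |thw t lam z * angR p.1 p.2 ^ n * f p.1 p.2 z|) ^ 2)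

/-- mixed `L²_h L^∞_z` norm of `θ_λ ⟨r⟩ⁿ f` -/
def L2hIz (t lam : ℝ) (n : ℕ) (f : ℝ → ℝ → ℝ → ℝ) : ℝ :=
  Real.sqrt (∫ x : ℝ, ∫ y : ℝ,
    (⨆ z : Ioi (0 : ℝ), |thw t lam (z : ℝ) * angR x y ^ n * f x y (z : ℝ)|) ^ 2)

/-- the primitive `φ(x,y,z) = exp(−z²/(4⟨t⟩)) ∫₀^z g(x,y,s) exp(s²/(4⟨t⟩)) ds` -/
def phiF (t : ℝ) (g : ℝ → ℝ → ℝ → ℝ) : ℝ → ℝ → ℝ → ℝ := fun x y z =>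
  Real.exp (-(z ^ 2) / (4 * angT t)) * ∫ s in (0 : ℝ)..z, g x y s * Real.exp (s ^ 2 / (4 * angT t))

/-- `u^r = ∂_z φ` -/
def ur (t : ℝ) (g : ℝ → ℝ → ℝ → ℝ) : ℝ → ℝ → ℝ → ℝ := pdz (phiF t g)

/-- `u^z = −(x∂_x + y∂_y)φ − 2φ` -/
def uzv (t : ℝ) (g : ℝ → ℝ → ℝ → ℝ) : ℝ → ℝ → ℝ → ℝ := fun x y z =>
  -(rdr (phiF t g) x y z) - 2 * phiF t g x y z

/-- smoothness together with rapid decay in `z` of all derivatives -/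
def DecaySmooth (g : ℝ → ℝ → ℝ → ℝ) : Prop :=
  ContDiff ℝ (⊤ : ℕ∞) (fun p : ℝ × ℝ × ℝ => g p.1 p.2.1 p.2.2) ∧
  ∀ a b k m : ℕ, ∀ x y : ℝ,
    Tendsto (fun z : ℝ => z ^ m * pdz^[k] (pdh a b g) x y z) atTop (nhds 0)

/-- `θ ⟨r⟩^{|α|} ∂^α_h g ∈ L²(ℝ² × (0,∞))` for every `α` -/
def L2cond (t : ℝ) (g : ℝ → ℝ → ℝ → ℝ) : Prop :=
  ∀ a b : ℕ,
    Integrable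
      (fun p : ℝ × ℝ × ℝ =>
        (thw t 1 p.2.2 * angR p.1 p.2.1 ^ (a + b) * pdh a b g p.1 p.2.1 p.2.2) ^ 2)
      (volume.restrict {p : ℝ × ℝ × ℝ | 0 < p.2.2})

/-- `θ ⟨r⟩^{|α|} ∂^α_h ∂_z g ∈ L²(ℝ² × (0,∞))` for every `α` -/
def L2condZ (t : ℝ) (g : ℝ → ℝ → ℝ → ℝ) : Prop :=
  ∀ a b : ℕ,
    Integrable
      (fun p : ℝ × ℝ × ℝ =>
        (thw t 1 p.2.2 * angR p.1 p.2.1 ^ (a + b) * pdh a b (pdz g) p.1 p.2.1 p.2.2) ^ 2)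
      (volume.restrict {p : ℝ × ℝ × ℝ | 0 < p.2.2})

/-- `X_n(g, τ)` -/
def Xel (t τ : ℝ) (g : ℝ → ℝ → ℝ → ℝ) (n : ℕ) : ℝ :=
  (∑ a ∈ Finset.range (n + 1), L2w t 1 n (pdh a (n - a) g)) * τ ^ n * Mfac n

/-- `D_n(g, τ) = X_n(∂_z g, τ)` -/
def Del (t τ : ℝ) (g : ℝ → ℝ → ℝ → ℝ) (n : ℕ) : ℝ :=
  (∑ a ∈ Finset.range (n + 1), L2w t 1 n (pdh a (n - a) (pdz g))) * τ ^ n * Mfac n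

/-- `Y_n(g, τ)` (with `Y₀ = 0`) -/
def Yel (t τ : ℝ) (g : ℝ → ℝ → ℝ → ℝ) (n : ℕ) : ℝ :=
  (∑ a ∈ Finset.range (n + 1), L2w t 1 n (pdh a (n - a) g)) * τ ^ (n - 1) * (n : ℝ) * Mfac n

/-- `‖g‖_{X_τ}` -/
def Xnrm (t τ : ℝ) (g : ℝ → ℝ → ℝ → ℝ) : ℝ := ∑' n : ℕ, Xel t τ g n
/-- `‖g‖_{D_τ}` -/
def Dnrm (t τ : ℝ) (g : ℝ → ℝ → ℝ → ℝ) : ℝ := ∑' n : ℕ, Del t τ g n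
/-- `‖g‖_{Y_τ}` -/
def Ynrm (t τ : ℝ) (g : ℝ → ℝ → ℝ → ℝ) : ℝ := ∑' n : ℕ, Yel t τ g n

/-- triple integral over `ℝ² × (0,∞)` -/
def trip (F : ℝ → ℝ → ℝ → ℝ) : ℝ := ∫ x : ℝ, ∫ y : ℝ, ∫ z in Ioi (0 : ℝ), F x y z

/-- `I^α_1` -/
def I1 (t : ℝ) (g : ℝ → ℝ → ℝ → ℝ) (a b : ℕ) : ℝ :=
  -trip fun x y z =>
    thw t 2 z * angR x y ^ (2 * (a + b)) *
      pdh a b (fun x' y' z' => ur t g x' y' z' * rdr g x' y' z') x y z * pdh a b g x y z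

/-- `I^α_2` -/
def I2 (t : ℝ) (g : ℝ → ℝ → ℝ → ℝ) (a b : ℕ) : ℝ :=
  -trip fun x y z =>
    thw t 2 z * angR x y ^ (2 * (a + b)) *
      pdh a b (fun x' y' z' => uzv t g x' y' z' * pdz g x' y' z') x y z * pdh a b g x y z

/-- `I^α_3` -/
def I3 (t : ℝ) (g : ℝ → ℝ → ℝ → ℝ) (a b : ℕ) : ℝ :=
  -trip fun x y z =>
    thw t 2 z * angR x y ^ (2 * (a + b)) *
      pdh a b (fun x' y' z' => ur t g x' y' z' ^ 2) x y z * pdh a b g x y z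

/-- `I^α_4` -/
def I4 (t : ℝ) (g : ℝ → ℝ → ℝ → ℝ) (a b : ℕ) : ℝ :=
  (1 / (2 * angT t)) * trip fun x y z =>
    thw t 2 z * angR x y ^ (2 * (a + b)) *
      pdh a b
        (fun x' y' z' =>
          uzv t g x' y' z' * pdz (fun x'' y'' w => w * phiF t g x'' y'' w) x' y' z') x y z *
      pdh a b g x y z

/-- `I^α_5` -/
def I5 (t : ℝ) (g : ℝ → ℝ → ℝ → ℝ) (a b : ℕ) : ℝ :=
  -(1 / angT t) * trip fun x y z =>
    z * thw t 2 z * angR x y ^ (2 * (a + b)) *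
      pdh a b (fun x' y' z' => ur t g x' y' z' * phiF t g x' y' z') x y z * pdh a b g x y z

/-- `I^α_6` -/
def I6 (t : ℝ) (g : ℝ → ℝ → ℝ → ℝ) (a b : ℕ) : ℝ :=
  -(1 / (2 * angT t)) * trip fun x y z =>
    z * thw t 2 z * angR x y ^ (2 * (a + b)) *
      (∫ s in Ioi z, pdh a b (fun x' y' z' => ur t g x' y' z' ^ 2) x y s) * pdh a b g x y z

/-- `I^α_7` -/
def I7 (t : ℝ) (g : ℝ → ℝ → ℝ → ℝ) (a b : ℕ) : ℝ :=
  (1 / angT t) * trip fun x y z =>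
    z * thw t 2 z * angR x y ^ (2 * (a + b)) *
      (∫ s in Ioi z, pdh a b (fun x' y' z' => pdz (ur t g) x' y' z' * uzv t g x' y' z') x y s) *
      pdh a b g x y z

/-- `∑_{|α| = n} |I^α| τⁿ Mₙ / ‖θ ⟨r⟩ⁿ ∂^α_h g‖_{L²}` (with the convention `x / 0 = 0`) -/
def Qterm (t τ : ℝ) (g : ℝ → ℝ → ℝ → ℝ) (I : ℕ → ℕ → ℝ) (n : ℕ) : ℝ :=
  ∑ a ∈ Finset.range (n + 1), |I a (n - a)| * τ ^ n * Mfac n / L2w t 1 n (pdh a (n - a) g)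

/-- `∂_t` -/
def pdt (G : ℝ → ℝ → ℝ → ℝ → ℝ) (t x y z : ℝ) : ℝ := deriv (fun t' => G t' x y z) t

/-- the good-unknown axially symmetric Prandtl equation at the point `(t, x, y, z)` -/
def GoodEq (G : ℝ → ℝ → ℝ → ℝ → ℝ) (t x y z : ℝ) : Prop :=
  pdt G t x y z
      + ur t (G t) x y z * rdr (G t) x y z
      + uzv t (G t) x y z * pdz (G t) x y z
      - pdz (pdz (G t)) x y z
      + G t x y z / angT t
      + ur t (G t) x y z ^ 2
      - 1 / (2 * angT t) * (uzv t (G t) x y z * pdz (fun x' y' w => w * phiF t (G t) x' y' w) x y z)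
      + z / angT t * (ur t (G t) x y z * phiF t (G t) x y z)
      + z / (2 * angT t) * (∫ s in Ioi z, ur t (G t) x y s ^ 2)
      - z / angT t * (∫ s in Ioi z, pdz (ur t (G t)) x y s * uzv t (G t) x y s) = 0

/-- the sum `∑_{j=1}^{7} |I^α_j|` -/
def Iall (t : ℝ) (g : ℝ → ℝ → ℝ → ℝ) (a b : ℕ) : ℝ :=
  |I1 t g a b| + |I2 t g a b| + |I3 t g a b| + |I4 t g a b| + |I5 t g a b| +
    |I6 t g a b| + |I7 t g a b|

open scoped ENNReal

/-- joint smoothness of a function of three real variables -/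
def SmoothF (f : ℝ → ℝ → ℝ → ℝ) : Prop :=
  ContDiff ℝ (⊤ : ℕ∞) (fun p : ℝ × ℝ × ℝ => f p.1 p.2.1 p.2.2)

namespace SmoothF

variable {f h : ℝ → ℝ → ℝ → ℝ}

theorem hasFDerivAt (hf : SmoothF f) (p : ℝ × ℝ × ℝ) :
    HasFDerivAt (fun p : ℝ × ℝ × ℝ => f p.1 p.2.1 p.2.2)
      (fderiv ℝ (fun p : ℝ × ℝ × ℝ => f p.1 p.2.1 p.2.2) p) p :=
  (hf.differentiable (by simp) p).hasFDerivAt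

theorem hasDerivAt_x (hf : SmoothF f) (x y z : ℝ) :
    HasDerivAt (fun x' => f x' y z)
      (fderiv ℝ (fun p : ℝ × ℝ × ℝ => f p.1 p.2.1 p.2.2) (x, y, z) (1, 0, 0)) x := by
  have h1 : HasDerivAt (fun x' : ℝ => ((x', y, z) : ℝ × ℝ × ℝ)) (1, 0, 0) x :=
    (hasDerivAt_id x).prodMk (hasDerivAt_const x (y, z))
  exact (hf.hasFDerivAt (x, y, z)).comp_hasDerivAt x h1

theorem hasDerivAt_y (hf : SmoothF f) (x y z : ℝ) :
    HasDerivAt (fun y' => f x y' z)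
      (fderiv ℝ (fun p : ℝ × ℝ × ℝ => f p.1 p.2.1 p.2.2) (x, y, z) (0, 1, 0)) y := by
  have h1 : HasDerivAt (fun y' : ℝ => ((x, y', z) : ℝ × ℝ × ℝ)) (0, 1, 0) y :=
    (hasDerivAt_const y x).prodMk ((hasDerivAt_id y).prodMk (hasDerivAt_const y z))
  exact (hf.hasFDerivAt (x, y, z)).comp_hasDerivAt y h1

theorem hasDerivAt_z (hf : SmoothF f) (x y z : ℝ) :
    HasDerivAt (fun z' => f x y z')
      (fderiv ℝ (fun p : ℝ × ℝ × ℝ => f p.1 p.2.1 p.2.2) (x, y, z) (0, 0, 1)) z := by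
  have h1 : HasDerivAt (fun z' : ℝ => ((x, y, z') : ℝ × ℝ × ℝ)) (0, 0, 1) z :=
    (hasDerivAt_const z x).prodMk ((hasDerivAt_const z y).prodMk (hasDerivAt_id z))
  exact (hf.hasFDerivAt (x, y, z)).comp_hasDerivAt z h1

theorem pdx_eq (hf : SmoothF f) (x y z : ℝ) :
    pdx f x y z = fderiv ℝ (fun p : ℝ × ℝ × ℝ => f p.1 p.2.1 p.2.2) (x, y, z) (1, 0, 0) :=
  (hf.hasDerivAt_x x y z).deriv

theorem pdy_eq (hf : SmoothF f) (x y z : ℝ) :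
    pdy f x y z = fderiv ℝ (fun p : ℝ × ℝ × ℝ => f p.1 p.2.1 p.2.2) (x, y, z) (0, 1, 0) :=
  (hf.hasDerivAt_y x y z).deriv

theorem pdz_eq (hf : SmoothF f) (x y z : ℝ) :
    pdz f x y z = fderiv ℝ (fun p : ℝ × ℝ × ℝ => f p.1 p.2.1 p.2.2) (x, y, z) (0, 0, 1) :=
  (hf.hasDerivAt_z x y z).deriv

theorem hasDerivAt_pdx (hf : SmoothF f) (x y z : ℝ) :
    HasDerivAt (fun x' => f x' y z) (pdx f x y z) x :=
  (hf.hasDerivAt_x x y z).differentiableAt.hasDerivAt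

theorem hasDerivAt_pdy (hf : SmoothF f) (x y z : ℝ) :
    HasDerivAt (fun y' => f x y' z) (pdy f x y z) y :=
  (hf.hasDerivAt_y x y z).differentiableAt.hasDerivAt

theorem hasDerivAt_pdz (hf : SmoothF f) (x y z : ℝ) :
    HasDerivAt (fun z' => f x y z') (pdz f x y z) z :=
  (hf.hasDerivAt_z x y z).differentiableAt.hasDerivAt

theorem contDiff_fderiv_apply (hf : SmoothF f) (v : ℝ × ℝ × ℝ) :
    ContDiff ℝ (⊤ : ℕ∞)
      (fun p => fderiv ℝ (fun p : ℝ × ℝ × ℝ => f p.1 p.2.1 p.2.2) p v) :=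
  (hf.fderiv_right (m := (⊤ : ℕ∞)) (by simp)).clm_apply contDiff_const

theorem pdx (hf : SmoothF f) : SmoothF (pdx f) := by
  simp only [SmoothF, hf.pdx_eq]
  exact hf.contDiff_fderiv_apply (1, 0, 0)

theorem pdy (hf : SmoothF f) : SmoothF (pdy f) := by
  simp only [SmoothF, hf.pdy_eq]
  exact hf.contDiff_fderiv_apply (0, 1, 0)

theorem pdz (hf : SmoothF f) : SmoothF (pdz f) := by
  simp only [SmoothF, hf.pdz_eq]
  exact hf.contDiff_fderiv_apply (0, 0, 1)

theorem fderiv_fderiv_comm (hf : SmoothF f) (p v w : ℝ × ℝ × ℝ) :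
    fderiv ℝ (fun q => fderiv ℝ (fun p : ℝ × ℝ × ℝ => f p.1 p.2.1 p.2.2) q v) p w =
    fderiv ℝ (fun q => fderiv ℝ (fun p : ℝ × ℝ × ℝ => f p.1 p.2.1 p.2.2) q w) p v := by
  have hd : DifferentiableAt ℝ (fderiv ℝ (fun p : ℝ × ℝ × ℝ => f p.1 p.2.1 p.2.2)) p :=
    ((hf.fderiv_right (m := (⊤ : ℕ∞)) (by simp)).differentiable (by simp)) p
  have hs : IsSymmSndFDerivAt ℝ (fun p : ℝ × ℝ × ℝ => f p.1 p.2.1 p.2.2) p :=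
    (hf.contDiffAt).isSymmSndFDerivAt
      (by rw [minSmoothness_of_isRCLikeNormedField]; exact WithTop.coe_le_coe.2 le_top)
  rw [fderiv_clm_apply hd (by fun_prop), fderiv_clm_apply hd (by fun_prop)]
  simpa using hs w v

theorem pdx_pdy (hf : SmoothF f) : _root_.pdx (_root_.pdy f) = _root_.pdy (_root_.pdx f) := by
  funext x y z
  rw [hf.pdy.pdx_eq, hf.pdx.pdy_eq]
  simp_rw [hf.pdy_eq, hf.pdx_eq]
  exact hf.fderiv_fderiv_comm _ _ _

theorem pdx_pdz (hf : SmoothF f) : _root_.pdx (_root_.pdz f) = _root_.pdz (_root_.pdx f) := by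
  funext x y z
  rw [hf.pdz.pdx_eq, hf.pdx.pdz_eq]
  simp_rw [hf.pdz_eq, hf.pdx_eq]
  exact hf.fderiv_fderiv_comm _ _ _

theorem pdy_pdz (hf : SmoothF f) : _root_.pdy (_root_.pdz f) = _root_.pdz (_root_.pdy f) := by
  funext x y z
  rw [hf.pdz.pdy_eq, hf.pdy.pdz_eq]
  simp_rw [hf.pdz_eq, hf.pdy_eq]
  exact hf.fderiv_fderiv_comm _ _ _

theorem add (hf : SmoothF f) (hh : SmoothF h) : SmoothF (fun x y z => f x y z + h x y z) :=
  ContDiff.add hf hh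

theorem sub (hf : SmoothF f) (hh : SmoothF h) : SmoothF (fun x y z => f x y z - h x y z) :=
  ContDiff.sub hf hh

theorem mul (hf : SmoothF f) (hh : SmoothF h) : SmoothF (fun x y z => f x y z * h x y z) :=
  ContDiff.mul hf hh

theorem neg (hf : SmoothF f) : SmoothF (fun x y z => -f x y z) :=
  ContDiff.neg hf

theorem const_mul (c : ℝ) (hf : SmoothF f) : SmoothF (fun x y z => c * f x y z) :=
  contDiff_const.mul hf

theorem mul_x (hf : SmoothF f) : SmoothF (fun x y z => x * f x y z) :=
  contDiff_fst.mul hf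

theorem mul_y (hf : SmoothF f) : SmoothF (fun x y z => y * f x y z) :=
  (contDiff_fst.comp contDiff_snd).mul hf

theorem weight_mul {w : ℝ → ℝ} (hw : ContDiff ℝ (⊤ : ℕ∞) w) (hf : SmoothF f) :
    SmoothF (fun x y z => w z * f x y z) :=
  (hw.comp (contDiff_snd.comp contDiff_snd)).mul hf

theorem rdr (hf : SmoothF f) : SmoothF (rdr f) :=
  hf.pdx.mul_x.add hf.pdy.mul_y

theorem iterate_pdx (hf : SmoothF f) (n : ℕ) : SmoothF (_root_.pdx^[n] f) := by
  induction n with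
  | zero => exact hf
  | succ n ih => rw [Function.iterate_succ_apply']; exact ih.pdx

theorem iterate_pdy (hf : SmoothF f) (n : ℕ) : SmoothF (_root_.pdy^[n] f) := by
  induction n with
  | zero => exact hf
  | succ n ih => rw [Function.iterate_succ_apply']; exact ih.pdy

theorem pdh (hf : SmoothF f) (a b : ℕ) : SmoothF (pdh a b f) :=
  (hf.iterate_pdy b).iterate_pdx a

theorem continuous (hf : SmoothF f) : Continuous (fun p : ℝ × ℝ × ℝ => f p.1 p.2.1 p.2.2) :=
  ContDiff.continuous hf

theorem contDiff_z (hf : SmoothF f) (x y : ℝ) : ContDiff ℝ (⊤ : ℕ∞) (f x y) :=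
  ContDiff.comp (g := fun p : ℝ × ℝ × ℝ => f p.1 p.2.1 p.2.2) hf
    (contDiff_const.prodMk (contDiff_const.prodMk contDiff_id))

theorem contDiff_x (hf : SmoothF f) (y z : ℝ) : ContDiff ℝ (⊤ : ℕ∞) (fun x => f x y z) :=
  ContDiff.comp (g := fun p : ℝ × ℝ × ℝ => f p.1 p.2.1 p.2.2) hf
    (contDiff_id.prodMk (contDiff_const.prodMk contDiff_const))

theorem contDiff_y (hf : SmoothF f) (x z : ℝ) : ContDiff ℝ (⊤ : ℕ∞) (fun y => f x y z) :=
  ContDiff.comp (g := fun p : ℝ × ℝ × ℝ => f p.1 p.2.1 p.2.2) hf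
    (contDiff_const.prodMk (contDiff_id.prodMk contDiff_const))

end SmoothF

variable {f h : ℝ → ℝ → ℝ → ℝ}

theorem pdx_pdh (a b : ℕ) (f : ℝ → ℝ → ℝ → ℝ) : pdx (pdh a b f) = pdh (a + 1) b f := by
  rw [pdh, pdh, Function.iterate_succ_apply']

theorem pdy_pdh (hf : SmoothF f) (a b : ℕ) : pdy (pdh a b f) = pdh a (b + 1) f := by
  induction a with
  | zero => simp only [pdh, Function.iterate_zero, id, Function.iterate_succ_apply']
  | succ a ih => rw [← pdx_pdh, ← pdx_pdh, ← ih, (hf.pdh a b).pdx_pdy]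

theorem pdz_pdh (hf : SmoothF f) (a b : ℕ) : pdz (pdh a b f) = pdh a b (pdz f) := by
  have hb : pdz (pdy^[b] f) = pdy^[b] (pdz f) := by
    induction b with
    | zero => rfl
    | succ b ih =>
      rw [Function.iterate_succ_apply', Function.iterate_succ_apply', ← ih,
        (hf.iterate_pdy b).pdy_pdz]
  induction a with
  | zero => exact hb
  | succ a ih => rw [← pdx_pdh, ← pdx_pdh, ← ih, (hf.pdh a b).pdx_pdz]

/-- An operator commuting with `∂_x` and `∂_y` on smooth functions commutes with `∂^α_h`. -/
theorem pdh_comm_of_pdx_pdy (A : (ℝ → ℝ → ℝ → ℝ) → ℝ → ℝ → ℝ → ℝ)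
    (hx : ∀ f, SmoothF f → pdx (A f) = A (pdx f)) (hy : ∀ f, SmoothF f → pdy (A f) = A (pdy f))
    (hf : SmoothF f) (a b : ℕ) : pdh a b (A f) = A (pdh a b f) := by
  have hb : pdy^[b] (A f) = A (pdy^[b] f) := by
    induction b with
    | zero => rfl
    | succ b ih =>
      rw [Function.iterate_succ_apply', Function.iterate_succ_apply', ih, hy _ (hf.iterate_pdy b)]
  induction a with
  | zero => exact hb
  | succ a ih => rw [← pdx_pdh, ← pdx_pdh, ih, hx _ (hf.pdh a b)]

theorem pdx_add (hf : SmoothF f) (hh : SmoothF h) :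
    pdx (fun x y z => f x y z + h x y z) = fun x y z => pdx f x y z + pdx h x y z := by
  funext x y z
  exact ((hf.hasDerivAt_pdx x y z).add (hh.hasDerivAt_pdx x y z)).deriv

theorem pdy_add (hf : SmoothF f) (hh : SmoothF h) :
    pdy (fun x y z => f x y z + h x y z) = fun x y z => pdy f x y z + pdy h x y z := by
  funext x y z
  exact ((hf.hasDerivAt_pdy x y z).add (hh.hasDerivAt_pdy x y z)).deriv

theorem pdh_add (hf : SmoothF f) (hh : SmoothF h) (a b : ℕ) :
    pdh a b (fun x y z => f x y z + h x y z) = fun x y z => pdh a b f x y z + pdh a b h x y z := by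
  have hb : pdy^[b] (fun x y z => f x y z + h x y z) =
      fun x y z => pdy^[b] f x y z + pdy^[b] h x y z := by
    induction b with
    | zero => rfl
    | succ b ih =>
      simp only [Function.iterate_succ_apply', ih]
      exact pdy_add (hf.iterate_pdy b) (hh.iterate_pdy b)
  induction a with
  | zero => exact hb
  | succ a ih =>
    simp only [← pdx_pdh, ih]
    exact pdx_add (hf.pdh a b) (hh.pdh a b)

theorem pdh_weight_mul {w : ℝ → ℝ} (hf : SmoothF f) (a b : ℕ) :
    pdh a b (fun x y z => w z * f x y z) = fun x y z => w z * pdh a b f x y z := by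
  refine pdh_comm_of_pdx_pdy (fun f x y z => w z * f x y z) (fun f hf => ?_) (fun f hf => ?_) hf a b
  · funext x y z
    exact ((hf.hasDerivAt_pdx x y z).const_mul (w z)).deriv
  · funext x y z
    exact ((hf.hasDerivAt_pdy x y z).const_mul (w z)).deriv

theorem iterate_pdx_eq_iteratedDeriv (n : ℕ) (f : ℝ → ℝ → ℝ → ℝ) :
    pdx^[n] f = fun x y z => iteratedDeriv n (fun x' => f x' y z) x := by
  induction n with
  | zero => funext x y z; simp
  | succ n ih => rw [Function.iterate_succ_apply', ih]; funext x y z; rw [iteratedDeriv_succ]; rfl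

theorem iterate_pdy_eq_iteratedDeriv (n : ℕ) (f : ℝ → ℝ → ℝ → ℝ) :
    pdy^[n] f = fun x y z => iteratedDeriv n (fun y' => f x y' z) y := by
  induction n with
  | zero => funext x y z; simp
  | succ n ih => rw [Function.iterate_succ_apply', ih]; funext x y z; rw [iteratedDeriv_succ]; rfl

/-- Leibniz rule for `∂^α_h`. -/
theorem pdh_mul (hf : SmoothF f) (hh : SmoothF h) (a b : ℕ) (x y z : ℝ) :
    pdh a b (fun x y z => f x y z * h x y z) x y z =
      ∑ i ∈ Finset.range (a + 1), ∑ j ∈ Finset.range (b + 1),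
        ((a.choose i : ℝ) * (b.choose j : ℝ)) *
          (pdh i j f x y z * pdh (a - i) (b - j) h x y z) := by
  have hy : pdy^[b] (fun x y z => f x y z * h x y z) = fun x y z =>
      ∑ j ∈ Finset.range (b + 1), (b.choose j : ℝ) * pdy^[j] f x y z * pdy^[b - j] h x y z := by
    funext x y z
    simp only [iterate_pdy_eq_iteratedDeriv]
    exact iteratedDeriv_fun_mul ((hf.contDiff_y x z).of_le (by exact_mod_cast le_top)).contDiffAt
      ((hh.contDiff_y x z).of_le (by exact_mod_cast le_top)).contDiffAt
  rw [pdh, hy, iterate_pdx_eq_iteratedDeriv]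
  have hterm : ∀ j : ℕ, ContDiff ℝ (a : ℕ∞) (fun x' => (b.choose j : ℝ) * pdy^[j] f x' y z *
      pdy^[b - j] h x' y z) := fun j =>
    (((contDiff_const.mul ((hf.iterate_pdy j).contDiff_x y z)).mul
      ((hh.iterate_pdy (b - j)).contDiff_x y z)).of_le (by exact_mod_cast le_top))
  beta_reduce
  rw [iteratedDeriv_fun_sum fun j _ => (hterm j).contDiffAt, Finset.sum_comm]
  refine Finset.sum_congr rfl fun j _ => ?_
  simp only [mul_assoc]
  rw [iteratedDeriv_const_mul_field, iteratedDeriv_fun_mul, Finset.mul_sum]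
  · refine Finset.sum_congr rfl fun i _ => ?_
    simp only [pdh, iterate_pdx_eq_iteratedDeriv]
    ring
  · exact (((hf.iterate_pdy j).contDiff_x y z).of_le (by exact_mod_cast le_top)).contDiffAt
  · exact (((hh.iterate_pdy (b - j)).contDiff_x y z).of_le (by exact_mod_cast le_top)).contDiffAt

theorem pdh_rdr (hf : SmoothF f) (a b : ℕ) :
    pdh a b (rdr f) = fun x y z =>
      x * pdh (a + 1) b f x y z + y * pdh a (b + 1) f x y z + (a + b : ℝ) * pdh a b f x y z := by
  have hb : pdy^[b] (rdr f) = fun x y z =>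
      x * pdh 1 b f x y z + y * pdh 0 (b + 1) f x y z + (b : ℝ) * pdh 0 b f x y z := by
    induction b with
    | zero => funext x y z; simp [rdr, pdh]
    | succ b ih =>
      rw [Function.iterate_succ_apply', ih]
      funext x y z
      have h1 := ((hf.pdh 1 b).hasDerivAt_pdy x y z).const_mul x
      have h2 := (hasDerivAt_id y).mul ((hf.pdh 0 (b + 1)).hasDerivAt_pdy x y z)
      have h3 := ((hf.pdh 0 b).hasDerivAt_pdy x y z).const_mul (b : ℝ)
      refine ((h1.add h2).add h3).deriv.trans ?_
      simp only [pdy_pdh hf, id]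
      push_cast
      ring
  induction a with
  | zero => rw [pdh, Function.iterate_zero, id, hb]; simp
  | succ a ih =>
    rw [← pdx_pdh, ih]
    funext x y z
    have h1 := (hasDerivAt_id x).mul ((hf.pdh (a + 1) b).hasDerivAt_pdx x y z)
    have h2 := ((hf.pdh a (b + 1)).hasDerivAt_pdx x y z).const_mul y
    have h3 := ((hf.pdh a b).hasDerivAt_pdx x y z).const_mul (a + b : ℝ)
    refine ((h1.add h2).add h3).deriv.trans ?_
    simp only [pdx_pdh, id]
    push_cast
    ring

section ParametricIntegral

variable {E : Type*} [NormedAddCommGroup E] [NormedSpace ℝ E] [FiniteDimensional ℝ E]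

theorem hasFDerivAt_integral_unitInterval {k : E × ℝ → ℝ} (hk : ContDiff ℝ (⊤ : ℕ∞) k) (p : E) :
    HasFDerivAt (fun p => ∫ s in (0 : ℝ)..1, k (p, s))
      (∫ s in (0 : ℝ)..1, (fderiv ℝ k (p, s)).comp (ContinuousLinearMap.inl ℝ E ℝ)) p := by
  have hcont : Continuous fun q : E × ℝ => (fderiv ℝ k q).comp (ContinuousLinearMap.inl ℝ E ℝ) :=
    (hk.continuous_fderiv (by simp)).clm_comp continuous_const
  obtain ⟨M, hM⟩ := ((isCompact_closedBall p 1).prod (isCompact_Icc (a := (0 : ℝ)) (b := 1)))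
    |>.exists_bound_of_continuousOn hcont.continuousOn
  refine intervalIntegral.hasFDerivAt_integral_of_dominated_of_fderiv_le
    (F' := fun p s => (fderiv ℝ k (p, s)).comp (ContinuousLinearMap.inl ℝ E ℝ))
    (bound := fun _ => M) (Metric.closedBall_mem_nhds p one_pos) ?_ ?_ ?_ ?_ ?_ ?_
  · exact Eventually.of_forall fun q =>
      (hk.continuous.comp (Continuous.prodMk_right q)).aestronglyMeasurable
  · exact (hk.continuous.comp (Continuous.prodMk_right p)).intervalIntegrable _ _
  · exact (hcont.comp (Continuous.prodMk_right p)).aestronglyMeasurable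
  · refine Eventually.of_forall fun s hs q hq => hM (q, s) ⟨hq, ?_⟩
    rw [uIoc_of_le zero_le_one] at hs
    exact Ioc_subset_Icc_self hs
  · exact intervalIntegrable_const
  · refine Eventually.of_forall fun s _ q _ => ?_
    have h1 : HasFDerivAt (fun q : E => (q, s)) (ContinuousLinearMap.inl ℝ E ℝ) q :=
      hasFDerivAt_prodMk_left q s
    exact ((hk.differentiable (by simp) (q, s)).hasFDerivAt).comp q h1

theorem fderiv_integral_unitInterval_apply {k : E × ℝ → ℝ} (hk : ContDiff ℝ (⊤ : ℕ∞) k)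
    (p v : E) :
    fderiv ℝ (fun p => ∫ s in (0 : ℝ)..1, k (p, s)) p v =
      ∫ s in (0 : ℝ)..1, fderiv ℝ k (p, s) (v, 0) := by
  have hcont : Continuous fun s : ℝ => (fderiv ℝ k (p, s)).comp (ContinuousLinearMap.inl ℝ E ℝ) :=
    ((hk.continuous_fderiv (by simp)).comp (Continuous.prodMk_right p)).clm_comp continuous_const
  rw [(hasFDerivAt_integral_unitInterval hk p).fderiv,
    ContinuousLinearMap.intervalIntegral_apply (hcont.intervalIntegrable _ _)]
  simp

theorem contDiff_integral_unitInterval {k : E × ℝ → ℝ} (hk : ContDiff ℝ (⊤ : ℕ∞) k) :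
    ContDiff ℝ (⊤ : ℕ∞) (fun p => ∫ s in (0 : ℝ)..1, k (p, s)) := by
  refine contDiff_infty.2 fun n => ?_
  induction n generalizing k with
  | zero =>
    exact contDiff_zero.2 (Differentiable.continuous (𝕜 := ℝ) fun p =>
      (hasFDerivAt_integral_unitInterval hk p).differentiableAt)
  | succ n ih =>
    push_cast
    refine contDiff_succ_iff_fderiv_apply.2 ⟨fun p =>
      (hasFDerivAt_integral_unitInterval hk p).differentiableAt, by simp, fun v => ?_⟩
    simp only [fderiv_integral_unitInterval_apply hk]
    exact ih (k := fun q => fderiv ℝ k q (v, 0))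
      ((hk.fderiv_right (m := (⊤ : ℕ∞)) (by simp)).clm_apply contDiff_const)

end ParametricIntegral

variable {f g : ℝ → ℝ → ℝ → ℝ}

/-- the vertical primitive `∫₀^z f` -/
def primZ (f : ℝ → ℝ → ℝ → ℝ) : ℝ → ℝ → ℝ → ℝ := fun x y z => ∫ s in (0 : ℝ)..z, f x y s

theorem primZ_eq (f : ℝ → ℝ → ℝ → ℝ) (x y z : ℝ) :
    primZ f x y z = z * ∫ s in (0 : ℝ)..1, f x y (z * s) := by
  rw [intervalIntegral.mul_integral_comp_mul_left, primZ]
  simp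

theorem SmoothF.contDiff_scaled (hf : SmoothF f) :
    ContDiff ℝ (⊤ : ℕ∞) (fun q : (ℝ × ℝ × ℝ) × ℝ => f q.1.1 q.1.2.1 (q.1.2.2 * q.2)) :=
  ContDiff.comp (g := fun p : ℝ × ℝ × ℝ => f p.1 p.2.1 p.2.2)
    (f := fun q : (ℝ × ℝ × ℝ) × ℝ => (q.1.1, q.1.2.1, q.1.2.2 * q.2)) hf (by fun_prop)

theorem SmoothF.primZ (hf : SmoothF f) : SmoothF (primZ f) := by
  have h : SmoothF fun x y z => ∫ s in (0 : ℝ)..1, f x y (z * s) :=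
    contDiff_integral_unitInterval hf.contDiff_scaled
  have := SmoothF.weight_mul (w := fun z => z) contDiff_id h
  simp only [SmoothF, primZ_eq]
  exact this

theorem pdx_primZ (hf : SmoothF f) : pdx (primZ f) = primZ (pdx f) := by
  funext x y z
  have h : SmoothF fun x y z => ∫ s in (0 : ℝ)..1, f x y (z * s) :=
    contDiff_integral_unitInterval hf.contDiff_scaled
  simp only [pdx, primZ_eq]
  refine ((h.hasDerivAt_pdx x y z).const_mul z).deriv.trans ?_
  rw [h.pdx_eq, fderiv_integral_unitInterval_apply hf.contDiff_scaled]
  congr 1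
  refine intervalIntegral.integral_congr fun s _ => ?_
  have h1 : HasDerivAt (fun x' : ℝ => (((x', y, z), s) : (ℝ × ℝ × ℝ) × ℝ)) ((1, 0, 0), 0) x :=
    ((hasDerivAt_id x).prodMk (hasDerivAt_const x (y, z))).prodMk (hasDerivAt_const x s)
  exact (((hf.contDiff_scaled.differentiable (by simp) ((x, y, z), s)).hasFDerivAt).comp_hasDerivAt
    x h1).deriv.symm

theorem pdy_primZ (hf : SmoothF f) : pdy (primZ f) = primZ (pdy f) := by
  funext x y z
  have h : SmoothF fun x y z => ∫ s in (0 : ℝ)..1, f x y (z * s) :=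
    contDiff_integral_unitInterval hf.contDiff_scaled
  simp only [pdy, primZ_eq]
  refine ((h.hasDerivAt_pdy x y z).const_mul z).deriv.trans ?_
  rw [h.pdy_eq, fderiv_integral_unitInterval_apply hf.contDiff_scaled]
  congr 1
  refine intervalIntegral.integral_congr fun s _ => ?_
  have h1 : HasDerivAt (fun y' : ℝ => (((x, y', z), s) : (ℝ × ℝ × ℝ) × ℝ)) ((0, 1, 0), 0) y :=
    ((hasDerivAt_const y x).prodMk ((hasDerivAt_id y).prodMk (hasDerivAt_const y z))).prodMk
      (hasDerivAt_const y s)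
  exact (((hf.contDiff_scaled.differentiable (by simp) ((x, y, z), s)).hasFDerivAt).comp_hasDerivAt
    y h1).deriv.symm

theorem pdz_primZ (hf : SmoothF f) : pdz (primZ f) = f := by
  funext x y z
  exact (hf.contDiff_z x y).continuous.deriv_integral (f x y) 0 z

theorem phiF_eq (t : ℝ) (g : ℝ → ℝ → ℝ → ℝ) :
    phiF t g = fun x y z => Real.exp (-(z ^ 2) / (4 * angT t)) *
      primZ (fun x y z => Real.exp (z ^ 2 / (4 * angT t)) * g x y z) x y z := by
  funext x y z
  simp only [phiF, primZ, mul_comm (g x y _)]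

theorem contDiff_exp_sq_div (T : ℝ) :
    ContDiff ℝ (⊤ : ℕ∞) (fun z : ℝ => Real.exp (z ^ 2 / T)) := by fun_prop

theorem contDiff_exp_neg_sq_div (T : ℝ) :
    ContDiff ℝ (⊤ : ℕ∞) (fun z : ℝ => Real.exp (-(z ^ 2) / T)) := by fun_prop

theorem SmoothF.phiF (hg : SmoothF g) (t : ℝ) : SmoothF (phiF t g) := by
  rw [phiF_eq]
  exact SmoothF.weight_mul (contDiff_exp_neg_sq_div _)
    (SmoothF.weight_mul (contDiff_exp_sq_div _) hg).primZ

theorem pdx_weight_mul (w : ℝ → ℝ) (hf : SmoothF f) :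
    pdx (fun x y z => w z * f x y z) = fun x y z => w z * pdx f x y z := by
  funext x y z
  exact ((hf.hasDerivAt_pdx x y z).const_mul (w z)).deriv

theorem pdy_weight_mul (w : ℝ → ℝ) (hf : SmoothF f) :
    pdy (fun x y z => w z * f x y z) = fun x y z => w z * pdy f x y z := by
  funext x y z
  exact ((hf.hasDerivAt_pdy x y z).const_mul (w z)).deriv

theorem pdx_phiF (hg : SmoothF g) (t : ℝ) : pdx (phiF t g) = phiF t (pdx g) := by
  have h := SmoothF.weight_mul (contDiff_exp_sq_div (4 * angT t)) hg
  rw [phiF_eq, phiF_eq, pdx_weight_mul (fun z => Real.exp (-(z ^ 2) / (4 * angT t))) h.primZ,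
    pdx_primZ h, pdx_weight_mul (fun z => Real.exp (z ^ 2 / (4 * angT t))) hg]

theorem pdy_phiF (hg : SmoothF g) (t : ℝ) : pdy (phiF t g) = phiF t (pdy g) := by
  have h := SmoothF.weight_mul (contDiff_exp_sq_div (4 * angT t)) hg
  rw [phiF_eq, phiF_eq, pdy_weight_mul (fun z => Real.exp (-(z ^ 2) / (4 * angT t))) h.primZ,
    pdy_primZ h, pdy_weight_mul (fun z => Real.exp (z ^ 2 / (4 * angT t))) hg]

theorem pdh_phiF (hg : SmoothF g) (t : ℝ) (a b : ℕ) :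
    pdh a b (phiF t g) = phiF t (pdh a b g) :=
  pdh_comm_of_pdx_pdy (phiF t) (fun _ hf => pdx_phiF hf t) (fun _ hf => pdy_phiF hf t) hg a b

/-- `u^r = g - z φ / (2⟨t⟩)` -/
theorem ur_eq (hg : SmoothF g) (t : ℝ) :
    ur t g = fun x y z => g x y z - z / (2 * angT t) * phiF t g x y z := by
  funext x y z
  have h := SmoothF.weight_mul (contDiff_exp_sq_div (4 * angT t)) hg
  have h1 := h.primZ.hasDerivAt_pdz x y z
  rw [pdz_primZ h] at h1
  have h2 : HasDerivAt (fun z : ℝ => Real.exp (-(z ^ 2) / (4 * angT t)))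
      (Real.exp (-(z ^ 2) / (4 * angT t)) * (-(2 * z) / (4 * angT t))) z := by
    have := ((hasDerivAt_pow 2 z).neg.div_const (4 * angT t)).exp
    simpa using this
  have h3 := (h2.mul h1).deriv
  rw [ur, phiF_eq]
  refine h3.trans ?_
  have h4 : Real.exp (-(z ^ 2) / (4 * angT t)) * Real.exp (z ^ 2 / (4 * angT t)) = 1 := by
    rw [← Real.exp_add, neg_div, neg_add_cancel, Real.exp_zero]
  linear_combination g x y z * h4

theorem SmoothF.ur (hg : SmoothF g) (t : ℝ) : SmoothF (ur t g) := (hg.phiF t).pdz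

theorem pdh_ur (hg : SmoothF g) (t : ℝ) (a b : ℕ) : pdh a b (ur t g) = ur t (pdh a b g) := by
  rw [_root_.ur, ← pdz_pdh (hg.phiF t), pdh_phiF hg, _root_.ur]

theorem rdr_phiF (hg : SmoothF g) (t : ℝ) : rdr (phiF t g) = phiF t (rdr g) := by
  funext x y z
  simp only [rdr, pdx_phiF hg, pdy_phiF hg, phiF]
  have hx : IntervalIntegrable (fun s => x * (pdx g x y s * Real.exp (s ^ 2 / (4 * angT t))))
      volume 0 z := by
    have := (hg.pdx.contDiff_z x y).continuous
    exact Continuous.intervalIntegrable (by fun_prop) _ _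
  have hy : IntervalIntegrable (fun s => y * (pdy g x y s * Real.exp (s ^ 2 / (4 * angT t))))
      volume 0 z := by
    have := (hg.pdy.contDiff_z x y).continuous
    exact Continuous.intervalIntegrable (by fun_prop) _ _
  simp only [add_mul, mul_assoc]
  rw [intervalIntegral.integral_add hx hy, intervalIntegral.integral_const_mul,
    intervalIntegral.integral_const_mul]
  ring

theorem uzv_eq (hg : SmoothF g) (t : ℝ) :
    uzv t g = fun x y z => -1 * phiF t (rdr g) x y z + -2 * phiF t g x y z := by
  funext x y z
  rw [uzv, rdr_phiF hg]
  ring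

theorem SmoothF.uzv (hg : SmoothF g) (t : ℝ) : SmoothF (uzv t g) := by
  rw [uzv_eq hg]
  exact ((hg.rdr.phiF t).const_mul (-1)).add ((hg.phiF t).const_mul (-2))

theorem pdh_uzv (hg : SmoothF g) (t : ℝ) (a b : ℕ) :
    pdh a b (uzv t g) = fun x y z =>
      -1 * phiF t (pdh a b (rdr g)) x y z + -2 * phiF t (pdh a b g) x y z := by
  rw [uzv_eq hg, pdh_add ((hg.rdr.phiF t).const_mul (-1)) ((hg.phiF t).const_mul (-2)),
    pdh_weight_mul (w := fun _ => -1) (hg.rdr.phiF t),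
    pdh_weight_mul (w := fun _ => -2) (hg.phiF t),
    pdh_phiF hg, pdh_phiF hg.rdr]

theorem SmoothF.z_mul (hf : SmoothF f) : SmoothF (fun x y z => z * f x y z) :=
  SmoothF.weight_mul (w := fun z => z) contDiff_id hf

theorem pdz_z_mul_phiF (hg : SmoothF g) (t : ℝ) :
    pdz (fun x y z => z * phiF t g x y z) = fun x y z => phiF t g x y z + z * ur t g x y z := by
  funext x y z
  have := ((hasDerivAt_id z).mul ((hg.phiF t).hasDerivAt_pdz x y z)).deriv
  refine this.trans ?_
  simp [ur]

theorem pdh_pdz_z_mul_phiF (hg : SmoothF g) (t : ℝ) (a b : ℕ) :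
    pdh a b (pdz fun x y z => z * phiF t g x y z) = fun x y z =>
      phiF t (pdh a b g) x y z + z * ur t (pdh a b g) x y z := by
  rw [← pdz_pdh (hg.phiF t).z_mul, pdh_weight_mul (w := fun z => z) (hg.phiF t), pdh_phiF hg,
    pdz_z_mul_phiF (hg.pdh a b)]

theorem pdz_ur (hg : SmoothF g) (t : ℝ) :
    pdz (ur t g) = fun x y z =>
      pdz g x y z - 1 / (2 * angT t) * (phiF t g x y z + z * ur t g x y z) := by
  funext x y z
  have h := ((hg.hasDerivAt_pdz x y z).sub
    (((hg.phiF t).z_mul.hasDerivAt_pdz x y z).const_mul (1 / (2 * angT t)))).deriv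
  rw [pdz_z_mul_phiF hg] at h
  rw [← h, pdz, ur_eq hg]
  congr 1
  funext z'
  simp only [Pi.sub_apply]
  ring

theorem pdh_pdz_ur (hg : SmoothF g) (t : ℝ) (a b : ℕ) :
    pdh a b (pdz (ur t g)) = fun x y z =>
      pdh a b (pdz g) x y z - 1 / (2 * angT t) *
        (phiF t (pdh a b g) x y z + z * ur t (pdh a b g) x y z) := by
  rw [← pdz_pdh (hg.ur t), pdh_ur hg, pdz_ur (hg.pdh a b), pdz_pdh hg]

section EL2

variable {α : Type*} [MeasurableSpace α] {μ : Measure α} {F G : α → ℝ≥0∞}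

/-- the `L²` seminorm of an `ℝ≥0∞`-valued function -/
def el2 (μ : Measure α) (F : α → ℝ≥0∞) : ℝ≥0∞ := (∫⁻ a, F a ^ 2 ∂μ) ^ (1 / 2 : ℝ)

theorem ennreal_sq_rpow_half (a : ℝ≥0∞) : (a ^ 2) ^ (1 / 2 : ℝ) = a := by
  rw [← ENNReal.rpow_natCast, ← ENNReal.rpow_mul]; norm_num

theorem ennreal_rpow_half_sq (a : ℝ≥0∞) : (a ^ (1 / 2 : ℝ)) ^ 2 = a := by
  rw [← ENNReal.rpow_natCast, ← ENNReal.rpow_mul]; norm_num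

theorem ennreal_pow_two_le_pow_two {a b : ℝ≥0∞} : a ^ 2 ≤ b ^ 2 ↔ a ≤ b :=
  ENNReal.pow_le_pow_left_iff two_ne_zero

theorem el2_sq (μ : Measure α) (F : α → ℝ≥0∞) : el2 μ F ^ 2 = ∫⁻ a, F a ^ 2 ∂μ :=
  ennreal_rpow_half_sq _

theorem el2_le_iff {c : ℝ≥0∞} : el2 μ F ≤ c ↔ ∫⁻ a, F a ^ 2 ∂μ ≤ c ^ 2 := by
  rw [← el2_sq, ennreal_pow_two_le_pow_two]

theorem el2_mono_ae (h : ∀ᵐ a ∂μ, F a ≤ G a) : el2 μ F ≤ el2 μ G := by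
  rw [el2_le_iff, el2_sq]
  refine lintegral_mono_ae ?_
  filter_upwards [h] with a ha
  gcongr

theorem el2_const_mul (c : ℝ≥0∞) (hF : AEMeasurable F μ) :
    el2 μ (fun a => c * F a) = c * el2 μ F := by
  simp only [el2, mul_pow]
  rw [lintegral_const_mul'' _ (hF.pow_const 2), ENNReal.mul_rpow_of_nonneg _ _ (by norm_num),
    ennreal_sq_rpow_half]

theorem lintegral_mul_le_el2 (hF : AEMeasurable F μ) (hG : AEMeasurable G μ) :
    ∫⁻ a, F a * G a ∂μ ≤ el2 μ F * el2 μ G := by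
  have := ENNReal.lintegral_mul_le_Lp_mul_Lq μ Real.HolderConjugate.two_two hF hG
  simpa [el2] using this

theorem el2_add_le (hF : AEMeasurable F μ) (hG : AEMeasurable G μ) :
    el2 μ (fun a => F a + G a) ≤ el2 μ F + el2 μ G := by
  have := ENNReal.lintegral_Lp_add_le hF hG (p := 2) (by norm_num)
  simpa [el2] using this

end EL2

/-- the weight `θ_λ` as an extended nonnegative real -/
def wt (t lam z : ℝ) : ℝ≥0∞ := ENNReal.ofReal (thw t lam z)

theorem wt_mul_wt (t p q z : ℝ) : wt t p z * wt t q z = wt t (p + q) z := by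
  simp only [wt, thw]
  rw [← ENNReal.ofReal_mul (Real.exp_pos _).le, ← Real.exp_add]
  congr 2; ring

theorem enorm_thw (t lam z : ℝ) : ‖thw t lam z‖ₑ = wt t lam z :=
  Real.enorm_of_nonneg (Real.exp_pos _).le

theorem continuous_wt (t lam : ℝ) : Continuous (wt t lam) := by
  unfold wt thw; exact ENNReal.continuous_ofReal.comp (by fun_prop)

theorem wt_mono {t : ℝ} (ht : 0 ≤ t) {p q : ℝ} (hpq : p ≤ q) (z : ℝ) : wt t p z ≤ wt t q z := by
  have : 0 < angT t := by unfold angT; linarith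
  unfold wt thw
  gcongr

theorem wt_zero (t z : ℝ) : wt t 0 z = 1 := by simp [wt, thw]

theorem wt_ne_top (t p z : ℝ) : wt t p z ≠ ∞ := ENNReal.ofReal_ne_top

/-- Lebesgue measure on `(0,∞)` -/
abbrev volPos : Measure ℝ := volume.restrict (Ioi 0)

/-- weighted vertical `L²` norm `‖θ f‖` on `(0,∞)` -/
def vL2 (t : ℝ) (f : ℝ → ℝ) : ℝ≥0∞ := el2 volPos fun z => wt t 1 z * ‖f z‖ₑ

/-- the vertical primitive `φ` of a function of one variable -/
def phi1 (t : ℝ) (f : ℝ → ℝ) (z : ℝ) : ℝ :=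
  Real.exp (-(z ^ 2) / (4 * angT t)) * ∫ s in (0 : ℝ)..z, f s * Real.exp (s ^ 2 / (4 * angT t))

/-- `u^r` for a function of one variable -/
def ur1 (t : ℝ) (f : ℝ → ℝ) (z : ℝ) : ℝ := f z - z / (2 * angT t) * phi1 t f z

/-- `⟨t⟩^{1/4}` as an extended nonnegative real -/
def sig (t : ℝ) : ℝ≥0∞ := ENNReal.ofReal (angT t ^ ((1 : ℝ) / 4))

section Vertical

variable {t : ℝ}

theorem angT_pos (ht : 0 ≤ t) : 0 < angT t := by unfold angT; linarith

theorem one_le_sig (ht : 0 ≤ t) : 1 ≤ sig t := by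
  rw [sig, ENNReal.one_le_ofReal]
  exact Real.one_le_rpow (by unfold angT; linarith) (by norm_num)

theorem sig_sq (ht : 0 ≤ t) : sig t ^ 2 = ENNReal.ofReal (Real.sqrt (angT t)) := by
  rw [sig, ← ENNReal.ofReal_pow (Real.rpow_nonneg (angT_pos ht).le _), ← Real.rpow_natCast,
    ← Real.rpow_mul (angT_pos ht).le, Real.sqrt_eq_rpow]
  norm_num

theorem inv_angT_mul_sig (ht : 0 ≤ t) : ‖(angT t)⁻¹‖ₑ * sig t ^ 4 = 1 := by
  have h : sig t ^ 4 = (sig t ^ 2) ^ 2 := by ring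
  have hT := angT_pos ht
  rw [h, sig_sq ht, ← ENNReal.ofReal_pow (Real.sqrt_nonneg _), Real.sq_sqrt hT.le,
    Real.enorm_of_nonneg (inv_nonneg.2 hT.le), ← ENNReal.ofReal_mul (inv_nonneg.2 hT.le),
    inv_mul_cancel₀ hT.ne', ENNReal.ofReal_one]

theorem inv_angT_mul_sig_cube_le (ht : 0 ≤ t) : ‖(angT t)⁻¹‖ₑ * sig t ^ 3 ≤ 1 := by
  rw [← inv_angT_mul_sig ht]
  gcongr
  · exact one_le_sig ht
  · norm_num

theorem lintegral_wt_neg_half_le (ht : 0 ≤ t) :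
    ∫⁻ z, wt t (-1 / 2) z ≤ 9 * sig t ^ 2 := by
  have hT := angT_pos ht
  have hb : 0 < 1 / (16 * angT t) := by positivity
  have e : ∀ z, thw t (-1 / 2) z = Real.exp (-(1 / (16 * angT t)) * z ^ 2) := fun z => by
    rw [thw]; congr 1; field_simp; ring
  simp only [wt, e]
  rw [← ofReal_integral_eq_lintegral_ofReal (integrable_exp_neg_mul_sq hb)
    (Eventually.of_forall fun z => (Real.exp_pos _).le), integral_gaussian, sig_sq ht,
    show (9 : ℝ≥0∞) = ENNReal.ofReal 9 by norm_num, ← ENNReal.ofReal_mul (by norm_num)]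
  refine ENNReal.ofReal_le_ofReal (Real.sqrt_le_iff.2 ⟨by positivity, ?_⟩)
  rw [mul_pow, Real.sq_sqrt hT.le]
  have hpi := Real.pi_lt_four
  have : Real.pi / (1 / (16 * angT t)) = 16 * Real.pi * angT t := by field_simp
  rw [this]
  nlinarith

theorem el2_wt_le (ht : 0 ≤ t) {p : ℝ} (hp : p ≤ -1 / 4) : el2 volPos (wt t p) ≤ 3 * sig t := by
  rw [el2_le_iff]
  calc ∫⁻ z in Ioi 0, wt t p z ^ 2 ≤ ∫⁻ z, wt t p z ^ 2 := setLIntegral_le_lintegral _ _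
    _ ≤ ∫⁻ z, wt t (-1 / 2) z := by
      refine lintegral_mono fun z => ?_
      rw [sq, wt_mul_wt]
      exact wt_mono ht (by linarith) z
    _ ≤ 9 * sig t ^ 2 := lintegral_wt_neg_half_le ht
    _ = (3 * sig t) ^ 2 := by rw [mul_pow]; norm_num

theorem enorm_mul_wt_le (ht : 0 ≤ t) {p : ℝ} (hp : p ≤ -1 / 4) (z : ℝ) :
    ‖z‖ₑ * wt t p z ≤ 6 * sig t ^ 2 := by
  have hT := angT_pos ht
  have hS : 0 < Real.sqrt (angT t) := Real.sqrt_pos.2 hT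
  refine (mul_le_mul_right (wt_mono ht hp z) _).trans ?_
  rw [sig_sq ht, wt, Real.enorm_eq_ofReal_abs, ← ENNReal.ofReal_mul (abs_nonneg _),
    show (6 : ℝ≥0∞) = ENNReal.ofReal 6 by norm_num, ← ENNReal.ofReal_mul (by norm_num)]
  refine ENNReal.ofReal_le_ofReal ?_
  have e : thw t (-1 / 4) z = (Real.exp (z ^ 2 / (32 * angT t)))⁻¹ := by
    rw [thw, ← Real.exp_neg]; congr 1; field_simp; ring
  rw [e, ← div_eq_mul_inv, div_le_iff₀ (Real.exp_pos _)]
  have h1 := Real.add_one_le_exp (z ^ 2 / (32 * angT t))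
  have h2 : |z| ≤ 6 * Real.sqrt (angT t) * (z ^ 2 / (32 * angT t) + 1) := by
    have : 6 * Real.sqrt (angT t) * (z ^ 2 / (32 * angT t) + 1) =
        (6 * z ^ 2 + 192 * angT t) / (32 * Real.sqrt (angT t)) := by
      have := Real.sq_sqrt hT.le
      field_simp
      rw [this]; ring
    rw [this, le_div_iff₀ (by positivity)]
    nlinarith [sq_nonneg (|z| - 3 * Real.sqrt (angT t)), Real.sq_sqrt hT.le, sq_abs z,
      abs_nonneg z]
  exact h2.trans (by gcongr)

theorem el2_enorm_mul_wt_le (ht : 0 ≤ t) {p : ℝ} (hp : p ≤ -1 / 2) :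
    el2 volPos (fun z => ‖z‖ₑ * wt t p z) ≤ 18 * sig t ^ 3 := by
  calc el2 volPos (fun z => ‖z‖ₑ * wt t p z)
      ≤ el2 volPos (fun z => 6 * sig t ^ 2 * wt t (-1 / 4) z) := by
        refine el2_mono_ae (Eventually.of_forall fun z => ?_)
        have : wt t p z = wt t (p + 1 / 4) z * wt t (-1 / 4) z := by
          rw [wt_mul_wt]; congr 1; ring
        rw [this, ← mul_assoc]
        exact mul_le_mul' (enorm_mul_wt_le ht (by linarith) z) le_rfl
    _ = 6 * sig t ^ 2 * el2 volPos (wt t (-1 / 4)) :=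
        el2_const_mul _ (continuous_wt _ _).aemeasurable
    _ ≤ 6 * sig t ^ 2 * (3 * sig t) := by gcongr; exact el2_wt_le ht le_rfl
    _ = 18 * sig t ^ 3 := by ring

theorem continuous_phi1 {f : ℝ → ℝ} (hf : Continuous f) : Continuous (phi1 t f) := by
  unfold phi1
  refine Continuous.mul (by fun_prop) ?_
  exact intervalIntegral.continuous_primitive
    (fun a b => Continuous.intervalIntegrable (by fun_prop) a b) 0

theorem continuous_ur1 {f : ℝ → ℝ} (hf : Continuous f) : Continuous (ur1 t f) := by
  have := continuous_phi1 (t := t) hf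
  unfold ur1
  fun_prop

theorem aemeasurable_wt_mul {f : ℝ → ℝ} (hf : Continuous f) (p : ℝ) {μ : Measure ℝ} :
    AEMeasurable (fun z => wt t p z * ‖f z‖ₑ) μ :=
  ((continuous_wt t p).measurable.mul hf.enorm.measurable).aemeasurable

/-- the kernel bound for `θ φ` -/
theorem wt_mul_enorm_phi1_le (f : ℝ → ℝ) {z : ℝ} (hz : 0 < z) :
    wt t 1 z * ‖phi1 t f z‖ₑ ≤
      ∫⁻ s in Ioc 0 z, wt t (-1) z * wt t 1 s * (wt t 1 s * ‖f s‖ₑ) := by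
  have h1 : ‖Real.exp (-(z ^ 2) / (4 * angT t))‖ₑ = wt t (-2) z := by
    rw [← enorm_thw, thw]; congr 2; ring
  have h2 : ∀ s, ‖Real.exp (s ^ 2 / (4 * angT t))‖ₑ = wt t 2 s := fun s => by
    rw [← enorm_thw, thw]; congr 2; ring
  have h3 : wt t 1 z * wt t (-2) z = wt t (-1) z := by rw [wt_mul_wt]; norm_num
  have h4 : ∀ s, wt t 1 s * wt t 1 s = wt t 2 s := fun s => by rw [wt_mul_wt]; norm_num
  rw [phi1, enorm_mul, h1, ← mul_assoc, h3, intervalIntegral.integral_of_le hz.le]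
  calc _ ≤ wt t (-1) z * ∫⁻ s in Ioc 0 z, ‖f s * Real.exp (s ^ 2 / (4 * angT t))‖ₑ := by
        gcongr; exact enorm_integral_le_lintegral_enorm _
    _ = _ := by
        rw [← lintegral_const_mul' _ _ (wt_ne_top _ _ _)]
        refine lintegral_congr fun s => ?_
        rw [enorm_mul, h2, ← h4]
        ring

theorem wt_neg_mul_wt_le (ht : 0 ≤ t) {s z : ℝ} (hs : 0 ≤ s) (hsz : s ≤ z) :
    wt t (-1) z * wt t 1 s ≤ wt t (-1) (z - s) := by
  have hT := angT_pos ht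
  simp only [wt, thw]
  rw [← ENNReal.ofReal_mul (Real.exp_pos _).le, ← Real.exp_add]
  refine ENNReal.ofReal_le_ofReal (Real.exp_le_exp.2 ?_)
  rw [← add_div]
  gcongr
  nlinarith

/-- `sup_z θ|φ| ≲ ⟨t⟩^{1/4} ‖θ f‖` -/
theorem wt_mul_enorm_phi1_le_vL2 (ht : 0 ≤ t) {f : ℝ → ℝ} (hf : Continuous f) {z : ℝ}
    (hz : 0 < z) : wt t 1 z * ‖phi1 t f z‖ₑ ≤ 3 * sig t * vL2 t f := by
  have hm : Measurable fun s => wt t (-1) (z - s) :=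
    ((continuous_wt t (-1)).comp (continuous_const.sub continuous_id)).measurable
  calc wt t 1 z * ‖phi1 t f z‖ₑ
      ≤ ∫⁻ s in Ioc 0 z, wt t (-1) z * wt t 1 s * (wt t 1 s * ‖f s‖ₑ) :=
        wt_mul_enorm_phi1_le f hz
    _ ≤ ∫⁻ s in Ioc 0 z, wt t (-1) (z - s) * (wt t 1 s * ‖f s‖ₑ) := by
        refine setLIntegral_mono' measurableSet_Ioc fun s hs => ?_
        gcongr
        exact wt_neg_mul_wt_le ht hs.1.le hs.2
    _ ≤ ∫⁻ s in Ioi 0, wt t (-1) (z - s) * (wt t 1 s * ‖f s‖ₑ) :=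
        lintegral_mono_set Ioc_subset_Ioi_self
    _ ≤ el2 volPos (fun s => wt t (-1) (z - s)) * vL2 t f :=
        lintegral_mul_le_el2 hm.aemeasurable (aemeasurable_wt_mul hf 1)
    _ ≤ 3 * sig t * vL2 t f := by
        gcongr
        rw [el2_le_iff]
        calc ∫⁻ s in Ioi 0, wt t (-1) (z - s) ^ 2 ≤ ∫⁻ s, wt t (-1) (z - s) ^ 2 :=
              setLIntegral_le_lintegral _ _
          _ ≤ ∫⁻ s, wt t (-1 / 2) (z - s) := by
              refine lintegral_mono fun s => ?_
              rw [sq, wt_mul_wt]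
              exact wt_mono ht (by norm_num) _
          _ = ∫⁻ s, wt t (-1 / 2) s := lintegral_sub_left_eq_self _ z
          _ ≤ 9 * sig t ^ 2 := lintegral_wt_neg_half_le ht
          _ = (3 * sig t) ^ 2 := by rw [mul_pow]; norm_num

end Vertical

theorem lintegral_Ioc_swap {F : ℝ → ℝ → ℝ≥0∞} (hF : Measurable (Function.uncurry F)) :
    ∫⁻ z in Ioi 0, ∫⁻ s in Ioc 0 z, F z s = ∫⁻ s in Ioi 0, ∫⁻ z in Ici s, F z s := by
  have hm : Measurable (Function.uncurry fun z s => (Iic z).indicator (F z) s) := by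
    have : (Function.uncurry fun z s => (Iic z).indicator (F z) s) =
        {p : ℝ × ℝ | p.2 ≤ p.1}.indicator (Function.uncurry F) := by
      ext ⟨z, s⟩
      simp [indicator]
    rw [this]
    exact hF.indicator (measurableSet_le measurable_snd measurable_fst)
  have h1 : ∀ z : ℝ, ∫⁻ s in Ioc 0 z, F z s = ∫⁻ s in Ioi 0, (Iic z).indicator (F z) s := fun z => by
    rw [lintegral_indicator measurableSet_Iic, Measure.restrict_restrict measurableSet_Iic,
      inter_comm, Ioi_inter_Iic]
  have h2 : ∀ s ∈ Ioi (0 : ℝ), ∫⁻ z in Ioi 0, (Iic z).indicator (F z) s = ∫⁻ z in Ici s, F z s :=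
    fun s hs => by
    have : ∀ z, (Iic z).indicator (F z) s = (Ici s).indicator (fun z => F z s) z := fun z => by
      simp [indicator]
    simp only [this]
    rw [lintegral_indicator measurableSet_Ici, Measure.restrict_restrict measurableSet_Ici,
      inter_eq_left.2 (Ici_subset_Ioi.2 hs)]
  simp only [h1]
  rw [lintegral_lintegral_swap hm.aemeasurable]
  exact setLIntegral_congr_fun measurableSet_Ioi h2

theorem wt_neg_sq_swap (t z s : ℝ) :
    wt t (-1) z * wt t 1 s = (wt t (-1 / 2) z * wt t (1 / 2) s) ^ 2 := by
  rw [mul_pow, sq, sq, wt_mul_wt, wt_mul_wt]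
  norm_num

section Vertical

variable {t : ℝ} (ht : 0 ≤ t)

include ht in
theorem lintegral_kernel_row_le {z : ℝ} (hz : 0 < z) :
    ‖(angT t)⁻¹‖ₑ * ‖z‖ₑ * ∫⁻ s in Ioc 0 z, wt t (-1) z * wt t 1 s ≤ 8 := by
  have hT := angT_pos ht
  have h1 : ∫⁻ s in Ioc 0 z, wt t (-1) z * wt t 1 s ≤
      ENNReal.ofReal (∫ s in (0 : ℝ)..z, Real.exp (z / (8 * angT t) * s + -(z ^ 2 / (8 * angT t)))) := by
    rw [intervalIntegral.integral_of_le hz.le, ofReal_integral_eq_lintegral_ofReal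
      (((by fun_prop : Continuous fun s : ℝ =>
        Real.exp (z / (8 * angT t) * s + -(z ^ 2 / (8 * angT t)))).intervalIntegrable 0 z).1)
      (Eventually.of_forall fun s => (Real.exp_pos _).le)]
    refine setLIntegral_mono' measurableSet_Ioc fun s hs => ?_
    simp only [wt, thw]
    rw [← ENNReal.ofReal_mul (Real.exp_pos _).le, ← Real.exp_add]
    refine ENNReal.ofReal_le_ofReal (Real.exp_le_exp.2 ?_)
    have : z / (8 * angT t) * s + -(z ^ 2 / (8 * angT t)) =
      (-1 * z ^ 2 + z * s) / (8 * angT t) := by ring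
    rw [this, ← add_div]
    refine div_le_div_of_nonneg_right ?_ (by positivity)
    nlinarith [mul_le_mul_of_nonneg_left hs.2 hs.1.le]
  have h2 : ∫ s in (0 : ℝ)..z, Real.exp (z / (8 * angT t) * s + -(z ^ 2 / (8 * angT t))) ≤
      8 * angT t / z := by
    have hc : z / (8 * angT t) ≠ 0 := by positivity
    rw [intervalIntegral.integral_comp_mul_add Real.exp hc, integral_exp, smul_eq_mul, inv_div]
    have : z / (8 * angT t) * z + -(z ^ 2 / (8 * angT t)) = 0 := by ring
    rw [this, Real.exp_zero]
    have := Real.exp_pos (z / (8 * angT t) * 0 + -(z ^ 2 / (8 * angT t)))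
    have hp : 0 < 8 * angT t / z := by positivity
    nlinarith
  calc _ ≤ ‖(angT t)⁻¹‖ₑ * ‖z‖ₑ * ENNReal.ofReal (8 * angT t / z) := by
        gcongr; exact h1.trans (ENNReal.ofReal_le_ofReal h2)
    _ = 8 := by
        rw [Real.enorm_of_nonneg (inv_pos.2 hT).le, Real.enorm_of_nonneg hz.le,
          ← ENNReal.ofReal_mul (inv_pos.2 hT).le, ← ENNReal.ofReal_mul (by positivity)]
        have : (angT t)⁻¹ * z * (8 * angT t / z) = 8 := by field_simp
        rw [this]; norm_num

include ht in
theorem lintegral_kernel_column_le {s : ℝ} (hs : 0 < s) :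
    ∫⁻ z in Ici s, ‖(angT t)⁻¹‖ₑ * ‖z‖ₑ * (wt t (-1) z * wt t 1 s) ≤ 4 := by
  have hT := angT_pos ht
  let F : ℝ → ℝ := fun z => -4 * Real.exp ((s ^ 2 - z ^ 2) / (8 * angT t))
  have hd : ∀ z, HasDerivAt F ((angT t)⁻¹ * z * Real.exp ((s ^ 2 - z ^ 2) / (8 * angT t))) z :=
    fun z => by
    have h := ((((hasDerivAt_pow 2 z).const_sub (s ^ 2)).div_const (8 * angT t)).exp).const_mul (-4)
    refine h.congr_deriv ?_
    field_simp
    norm_num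
    ring
  have hlim : Tendsto F atTop (nhds 0) := by
    have h1 : Tendsto (fun z : ℝ => (s ^ 2 - z ^ 2) / (8 * angT t)) atTop atBot := by
      refine Tendsto.atBot_div_const (by positivity) ?_
      exact tendsto_atBot_add_const_left _ _ (tendsto_neg_atTop_atBot.comp
        (tendsto_pow_atTop two_ne_zero))
    simpa [F] using (Real.tendsto_exp_atBot.comp h1).const_mul (-4)
  have hpos : ∀ z ∈ Ioi s, 0 ≤ (angT t)⁻¹ * z * Real.exp ((s ^ 2 - z ^ 2) / (8 * angT t)) :=
    fun z hz => by
    have : 0 < z := hs.trans hz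
    positivity
  have hI := integral_Ioi_of_hasDerivAt_of_nonneg' (fun z _ => hd z) hpos hlim
  have hi := integrableOn_Ioi_deriv_of_nonneg' (fun z _ => hd z) hpos hlim
  rw [setLIntegral_congr Ioi_ae_eq_Ici.symm]
  have : ∀ z ∈ Ioi s, ‖(angT t)⁻¹‖ₑ * ‖z‖ₑ * (wt t (-1) z * wt t 1 s) =
      ENNReal.ofReal ((angT t)⁻¹ * z * Real.exp ((s ^ 2 - z ^ 2) / (8 * angT t))) := fun z hz => by
    have hz' : 0 < z := hs.trans hz
    simp only [wt, thw]
    rw [Real.enorm_of_nonneg (inv_pos.2 hT).le, Real.enorm_of_nonneg hz'.le,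
      ← ENNReal.ofReal_mul (Real.exp_pos _).le, ← ENNReal.ofReal_mul (inv_pos.2 hT).le,
      ← ENNReal.ofReal_mul (by positivity), ← Real.exp_add]
    congr 3
    ring
  rw [setLIntegral_congr_fun measurableSet_Ioi this,
    ← ofReal_integral_eq_lintegral_ofReal hi
      ((ae_restrict_iff' measurableSet_Ioi).2 (Eventually.of_forall hpos)), hI]
  simp [F]

theorem measurable_wt (t p : ℝ) : Measurable (wt t p) := (continuous_wt t p).measurable

include ht in
theorem el2_enorm_mul_wt_mul_enorm_phi1_le {f : ℝ → ℝ} (hf : Continuous f) :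
    el2 volPos (fun z => ‖(angT t)⁻¹‖ₑ * ‖z‖ₑ * (wt t 1 z * ‖phi1 t f z‖ₑ)) ≤ 6 * vL2 t f := by
  set h : ℝ → ℝ≥0∞ := fun s => wt t 1 s * ‖f s‖ₑ with hh
  have hmh : Measurable h := (measurable_wt t 1).mul hf.enorm.measurable
  set δ : ℝ≥0∞ := ‖(angT t)⁻¹‖ₑ with hδ
  have hmw := measurable_wt t
  have hpt : ∀ z ∈ Ioi (0 : ℝ), (δ * ‖z‖ₑ * (wt t 1 z * ‖phi1 t f z‖ₑ)) ^ 2 ≤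
      8 * ∫⁻ s in Ioc 0 z, δ * ‖z‖ₑ * (wt t (-1) z * wt t 1 s) * h s ^ 2 := fun z hz => by
    calc (δ * ‖z‖ₑ * (wt t 1 z * ‖phi1 t f z‖ₑ)) ^ 2
        ≤ (δ * ‖z‖ₑ * ∫⁻ s in Ioc 0 z, (wt t (-1 / 2) z * wt t (1 / 2) s) *
            ((wt t (-1 / 2) z * wt t (1 / 2) s) * h s)) ^ 2 := by
          gcongr
          refine (wt_mul_enorm_phi1_le f hz).trans (le_of_eq (lintegral_congr fun s => ?_))
          rw [wt_neg_sq_swap, sq, mul_assoc]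
      _ ≤ (δ * ‖z‖ₑ * (el2 (volume.restrict (Ioc 0 z)) (fun s => wt t (-1 / 2) z * wt t (1 / 2) s) *
            el2 (volume.restrict (Ioc 0 z))
              fun s => (wt t (-1 / 2) z * wt t (1 / 2) s) * h s)) ^ 2 := by
          gcongr
          exact lintegral_mul_le_el2 (by fun_prop) (by fun_prop)
      _ = (δ * ‖z‖ₑ * ∫⁻ s in Ioc 0 z, wt t (-1) z * wt t 1 s) *
            (δ * ‖z‖ₑ * ∫⁻ s in Ioc 0 z, (wt t (-1) z * wt t 1 s) * h s ^ 2) := by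
          simp only [mul_pow, el2_sq, wt_neg_sq_swap]
          ring
      _ ≤ 8 * (δ * ‖z‖ₑ * ∫⁻ s in Ioc 0 z, (wt t (-1) z * wt t 1 s) * h s ^ 2) := by
          gcongr
          exact lintegral_kernel_row_le ht hz
      _ = _ := by
          rw [← lintegral_const_mul _ (by fun_prop)]
          simp only [mul_assoc]
  rw [el2_le_iff]
  calc _ ≤ ∫⁻ z in Ioi 0, 8 * ∫⁻ s in Ioc 0 z, δ * ‖z‖ₑ * (wt t (-1) z * wt t 1 s) * h s ^ 2 :=
        setLIntegral_mono' measurableSet_Ioi hpt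
    _ = 8 * ∫⁻ s in Ioi 0, ∫⁻ z in Ici s, δ * ‖z‖ₑ * (wt t (-1) z * wt t 1 s) * h s ^ 2 := by
        rw [lintegral_const_mul' _ _ (by norm_num), lintegral_Ioc_swap]
        unfold Function.uncurry
        fun_prop
    _ ≤ 8 * ∫⁻ s in Ioi 0, 4 * h s ^ 2 := by
        gcongr 8 * ?_
        refine setLIntegral_mono' measurableSet_Ioi fun s hs => ?_
        rw [lintegral_mul_const _ (by fun_prop)]
        gcongr
        exact lintegral_kernel_column_le ht hs
    _ = 32 * ∫⁻ s in Ioi 0, h s ^ 2 := by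
        rw [lintegral_const_mul' _ _ (by norm_num), ← mul_assoc]; norm_num
    _ ≤ (6 * vL2 t f) ^ 2 := by
        rw [mul_pow, vL2, el2_sq]
        gcongr
        norm_num

include ht in
theorem vL2_ur1_le {f : ℝ → ℝ} (hf : Continuous f) : vL2 t (ur1 t f) ≤ 4 * vL2 t f := by
  have hp := (continuous_phi1 (t := t) hf).enorm.measurable
  have hf' := hf.enorm.measurable
  have hmw := measurable_wt t
  calc vL2 t (ur1 t f) ≤ el2 volPos (fun z => wt t 1 z * ‖f z‖ₑ +
        2⁻¹ * (‖(angT t)⁻¹‖ₑ * ‖z‖ₑ * (wt t 1 z * ‖phi1 t f z‖ₑ))) := by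
        refine el2_mono_ae (Eventually.of_forall fun z => ?_)
        have h2 : ‖(2 : ℝ)⁻¹‖ₑ = 2⁻¹ := by
          rw [Real.enorm_of_nonneg (by norm_num), ENNReal.ofReal_inv_of_pos (by norm_num)]
          norm_num
        have e : z / (2 * angT t) * phi1 t f z =
            2⁻¹ * ((angT t)⁻¹ * z * phi1 t f z) := by field_simp
        have h := enorm_sub_le (a := f z) (b := z / (2 * angT t) * phi1 t f z)
        rw [e, enorm_mul, enorm_mul, enorm_mul, h2, ← e] at h
        calc _ ≤ _ := mul_le_mul_right h _
          _ = _ := by ring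
    _ ≤ vL2 t f + 2⁻¹ * (6 * vL2 t f) := by
        refine (el2_add_le (by fun_prop) (by fun_prop)).trans ?_
        rw [el2_const_mul _ (by fun_prop)]
        gcongr
        · exact le_rfl
        · exact el2_enorm_mul_wt_mul_enorm_phi1_le ht hf
    _ = 4 * vL2 t f := by
        rw [← mul_assoc, show (2⁻¹ * 6 : ℝ≥0∞) = 3 by
          rw [show (6 : ℝ≥0∞) = 2 * 3 by norm_num, ← mul_assoc,
            ENNReal.inv_mul_cancel (by norm_num) (by norm_num), one_mul]]
        ring

include ht in
theorem enorm_le_vL2_deriv {f f' : ℝ → ℝ} (hd : ∀ z, HasDerivAt f (f' z) z) (hf' : Continuous f')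
    (hlim : Tendsto f atTop (nhds 0)) {z : ℝ} (hz : 0 < z) : ‖f z‖ₑ ≤ 3 * sig t * vL2 t f' := by
  have key : ∀ w, z ≤ w → ‖f z‖ₑ ≤ ‖f w‖ₑ + 3 * sig t * vL2 t f' := fun w hw => by
    have h1 := intervalIntegral.integral_eq_sub_of_hasDerivAt (fun x _ => hd x)
      (hf'.intervalIntegrable z w)
    have h2 : f z = f w - ∫ s in z..w, f' s := by rw [h1]; ring
    have h3 : ‖∫ s in z..w, f' s‖ₑ ≤ 3 * sig t * vL2 t f' := by
      rw [intervalIntegral.integral_of_le hw]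
      calc _ ≤ ∫⁻ s in Ioc z w, ‖f' s‖ₑ := enorm_integral_le_lintegral_enorm _
        _ ≤ ∫⁻ s in Ioi 0, ‖f' s‖ₑ :=
            lintegral_mono_set fun s hs => hz.trans hs.1
        _ = ∫⁻ s in Ioi 0, wt t (-1) s * (wt t 1 s * ‖f' s‖ₑ) := by
            refine lintegral_congr fun s => ?_
            rw [← mul_assoc, wt_mul_wt, neg_add_cancel, wt_zero, one_mul]
        _ ≤ el2 volPos (wt t (-1)) * vL2 t f' :=
            lintegral_mul_le_el2 (measurable_wt t _).aemeasurable (aemeasurable_wt_mul hf' 1)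
        _ ≤ _ := by
            gcongr
            exact el2_wt_le ht (by norm_num)
    calc ‖f z‖ₑ = ‖f w - ∫ s in z..w, f' s‖ₑ := by rw [h2]
      _ ≤ ‖f w‖ₑ + ‖∫ s in z..w, f' s‖ₑ := enorm_sub_le
      _ ≤ _ := by gcongr
  have hl : Tendsto (fun w => ‖f w‖ₑ + 3 * sig t * vL2 t f') atTop
      (nhds (0 + 3 * sig t * vL2 t f')) := by
    refine Tendsto.add ?_ tendsto_const_nhds
    simpa using hlim.enorm
  rw [zero_add] at hl
  exact ge_of_tendsto hl (eventually_atTop.2 ⟨z, key⟩)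

include ht in
theorem enorm_ur1_le {f f' : ℝ → ℝ} (hf : Continuous f) (hd : ∀ z, HasDerivAt f (f' z) z)
    (hf' : Continuous f') (hlim : Tendsto f atTop (nhds 0)) {z : ℝ} (hz : 0 < z) :
    ‖ur1 t f z‖ₑ ≤ 18 * (vL2 t f + sig t * vL2 t f') := by
  have h1 : ‖z / (2 * angT t) * phi1 t f z‖ₑ ≤ 18 * vL2 t f := by
    have hle : ‖z / (2 * angT t)‖ₑ ≤ ‖(angT t)⁻¹‖ₑ * ‖z‖ₑ := by
      have hT := angT_pos ht
      rw [← enorm_mul, Real.enorm_of_nonneg (by positivity), Real.enorm_of_nonneg (by positivity)]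
      refine ENNReal.ofReal_le_ofReal ?_
      rw [inv_mul_eq_div]
      gcongr
      linarith
    calc ‖z / (2 * angT t) * phi1 t f z‖ₑ
        ≤ ‖(angT t)⁻¹‖ₑ * ‖z‖ₑ * ‖phi1 t f z‖ₑ := by rw [enorm_mul]; gcongr
      _ = ‖(angT t)⁻¹‖ₑ * (‖z‖ₑ * wt t (-1) z) * (wt t 1 z * ‖phi1 t f z‖ₑ) := by
          have : wt t (-1) z * wt t 1 z = 1 := by rw [wt_mul_wt, neg_add_cancel, wt_zero]
          calc _ = ‖(angT t)⁻¹‖ₑ * ‖z‖ₑ * (wt t (-1) z * wt t 1 z) * ‖phi1 t f z‖ₑ := by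
                rw [this, mul_one]
            _ = _ := by ring
      _ ≤ ‖(angT t)⁻¹‖ₑ * (6 * sig t ^ 2) * (3 * sig t * vL2 t f) := by
          exact mul_le_mul' (mul_le_mul' le_rfl (enorm_mul_wt_le ht (by norm_num) z))
            (wt_mul_enorm_phi1_le_vL2 ht hf hz)
      _ = 18 * (‖(angT t)⁻¹‖ₑ * sig t ^ 3) * vL2 t f := by ring
      _ ≤ 18 * 1 * vL2 t f := by gcongr; exact inv_angT_mul_sig_cube_le ht
      _ = _ := by ring
  calc ‖ur1 t f z‖ₑ ≤ ‖f z‖ₑ + ‖z / (2 * angT t) * phi1 t f z‖ₑ := enorm_sub_le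
    _ ≤ 3 * sig t * vL2 t f' + 18 * vL2 t f := by
        gcongr
        exact enorm_le_vL2_deriv ht hd hf' hlim hz
    _ ≤ 18 * sig t * vL2 t f' + 18 * vL2 t f := by gcongr; norm_num
    _ = _ := by ring

end Vertical

/-- the vertical weighted `L¹` functional controlling the nonlocal terms -/
def vL1 (t : ℝ) (q : ℝ → ℝ) : ℝ≥0∞ :=
  18 * sig t ^ 3 * ∫⁻ s in Ioi 0, wt t (3 / 2) s * ‖q s‖ₑ

section Functionals

variable {t : ℝ} {q k : ℝ → ℝ}

theorem vL2_mono_ae {c : ℝ≥0∞} {q k : ℝ → ℝ} (hk : Continuous k)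
    (h : ∀ z, 0 < z → ‖q z‖ₑ ≤ c * ‖k z‖ₑ) : vL2 t q ≤ c * vL2 t k := by
  rw [vL2, vL2, ← el2_const_mul _ (aemeasurable_wt_mul hk 1)]
  refine el2_mono_ae ((ae_restrict_iff' measurableSet_Ioi).2 (Eventually.of_forall fun z hz => ?_))
  calc _ ≤ wt t 1 z * (c * ‖k z‖ₑ) := by gcongr; exact h z hz
    _ = _ := by ring

theorem vL2_const_mul (c : ℝ) (hq : Continuous q) :
    vL2 t (fun z => c * q z) = ‖c‖ₑ * vL2 t q := by
  rw [vL2, vL2, ← el2_const_mul _ (aemeasurable_wt_mul hq 1)]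
  congr 1
  ext z
  rw [enorm_mul]
  ring

theorem vL2_add_le (hq : Continuous q) (hk : Continuous k) :
    vL2 t (fun z => q z + k z) ≤ vL2 t q + vL2 t k := by
  refine le_trans (el2_mono_ae (Eventually.of_forall fun z => ?_))
    (el2_add_le (aemeasurable_wt_mul hq 1) (aemeasurable_wt_mul hk 1))
  rw [← mul_add]
  gcongr
  exact enorm_add_le _ _

theorem vL1_const_mul (c : ℝ) : vL1 t (fun z => c * q z) = ‖c‖ₑ * vL1 t q := by
  have : ∀ s, wt t (3 / 2) s * ‖c * q s‖ₑ = ‖c‖ₑ * (wt t (3 / 2) s * ‖q s‖ₑ) := fun s => by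
    rw [enorm_mul]; ring
  simp only [vL1, this]
  rw [lintegral_const_mul' _ _ enorm_ne_top]
  ring

theorem vL1_add_le (hq : Continuous q) :
    vL1 t (fun z => q z + k z) ≤ vL1 t q + vL1 t k := by
  have hm : Measurable fun s => wt t (3 / 2) s * ‖q s‖ₑ :=
    (measurable_wt t _).mul hq.enorm.measurable
  rw [vL1, vL1, vL1, ← mul_add, ← lintegral_add_left hm]
  gcongr with s
  rw [← mul_add]
  gcongr
  exact enorm_add_le _ _

theorem lintegral_wt_two_mul_le (hq : Continuous q) (hk : Continuous k) :
    ∫⁻ z in Ioi 0, wt t 2 z * ‖q z‖ₑ * ‖k z‖ₑ ≤ vL2 t q * vL2 t k := by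
  refine le_trans (le_of_eq (lintegral_congr fun z => ?_))
    (lintegral_mul_le_el2 (aemeasurable_wt_mul hq 1) (aemeasurable_wt_mul hk 1))
  have : wt t 2 z = wt t 1 z * wt t 1 z := by rw [wt_mul_wt]; norm_num
  rw [this]
  ring

theorem lintegral_nonlocal_le (ht : 0 ≤ t) (hk : Continuous k) :
    ∫⁻ z in Ioi 0, ‖z‖ₑ * wt t 2 z * (∫⁻ s in Ioi z, ‖q s‖ₑ) * ‖k z‖ₑ ≤ vL1 t q * vL2 t k := by
  have hT := angT_pos ht
  set A := ∫⁻ s in Ioi 0, wt t (3 / 2) s * ‖q s‖ₑ with hA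
  have h1 : ∀ z ∈ Ioi (0 : ℝ), wt t (3 / 2) z * ∫⁻ s in Ioi z, ‖q s‖ₑ ≤ A := fun z hz => by
    rw [← lintegral_const_mul' _ _ (wt_ne_top _ _ _)]
    calc _ ≤ ∫⁻ s in Ioi z, wt t (3 / 2) s * ‖q s‖ₑ := by
          refine setLIntegral_mono' measurableSet_Ioi fun s hs => ?_
          have hz' : (0 : ℝ) ≤ z := le_of_lt hz
          have hs' : z ≤ s := le_of_lt hs
          gcongr
          unfold wt thw
          gcongr
      _ ≤ A := lintegral_mono_set (Ioi_subset_Ioi (le_of_lt hz))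
  calc _ ≤ ∫⁻ z in Ioi 0, A * ((‖z‖ₑ * wt t (-1 / 2) z) * (wt t 1 z * ‖k z‖ₑ)) := by
        refine setLIntegral_mono' measurableSet_Ioi fun z hz => ?_
        have : wt t 2 z = wt t (3 / 2) z * (wt t (-1 / 2) z * wt t 1 z) := by
          rw [wt_mul_wt, wt_mul_wt]; norm_num
        calc _ = (wt t (3 / 2) z * ∫⁻ s in Ioi z, ‖q s‖ₑ) *
              ((‖z‖ₑ * wt t (-1 / 2) z) * (wt t 1 z * ‖k z‖ₑ)) := by rw [this]; ring
          _ ≤ _ := by gcongr; exact h1 z hz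
    _ = A * ∫⁻ z in Ioi 0, (‖z‖ₑ * wt t (-1 / 2) z) * (wt t 1 z * ‖k z‖ₑ) := by
        have := measurable_wt t
        have := hk.enorm.measurable
        exact lintegral_const_mul _ (by fun_prop)
    _ ≤ A * (18 * sig t ^ 3 * vL2 t k) := by
        gcongr
        refine (lintegral_mul_le_el2 ?_ (aemeasurable_wt_mul hk 1)).trans ?_
        · have := measurable_wt t
          fun_prop
        · exact mul_le_mul' (el2_enorm_mul_wt_le ht le_rfl) le_rfl
    _ = _ := by rw [vL1]; ring

end Functionals

section Bilinear

variable {t : ℝ} (ht : 0 ≤ t) {f f' h0 h1 : ℝ → ℝ} (hf : Continuous f)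
  (hd : ∀ z, HasDerivAt f (f' z) z) (hf' : Continuous f') (hlim : Tendsto f atTop (nhds 0))
  (hh0 : Continuous h0) (hh1 : Continuous h1) {E H : ℝ≥0∞}
  (hE : vL2 t f ≤ E) (hE' : sig t * vL2 t f' ≤ E) (hH0 : vL2 t h0 ≤ H) (hH1 : vL2 t h1 ≤ H)

/-- the vertical profile of `∂^α u^z` -/
def uz1 (t : ℝ) (h0 h1 : ℝ → ℝ) (z : ℝ) : ℝ := -1 * phi1 t h1 z + -2 * phi1 t h0 z

/-- the vertical profile of `∂_z(zφ)` -/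
def dzphi1 (t : ℝ) (f : ℝ → ℝ) (z : ℝ) : ℝ := phi1 t f z + z * ur1 t f z

/-- the vertical profile of `∂_z u^r` -/
def dur1 (t : ℝ) (f f' : ℝ → ℝ) (z : ℝ) : ℝ := f' z - 1 / (2 * angT t) * dzphi1 t f z

include hf in
theorem continuous_dzphi1 : Continuous (dzphi1 t f) := by
  have := continuous_phi1 (t := t) hf
  have := continuous_ur1 (t := t) hf
  unfold dzphi1
  fun_prop

include hf hf' in
theorem continuous_dur1 : Continuous (dur1 t f f') := by
  have := continuous_dzphi1 (t := t) hf
  unfold dur1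
  fun_prop

include ht hh0 hh1 hH0 hH1 in
theorem wt_mul_enorm_uz1_le {z : ℝ} (hz : 0 < z) :
    wt t 1 z * ‖uz1 t h0 h1 z‖ₑ ≤ 9 * sig t * H := by
  have a0 := wt_mul_enorm_phi1_le_vL2 ht hh0 hz
  have a1 := wt_mul_enorm_phi1_le_vL2 ht hh1 hz
  have e1 : ‖(-1 : ℝ)‖ₑ = 1 := by simp
  have e2 : ‖(-2 : ℝ)‖ₑ = 2 := by rw [enorm_neg, Real.enorm_of_nonneg (by norm_num)]; norm_num
  calc wt t 1 z * ‖uz1 t h0 h1 z‖ₑ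
      ≤ wt t 1 z * (‖-1 * phi1 t h1 z‖ₑ + ‖-2 * phi1 t h0 z‖ₑ) := by
        gcongr; exact enorm_add_le _ _
    _ = wt t 1 z * ‖phi1 t h1 z‖ₑ + 2 * (wt t 1 z * ‖phi1 t h0 z‖ₑ) := by
        rw [enorm_mul, enorm_mul, e1, e2]; ring
    _ ≤ 3 * sig t * H + 2 * (3 * sig t * H) :=
        add_le_add (a1.trans (by gcongr)) (mul_le_mul' le_rfl (a0.trans (by gcongr)))
    _ = _ := by ring

theorem enorm_eq_wt_neg_mul (t z : ℝ) (a : ℝ≥0∞) : a = wt t (-1) z * (wt t 1 z * a) := by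
  rw [← mul_assoc, wt_mul_wt, neg_add_cancel, wt_zero, one_mul]

include ht hh0 hh1 hH0 hH1 in
theorem enorm_uz1_le {z : ℝ} (hz : 0 < z) :
    ‖uz1 t h0 h1 z‖ₑ ≤ 9 * sig t * H := by
  refine le_trans ?_ (wt_mul_enorm_uz1_le ht hh0 hh1 hH0 hH1 hz)
  have : 1 ≤ wt t 1 z := by rw [← wt_zero t z]; exact wt_mono ht zero_le_one z
  exact le_mul_of_one_le_left' this

include ht hf hd hf' hlim hE hE' in
theorem enorm_ur1_le_of_le {z : ℝ} (hz : 0 < z) : ‖ur1 t f z‖ₑ ≤ 36 * E := by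
  refine (enorm_ur1_le ht hf hd hf' hlim hz).trans ?_
  calc _ ≤ 18 * (E + E) := by gcongr
    _ = _ := by ring

include ht hf hd hf' hlim hE hE' hh1 hH1 in
theorem vL2_ur1_mul_le : vL2 t (fun z => ur1 t f z * h1 z) ≤ 1000 * (E * H) := by
  refine (vL2_mono_ae hh1 (c := 36 * E) fun z hz => ?_).trans ?_
  · rw [enorm_mul]
    exact mul_le_mul' (enorm_ur1_le_of_le ht hf hd hf' hlim hE hE' hz) le_rfl
  · rw [mul_assoc]
    gcongr
    norm_num

include ht hf' hE' hh0 hh1 hH0 hH1 in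
theorem vL2_deriv_mul_uz1_le : vL2 t (fun z => f' z * uz1 t h0 h1 z) ≤ 1000 * (E * H) := by
  refine (vL2_mono_ae hf' (c := 9 * sig t * H) fun z hz => ?_).trans ?_
  · rw [enorm_mul, mul_comm]
    exact mul_le_mul' (enorm_uz1_le ht hh0 hh1 hH0 hH1 hz) le_rfl
  · calc 9 * sig t * H * vL2 t f' = 9 * (sig t * vL2 t f' * H) := by ring
      _ ≤ _ := by gcongr; norm_num

include ht hf hd hf' hlim hE hE' hh0 hH0 in
theorem vL2_ur1_mul_ur1_le : vL2 t (fun z => ur1 t f z * ur1 t h0 z) ≤ 1000 * (E * H) := by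
  refine (vL2_mono_ae (continuous_ur1 (t := t) hh0) (c := 36 * E) fun z hz => ?_).trans ?_
  · rw [enorm_mul]
    exact mul_le_mul' (enorm_ur1_le_of_le ht hf hd hf' hlim hE hE' hz) le_rfl
  · calc 36 * E * vL2 t (ur1 t h0) ≤ 36 * E * (4 * H) := by
          gcongr; exact (vL2_ur1_le ht hh0).trans (by gcongr)
      _ = 144 * (E * H) := by ring
      _ ≤ _ := by gcongr; norm_num

include ht hf hE in
theorem el2_enorm_dzphi1_le : el2 volPos (fun z => ‖dzphi1 t f z‖ₑ) ≤ 33 * sig t ^ 2 * E := by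
  have hw := measurable_wt t
  have hu := (continuous_ur1 (t := t) hf).enorm.measurable
  calc _ ≤ el2 volPos (fun z => 3 * sig t * E * wt t (-1) z +
        6 * sig t ^ 2 * (wt t 1 z * ‖ur1 t f z‖ₑ)) := by
        refine el2_mono_ae ((ae_restrict_iff' measurableSet_Ioi).2
          (Eventually.of_forall fun z hz => ?_))
        refine (enorm_add_le _ _).trans (add_le_add ?_ ?_)
        · calc ‖phi1 t f z‖ₑ = (wt t 1 z * ‖phi1 t f z‖ₑ) * wt t (-1) z := by
                rw [mul_comm]; exact enorm_eq_wt_neg_mul t z _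
            _ ≤ _ := mul_le_mul' ((wt_mul_enorm_phi1_le_vL2 ht hf hz).trans (by gcongr)) le_rfl
        · calc ‖z * ur1 t f z‖ₑ = ‖z‖ₑ * wt t (-1) z * (wt t 1 z * ‖ur1 t f z‖ₑ) := by
                rw [enorm_mul, mul_assoc, ← enorm_eq_wt_neg_mul t z]
            _ ≤ _ := mul_le_mul' (enorm_mul_wt_le ht (by norm_num) z) le_rfl
    _ ≤ 3 * sig t * E * (3 * sig t) + 6 * sig t ^ 2 * (4 * E) := by
        refine (el2_add_le (by fun_prop) (by fun_prop)).trans ?_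
        rw [el2_const_mul _ (by fun_prop), el2_const_mul _ (by fun_prop)]
        gcongr
        · exact el2_wt_le ht (by norm_num)
        · exact (vL2_ur1_le ht hf).trans (by gcongr)
    _ = _ := by ring

include ht hf hE hh0 hh1 hH0 hH1 in
theorem vL2_dzphi1_mul_uz1_le :
    ‖(angT t)⁻¹‖ₑ * vL2 t (fun z => dzphi1 t f z * uz1 t h0 h1 z) ≤ 1000 * (E * H) := by
  have hm := (continuous_dzphi1 (t := t) hf).enorm.measurable
  have h : vL2 t (fun z => dzphi1 t f z * uz1 t h0 h1 z) ≤
      9 * sig t * H * (33 * sig t ^ 2 * E) := by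
    calc _ ≤ el2 volPos (fun z => 9 * sig t * H * ‖dzphi1 t f z‖ₑ) := by
          refine el2_mono_ae ((ae_restrict_iff' measurableSet_Ioi).2
            (Eventually.of_forall fun z hz => ?_))
          rw [enorm_mul, mul_left_comm, mul_comm]
          exact mul_le_mul' (wt_mul_enorm_uz1_le ht hh0 hh1 hH0 hH1 hz) le_rfl
      _ ≤ _ := by
          rw [el2_const_mul _ hm.aemeasurable]
          exact mul_le_mul' le_rfl (el2_enorm_dzphi1_le ht hf hE)
  calc _ ≤ ‖(angT t)⁻¹‖ₑ * (9 * sig t * H * (33 * sig t ^ 2 * E)) := by gcongr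
    _ = 297 * (‖(angT t)⁻¹‖ₑ * sig t ^ 3) * (E * H) := by ring
    _ ≤ 1000 * 1 * (E * H) := by
        gcongr
        · norm_num
        · exact inv_angT_mul_sig_cube_le ht
    _ = _ := by ring

include ht hf hd hf' hlim hE hE' hh0 hH0 in
theorem vL2_mul_ur1_mul_phi1_le :
    ‖(angT t)⁻¹‖ₑ * vL2 t (fun z => z * (ur1 t f z * phi1 t h0 z)) ≤ 1000 * (E * H) := by
  have hm := (continuous_phi1 (t := t) hh0).enorm.measurable
  have hw := measurable_wt t
  rw [vL2, ← el2_const_mul]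
  swap
  · have := (continuous_ur1 (t := t) hf).enorm.measurable
    simp only [enorm_mul]
    fun_prop
  calc _ ≤ el2 volPos (fun z => 36 * E *
        (‖(angT t)⁻¹‖ₑ * ‖z‖ₑ * (wt t 1 z * ‖phi1 t h0 z‖ₑ))) := by
        refine el2_mono_ae ((ae_restrict_iff' measurableSet_Ioi).2
          (Eventually.of_forall fun z hz => ?_))
        calc _ = ‖ur1 t f z‖ₑ * (‖(angT t)⁻¹‖ₑ * ‖z‖ₑ * (wt t 1 z * ‖phi1 t h0 z‖ₑ)) := by
              rw [enorm_mul, enorm_mul]; ring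
          _ ≤ _ := by gcongr; exact enorm_ur1_le_of_le ht hf hd hf' hlim hE hE' hz
    _ ≤ 36 * E * (6 * H) := by
        rw [el2_const_mul _ (by fun_prop)]
        gcongr
        exact (el2_enorm_mul_wt_mul_enorm_phi1_le ht hh0).trans (by gcongr)
    _ = 216 * (E * H) := by ring
    _ ≤ _ := by gcongr; norm_num

include ht hf hE hh0 hH0 in
theorem vL1_ur1_mul_ur1_le :
    ‖(angT t)⁻¹‖ₑ * vL1 t (fun z => ur1 t f z * ur1 t h0 z) ≤ 18000 * (E * H) := by
  have h : ∫⁻ s in Ioi 0, wt t (3 / 2) s * ‖ur1 t f s * ur1 t h0 s‖ₑ ≤ 16 * (E * H) := by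
    calc _ ≤ ∫⁻ s in Ioi 0, (wt t 1 s * ‖ur1 t f s‖ₑ) * (wt t 1 s * ‖ur1 t h0 s‖ₑ) := by
          refine lintegral_mono fun s => ?_
          calc _ ≤ wt t (1 + 1) s * ‖ur1 t f s * ur1 t h0 s‖ₑ := by
                gcongr; exact wt_mono ht (by norm_num) s
            _ = _ := by rw [← wt_mul_wt, enorm_mul]; ring
      _ ≤ vL2 t (ur1 t f) * vL2 t (ur1 t h0) :=
          lintegral_mul_le_el2 (aemeasurable_wt_mul (continuous_ur1 hf) 1)
            (aemeasurable_wt_mul (continuous_ur1 hh0) 1)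
      _ ≤ (4 * E) * (4 * H) := by
          gcongr
          · exact (vL2_ur1_le ht hf).trans (by gcongr)
          · exact (vL2_ur1_le ht hh0).trans (by gcongr)
      _ = _ := by ring
  calc _ ≤ ‖(angT t)⁻¹‖ₑ * (18 * sig t ^ 3 * (16 * (E * H))) := by unfold vL1; gcongr
    _ = 288 * (‖(angT t)⁻¹‖ₑ * sig t ^ 3) * (E * H) := by ring
    _ ≤ 18000 * 1 * (E * H) := by
        gcongr
        · norm_num
        · exact inv_angT_mul_sig_cube_le ht
    _ = _ := by ring

include ht hf hf' hE hE' in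
theorem lintegral_wt_half_mul_enorm_dur1_le :
    ∫⁻ s in Ioi 0, wt t (1 / 2) s * ‖dur1 t f f' s‖ₑ ≤ 102 * E := by
  have hT := angT_pos ht
  have hw := measurable_wt t
  have hu := (continuous_ur1 (t := t) hf).enorm.measurable
  have hp := (continuous_phi1 (t := t) hf).enorm.measurable
  have hfm := hf'.enorm.measurable
  have hle : ‖1 / (2 * angT t)‖ₑ ≤ ‖(angT t)⁻¹‖ₑ := by
    rw [Real.enorm_of_nonneg (by positivity), Real.enorm_of_nonneg (by positivity), one_div]
    refine ENNReal.ofReal_le_ofReal ?_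
    gcongr
    linarith
  have a1 : ∫⁻ s in Ioi 0, wt t (1 / 2) s * ‖f' s‖ₑ ≤ 3 * E := by
    calc _ = ∫⁻ s in Ioi 0, wt t (-1 / 2) s * (wt t 1 s * ‖f' s‖ₑ) := by
          refine lintegral_congr fun s => ?_
          rw [← mul_assoc, wt_mul_wt]; norm_num
      _ ≤ el2 volPos (wt t (-1 / 2)) * vL2 t f' :=
          lintegral_mul_le_el2 (by fun_prop) (by fun_prop)
      _ ≤ 3 * sig t * vL2 t f' := by gcongr; exact el2_wt_le ht (by norm_num)
      _ = 3 * (sig t * vL2 t f') := by ring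
      _ ≤ _ := by gcongr
  have a2 : ‖(angT t)⁻¹‖ₑ * ∫⁻ s in Ioi 0, wt t (1 / 2) s * ‖phi1 t f s‖ₑ ≤ 27 * E := by
    calc _ ≤ ‖(angT t)⁻¹‖ₑ * ∫⁻ s in Ioi 0, 3 * sig t * E * wt t (-1 / 2) s := by
          gcongr ‖(angT t)⁻¹‖ₑ * ?_
          refine setLIntegral_mono' measurableSet_Ioi fun s hs => ?_
          have : wt t (1 / 2) s = wt t 1 s * wt t (-1 / 2) s := by rw [wt_mul_wt]; norm_num
          rw [this, mul_right_comm]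
          exact mul_le_mul' ((wt_mul_enorm_phi1_le_vL2 ht hf hs).trans (by gcongr)) le_rfl
      _ ≤ ‖(angT t)⁻¹‖ₑ * (3 * sig t * E * (9 * sig t ^ 2)) := by
          rw [lintegral_const_mul _ (by fun_prop)]
          gcongr
          exact (setLIntegral_le_lintegral _ _).trans (lintegral_wt_neg_half_le ht)
      _ = 27 * (‖(angT t)⁻¹‖ₑ * sig t ^ 3) * E := by ring
      _ ≤ 27 * 1 * E := by gcongr; exact inv_angT_mul_sig_cube_le ht
      _ = _ := by ring
  have a3 : ‖(angT t)⁻¹‖ₑ * ∫⁻ s in Ioi 0, wt t (1 / 2) s * (‖s‖ₑ * ‖ur1 t f s‖ₑ) ≤ 72 * E := by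
    calc _ = ‖(angT t)⁻¹‖ₑ *
          ∫⁻ s in Ioi 0, (‖s‖ₑ * wt t (-1 / 2) s) * (wt t 1 s * ‖ur1 t f s‖ₑ) := by
          congr 1
          refine lintegral_congr fun s => ?_
          have : wt t (1 / 2) s = wt t (-1 / 2) s * wt t 1 s := by rw [wt_mul_wt]; norm_num
          rw [this]; ring
      _ ≤ ‖(angT t)⁻¹‖ₑ * (el2 volPos (fun s => ‖s‖ₑ * wt t (-1 / 2) s) * vL2 t (ur1 t f)) := by
          gcongr
          exact lintegral_mul_le_el2 (by fun_prop) (by fun_prop)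
      _ ≤ ‖(angT t)⁻¹‖ₑ * (18 * sig t ^ 3 * (4 * E)) := by
          refine mul_le_mul' le_rfl (mul_le_mul' (el2_enorm_mul_wt_le ht le_rfl) ?_)
          exact (vL2_ur1_le ht hf).trans (by gcongr)
      _ = 72 * (‖(angT t)⁻¹‖ₑ * sig t ^ 3) * E := by ring
      _ ≤ 72 * 1 * E := by gcongr; exact inv_angT_mul_sig_cube_le ht
      _ = _ := by ring
  calc _ ≤ ∫⁻ s in Ioi 0, (wt t (1 / 2) s * ‖f' s‖ₑ +
        (‖(angT t)⁻¹‖ₑ * (wt t (1 / 2) s * ‖phi1 t f s‖ₑ) +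
          ‖(angT t)⁻¹‖ₑ * (wt t (1 / 2) s * (‖s‖ₑ * ‖ur1 t f s‖ₑ)))) := by
        refine lintegral_mono fun s => ?_
        calc wt t (1 / 2) s * ‖dur1 t f f' s‖ₑ
            ≤ wt t (1 / 2) s *
              (‖f' s‖ₑ + ‖(angT t)⁻¹‖ₑ * (‖phi1 t f s‖ₑ + ‖s‖ₑ * ‖ur1 t f s‖ₑ)) := by
              refine mul_le_mul' le_rfl (enorm_sub_le.trans (add_le_add le_rfl ?_))
              rw [enorm_mul, ← enorm_mul s]
              exact mul_le_mul' hle (enorm_add_le _ _)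
          _ = _ := by ring
    _ ≤ 3 * E + (27 * E + 72 * E) := by
        rw [lintegral_add_left (by fun_prop), lintegral_add_left (by fun_prop),
          lintegral_const_mul _ (by fun_prop), lintegral_const_mul _ (by fun_prop)]
        gcongr
    _ = _ := by ring

include ht hf hf' hE hE' hh0 hh1 hH0 hH1 in
theorem vL1_dur1_mul_uz1_le :
    ‖(angT t)⁻¹‖ₑ * vL1 t (fun z => dur1 t f f' z * uz1 t h0 h1 z) ≤ 18000 * (E * H) := by
  have hm := (continuous_dur1 (t := t) hf hf').enorm.measurable
  have hw := measurable_wt t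
  have h : ∫⁻ s in Ioi 0, wt t (3 / 2) s * ‖dur1 t f f' s * uz1 t h0 h1 s‖ₑ ≤
      9 * sig t * H * (102 * E) := by
    calc _ ≤ ∫⁻ s in Ioi 0, 9 * sig t * H * (wt t (1 / 2) s * ‖dur1 t f f' s‖ₑ) := by
          refine setLIntegral_mono' measurableSet_Ioi fun s hs => ?_
          have : wt t (3 / 2) s = wt t 1 s * wt t (1 / 2) s := by rw [wt_mul_wt]; norm_num
          calc _ = (wt t 1 s * ‖uz1 t h0 h1 s‖ₑ) * (wt t (1 / 2) s * ‖dur1 t f f' s‖ₑ) := by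
                rw [this, enorm_mul]; ring
            _ ≤ _ := mul_le_mul' (wt_mul_enorm_uz1_le ht hh0 hh1 hH0 hH1 hs) le_rfl
      _ ≤ _ := by
          rw [lintegral_const_mul _ (by fun_prop)]
          exact mul_le_mul' le_rfl (lintegral_wt_half_mul_enorm_dur1_le ht hf hf' hE hE')
  calc _ ≤ ‖(angT t)⁻¹‖ₑ * (18 * sig t ^ 3 * (9 * sig t * H * (102 * E))) := by unfold vL1; gcongr
    _ = 16524 * (‖(angT t)⁻¹‖ₑ * sig t ^ 4) * (E * H) := by ring
    _ ≤ 18000 * 1 * (E * H) := by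
        gcongr
        · norm_num
        · exact (inv_angT_mul_sig ht).le
    _ = _ := by ring

end Bilinear

theorem ennreal_add_sq_le (a b : ℝ≥0∞) : (a + b) ^ 2 ≤ 2 * (a ^ 2 + b ^ 2) := by
  have := ENNReal.rpow_add_le_mul_rpow_add_rpow a b (p := 2) (by norm_num)
  norm_num at this
  exact this

theorem enorm_sq_le_lintegral_Ioc {f f' : ℝ → ℝ} (hd : ∀ x, HasDerivAt f (f' x) x)
    (hf' : Continuous f') (x : ℝ) :
    ‖f x‖ₑ ^ 2 ≤ 2 * ∫⁻ s in Ioc x (x + 1), (‖f s‖ₑ ^ 2 + ‖f' s‖ₑ ^ 2) := by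
  have hf : Continuous f := continuous_iff_continuousAt.2 fun x => (hd x).continuousAt
  have hm := hf.enorm.measurable
  have hm' := hf'.enorm.measurable
  have hcs : (∫⁻ u in Ioc x (x + 1), ‖f' u‖ₑ) ^ 2 ≤ ∫⁻ u in Ioc x (x + 1), ‖f' u‖ₑ ^ 2 := by
    have h := lintegral_mul_le_el2 (μ := volume.restrict (Ioc x (x + 1))) (F := fun _ => 1)
      aemeasurable_const hm'.aemeasurable
    have h1 : el2 (volume.restrict (Ioc x (x + 1))) (fun _ => 1) = 1 := by simp [el2]
    simp only [one_mul, h1] at h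
    rw [← el2_sq]
    gcongr
  have key : ∀ s ∈ Ioc x (x + 1),
      ‖f x‖ₑ ^ 2 ≤ 2 * (‖f s‖ₑ ^ 2 + ∫⁻ u in Ioc x (x + 1), ‖f' u‖ₑ ^ 2) := fun s hs => by
    have h1 := intervalIntegral.integral_eq_sub_of_hasDerivAt (fun u _ => hd u)
      (hf'.intervalIntegrable x s)
    have h2 : f x = f s - ∫ u in x..s, f' u := by rw [h1]; ring
    have h3 : ‖∫ u in x..s, f' u‖ₑ ≤ ∫⁻ u in Ioc x (x + 1), ‖f' u‖ₑ := by
      rw [intervalIntegral.integral_of_le hs.1.le]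
      exact (enorm_integral_le_lintegral_enorm _).trans
        (lintegral_mono_set (Ioc_subset_Ioc_right hs.2))
    calc ‖f x‖ₑ ^ 2 ≤ (‖f s‖ₑ + ∫⁻ u in Ioc x (x + 1), ‖f' u‖ₑ) ^ 2 := by
          gcongr
          rw [h2]
          exact enorm_sub_le.trans (add_le_add le_rfl h3)
      _ ≤ _ := (ennreal_add_sq_le _ _).trans (by gcongr)
  calc ‖f x‖ₑ ^ 2 = ∫⁻ s in Ioc x (x + 1), ‖f x‖ₑ ^ 2 := by simp
    _ ≤ ∫⁻ s in Ioc x (x + 1), 2 * (‖f s‖ₑ ^ 2 + ∫⁻ u in Ioc x (x + 1), ‖f' u‖ₑ ^ 2) :=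
        setLIntegral_mono' measurableSet_Ioc key
    _ = _ := by
        rw [lintegral_const_mul _ (by fun_prop), lintegral_add_left (by fun_prop),
          lintegral_add_left (by fun_prop)]
        simp

/-- one-dimensional Sobolev bound with the mass taken further away from the origin -/
theorem enorm_sq_le_lintegral_outward {f f' : ℝ → ℝ} (hd : ∀ x, HasDerivAt f (f' x) x)
    (hf' : Continuous f') (x : ℝ) :
    ‖f x‖ₑ ^ 2 ≤ 2 * ∫⁻ s in {s | |x| ≤ |s|}, (‖f s‖ₑ ^ 2 + ‖f' s‖ₑ ^ 2) := by
  rcases le_total 0 x with hx | hx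
  · refine (enorm_sq_le_lintegral_Ioc hd hf' x).trans ?_
    gcongr
    intro s hs
    rw [mem_ofPred_eq, abs_of_nonneg hx, abs_of_nonneg (hx.trans hs.1.le)]
    exact hs.1.le
  · have hd' : ∀ u, HasDerivAt (fun u => f (-u)) (-f' (-u)) u := fun u => by
      have h := HasDerivAt.comp u (hd (-u)) (hasDerivAt_neg u)
      rw [mul_neg_one] at h
      exact h
    have h := enorm_sq_le_lintegral_Ioc hd' (by fun_prop) (-x)
    simp only [neg_neg, enorm_neg] at h
    refine h.trans ?_
    gcongr 2 * ?_
    have hS : MeasurableSet {s : ℝ | |x| ≤ |s|} :=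
      measurableSet_le measurable_const continuous_abs.measurable
    calc ∫⁻ s in Ioc (-x) (-x + 1), (‖f (-s)‖ₑ ^ 2 + ‖f' (-s)‖ₑ ^ 2)
        ≤ ∫⁻ s in {s | |x| ≤ |s|}, (‖f (-s)‖ₑ ^ 2 + ‖f' (-s)‖ₑ ^ 2) := by
          refine lintegral_mono_set fun s hs => ?_
          rw [mem_ofPred_eq, abs_of_nonpos hx]
          exact hs.1.le.trans (le_abs_self s)
      _ = ∫⁻ s, {s : ℝ | |x| ≤ |s|}.indicator (fun s => ‖f s‖ₑ ^ 2 + ‖f' s‖ₑ ^ 2) (-s) := by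
          rw [← lintegral_indicator hS]
          refine lintegral_congr fun s => ?_
          simp [indicator]
      _ = _ := by rw [lintegral_neg_eq_self, lintegral_indicator hS]

theorem enorm_sq_mul_le_lintegral {f f' : ℝ → ℝ} (hd : ∀ x, HasDerivAt f (f' x) x)
    (hf' : Continuous f') {ρ : ℝ → ℝ≥0∞} (hρ : ∀ x s, |x| ≤ |s| → ρ x ≤ ρ s)
    (hρ' : ∀ x, ρ x ≠ ∞) (x : ℝ) :
    ρ x * ‖f x‖ₑ ^ 2 ≤ 2 * ∫⁻ s, ρ s * (‖f s‖ₑ ^ 2 + ‖f' s‖ₑ ^ 2) := by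
  have hS : MeasurableSet {s : ℝ | |x| ≤ |s|} :=
    measurableSet_le measurable_const continuous_abs.measurable
  calc ρ x * ‖f x‖ₑ ^ 2
      ≤ ρ x * (2 * ∫⁻ s in {s | |x| ≤ |s|}, (‖f s‖ₑ ^ 2 + ‖f' s‖ₑ ^ 2)) := by
        gcongr; exact enorm_sq_le_lintegral_outward hd hf' x
    _ = 2 * ∫⁻ s in {s | |x| ≤ |s|}, ρ x * (‖f s‖ₑ ^ 2 + ‖f' s‖ₑ ^ 2) := by
        rw [lintegral_const_mul' _ _ (hρ' x)]; ring
    _ ≤ 2 * ∫⁻ s in {s | |x| ≤ |s|}, ρ s * (‖f s‖ₑ ^ 2 + ‖f' s‖ₑ ^ 2) := by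
        gcongr 2 * ?_
        refine setLIntegral_mono' hS fun s hs => ?_
        gcongr
        exact hρ x s hs
    _ ≤ _ := mul_le_mul' le_rfl (setLIntegral_le_lintegral _ _)

/-- two-dimensional Sobolev bound with a weight that grows away from the axes -/
theorem enorm_sq_mul_le_lintegral_prod {f f₁ f₂ f₁₂ : ℝ → ℝ → ℝ} {ρ : ℝ → ℝ → ℝ≥0∞}
    (h₁ : ∀ x y, HasDerivAt (fun s => f s y) (f₁ x y) x)
    (h₂ : ∀ x y, HasDerivAt (f x) (f₂ x y) y) (h₁₂ : ∀ x y, HasDerivAt (f₁ x) (f₁₂ x y) y)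
    (hf : Continuous fun p : ℝ × ℝ => f p.1 p.2) (hf₁ : Continuous fun p : ℝ × ℝ => f₁ p.1 p.2)
    (hf₂ : Continuous fun p : ℝ × ℝ => f₂ p.1 p.2)
    (hf₁₂ : Continuous fun p : ℝ × ℝ => f₁₂ p.1 p.2)
    (hρ₁ : ∀ y x s, |x| ≤ |s| → ρ x y ≤ ρ s y) (hρ₂ : ∀ x y s, |y| ≤ |s| → ρ x y ≤ ρ x s)
    (hρ : ∀ x y, ρ x y ≠ ∞) (hρm : Measurable fun p : ℝ × ℝ => ρ p.1 p.2) (x y : ℝ) :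
    ρ x y * ‖f x y‖ₑ ^ 2 ≤ 4 * ∫⁻ p : ℝ × ℝ,
      (ρ p.1 p.2 * (‖f p.1 p.2‖ₑ ^ 2 + ‖f₂ p.1 p.2‖ₑ ^ 2) +
        ρ p.1 p.2 * (‖f₁ p.1 p.2‖ₑ ^ 2 + ‖f₁₂ p.1 p.2‖ₑ ^ 2)) := by
  have m := hf.enorm.measurable
  have m₁ := hf₁.enorm.measurable
  have m₂ := hf₂.enorm.measurable
  have m₁₂ := hf₁₂.enorm.measurable
  have hA : Measurable fun p : ℝ × ℝ => ρ p.1 p.2 * (‖f p.1 p.2‖ₑ ^ 2 + ‖f₂ p.1 p.2‖ₑ ^ 2) :=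
    hρm.mul ((m.pow_const 2).add (m₂.pow_const 2))
  have hB : Measurable fun p : ℝ × ℝ =>
      ρ p.1 p.2 * (‖f₁ p.1 p.2‖ₑ ^ 2 + ‖f₁₂ p.1 p.2‖ₑ ^ 2) :=
    hρm.mul ((m₁.pow_const 2).add (m₁₂.pow_const 2))
  have hAB : AEMeasurable (fun p : ℝ × ℝ =>
      ρ p.1 p.2 * (‖f p.1 p.2‖ₑ ^ 2 + ‖f₂ p.1 p.2‖ₑ ^ 2) +
        ρ p.1 p.2 * (‖f₁ p.1 p.2‖ₑ ^ 2 + ‖f₁₂ p.1 p.2‖ₑ ^ 2)) (volume.prod volume) :=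
    (hA.add hB).aemeasurable
  calc ρ x y * ‖f x y‖ₑ ^ 2
      ≤ 2 * ∫⁻ s, ρ s y * (‖f s y‖ₑ ^ 2 + ‖f₁ s y‖ₑ ^ 2) :=
        enorm_sq_mul_le_lintegral (f := fun s => f s y) (ρ := fun s => ρ s y) (fun s => h₁ s y)
          (hf₁.comp (Continuous.prodMk_left y)) (hρ₁ y) (fun s => hρ s y) x
    _ ≤ 2 * ∫⁻ s, 2 * ∫⁻ u, (ρ s u * (‖f s u‖ₑ ^ 2 + ‖f₂ s u‖ₑ ^ 2) +
          ρ s u * (‖f₁ s u‖ₑ ^ 2 + ‖f₁₂ s u‖ₑ ^ 2)) := by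
        refine mul_le_mul' le_rfl (lintegral_mono fun s => ?_)
        have hAs : Measurable fun u => ρ s u * (‖f s u‖ₑ ^ 2 + ‖f₂ s u‖ₑ ^ 2) :=
          hA.comp measurable_prodMk_left
        rw [lintegral_add_left hAs, mul_add, mul_add]
        exact add_le_add
          (enorm_sq_mul_le_lintegral (h₂ s) (hf₂.comp (Continuous.prodMk_right s)) (hρ₂ s) (hρ s) y)
          (enorm_sq_mul_le_lintegral (h₁₂ s) (hf₁₂.comp (Continuous.prodMk_right s)) (hρ₂ s)
            (hρ s) y)
    _ = _ := by
        rw [lintegral_const_mul' _ _ (by norm_num), ← mul_assoc, Measure.volume_eq_prod,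
          lintegral_prod _ hAB]
        norm_num

/-- `⟨r⟩` as an extended nonnegative real -/
def eR (x y : ℝ) : ℝ≥0∞ := ENNReal.ofReal (angR x y)

theorem one_le_eR (x y : ℝ) : 1 ≤ eR x y := by
  rw [eR, ENNReal.one_le_ofReal, angR, Real.one_le_sqrt]
  nlinarith [sq_nonneg x, sq_nonneg y]

theorem eR_ne_top (x y : ℝ) : eR x y ≠ ∞ := ENNReal.ofReal_ne_top

theorem eR_mono_left {x s : ℝ} (h : |x| ≤ |s|) (y : ℝ) : eR x y ≤ eR s y := by
  unfold eR angR
  have := sq_le_sq.2 h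
  gcongr

theorem eR_mono_right {y s : ℝ} (h : |y| ≤ |s|) (x : ℝ) : eR x y ≤ eR x s := by
  unfold eR angR
  have := sq_le_sq.2 h
  gcongr

theorem enorm_angR (x y : ℝ) : ‖angR x y‖ₑ = eR x y := Real.enorm_of_nonneg (Real.sqrt_nonneg _)

theorem enorm_x_le_eR (x y : ℝ) : ‖x‖ₑ ≤ eR x y := by
  rw [Real.enorm_eq_ofReal_abs]
  exact ENNReal.ofReal_le_ofReal (Real.abs_le_sqrt (by nlinarith [sq_nonneg y]))

theorem enorm_y_le_eR (x y : ℝ) : ‖y‖ₑ ≤ eR x y := by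
  rw [Real.enorm_eq_ofReal_abs]
  exact ENNReal.ofReal_le_ofReal (Real.abs_le_sqrt (by nlinarith [sq_nonneg x]))

theorem measurable_eR : Measurable fun p : ℝ × ℝ => eR p.1 p.2 := by
  unfold eR angR
  exact ENNReal.measurable_ofReal.comp (by fun_prop : Continuous _).measurable

/-- the norm `‖θ ⟨r⟩ⁿ f‖_{L²}` as an extended nonnegative real -/
def eL2 (t : ℝ) (n : ℕ) (f : ℝ → ℝ → ℝ → ℝ) : ℝ≥0∞ :=
  el2 (volume : Measure (ℝ × ℝ)) fun p => eR p.1 p.2 ^ n * vL2 t (f p.1 p.2)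

section Horizontal

variable {t : ℝ} {f g : ℝ → ℝ → ℝ → ℝ}

theorem SmoothF.continuous_z (hf : SmoothF f) (x y : ℝ) : Continuous (f x y) :=
  (hf.contDiff_z x y).continuous

theorem SmoothF.measurable_wt_mul (hf : SmoothF f) (t p : ℝ) :
    Measurable fun q : (ℝ × ℝ) × ℝ => wt t p q.2 * ‖f q.1.1 q.1.2 q.2‖ₑ := by
  have h : Continuous fun q : (ℝ × ℝ) × ℝ => f q.1.1 q.1.2 q.2 :=
    hf.continuous.comp (by fun_prop : Continuous fun q : (ℝ × ℝ) × ℝ => (q.1.1, q.1.2, q.2))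
  exact ((measurable_wt t p).comp measurable_snd).mul h.enorm.measurable

theorem SmoothF.measurable_vL2 (hf : SmoothF f) (t : ℝ) :
    Measurable fun p : ℝ × ℝ => vL2 t (f p.1 p.2) := by
  have h : Measurable fun p : ℝ × ℝ => ∫⁻ z in Ioi 0, (wt t 1 z * ‖f p.1 p.2 z‖ₑ) ^ 2 :=
    Measurable.lintegral_prod_right'
      (f := fun q : (ℝ × ℝ) × ℝ => (wt t 1 q.2 * ‖f q.1.1 q.1.2 q.2‖ₑ) ^ 2)
      ((hf.measurable_wt_mul t 1).pow_const 2)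
  exact h.pow_const _

theorem SmoothF.measurable_eR_mul_vL2 (hf : SmoothF f) (t : ℝ) (n : ℕ) :
    Measurable fun p : ℝ × ℝ => eR p.1 p.2 ^ n * vL2 t (f p.1 p.2) :=
  (measurable_eR.pow_const n).mul (hf.measurable_vL2 t)

theorem eL2_mono_exponent {m n : ℕ} (h : m ≤ n) (f : ℝ → ℝ → ℝ → ℝ) : eL2 t m f ≤ eL2 t n f := by
  refine el2_mono_ae (Eventually.of_forall fun p => ?_)
  gcongr
  exact one_le_eR _ _

theorem eR_mul_wt_mul_enorm_sq_le (hf : SmoothF f) (n : ℕ) (x y z : ℝ) :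
    (eR x y ^ n * (wt t 1 z * ‖f x y z‖ₑ)) ^ 2 ≤ 4 * ∫⁻ p : ℝ × ℝ,
      ((eR p.1 p.2 ^ n * (wt t 1 z * ‖f p.1 p.2 z‖ₑ)) ^ 2 +
        (eR p.1 p.2 ^ n * (wt t 1 z * ‖pdy f p.1 p.2 z‖ₑ)) ^ 2 +
        ((eR p.1 p.2 ^ n * (wt t 1 z * ‖pdx f p.1 p.2 z‖ₑ)) ^ 2 +
        (eR p.1 p.2 ^ n * (wt t 1 z * ‖pdy (pdx f) p.1 p.2 z‖ₑ)) ^ 2)) := by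
  have hm : ∀ {h : ℝ → ℝ → ℝ → ℝ}, SmoothF h → Continuous fun p : ℝ × ℝ => h p.1 p.2 z :=
    fun hh => hh.continuous.comp (by fun_prop : Continuous fun p : ℝ × ℝ => (p.1, p.2, z))
  have h := enorm_sq_mul_le_lintegral_prod (f := fun x y => f x y z)
    (f₁ := fun x y => pdx f x y z) (f₂ := fun x y => pdy f x y z)
    (f₁₂ := fun x y => pdy (pdx f) x y z) (ρ := fun x y => (eR x y ^ n) ^ 2 * wt t 1 z ^ 2)
    (fun x y => hf.hasDerivAt_pdx x y z) (fun x y => hf.hasDerivAt_pdy x y z)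
    (fun x y => hf.pdx.hasDerivAt_pdy x y z) (hm hf) (hm hf.pdx) (hm hf.pdy) (hm hf.pdx.pdy)
    (fun y u v huv => by have := eR_mono_left huv y; gcongr)
    (fun x u v huv => by have := eR_mono_right huv x; gcongr)
    (fun x y => ENNReal.mul_ne_top (ENNReal.pow_ne_top (ENNReal.pow_ne_top (eR_ne_top _ _)))
      (ENNReal.pow_ne_top (wt_ne_top _ _ _)))
    (((measurable_eR.pow_const n).pow_const 2).mul_const _) x y
  simpa only [mul_pow, mul_add, mul_assoc] using h

theorem lintegral_add_add_add {α : Type*} [MeasurableSpace α] {μ : Measure α}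
    {F₀ F₁ F₂ F₃ : α → ℝ≥0∞} (h₀ : Measurable F₀) (h₁ : Measurable F₁) (h₂ : Measurable F₂) :
    ∫⁻ a, (F₀ a + F₁ a + (F₂ a + F₃ a)) ∂μ =
      ∫⁻ a, F₀ a ∂μ + ∫⁻ a, F₁ a ∂μ + (∫⁻ a, F₂ a ∂μ + ∫⁻ a, F₃ a ∂μ) := by
  have h : Measurable fun a => F₀ a + F₁ a := h₀.add h₁
  rw [lintegral_add_left h, lintegral_add_left h₀, lintegral_add_left h₂]

/-- integrating a pointwise-in-`z` bound by four squares into a bound of `L²(μ; L²(ν))` norms -/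
theorem el2_le_of_sq_le_lintegral {α β : Type*} [MeasurableSpace α] [MeasurableSpace β]
    {μ : Measure α} {ν : Measure β} [SFinite μ] [SFinite ν] {c : β → ℝ≥0∞}
    {F₀ F₁ F₂ F₃ : α → β → ℝ≥0∞} (h₀ : Measurable (Function.uncurry F₀))
    (h₁ : Measurable (Function.uncurry F₁)) (h₂ : Measurable (Function.uncurry F₂))
    (h₃ : Measurable (Function.uncurry F₃))
    (hc : ∀ z, c z ^ 2 ≤
      4 * ∫⁻ p, (F₀ p z ^ 2 + F₁ p z ^ 2 + (F₂ p z ^ 2 + F₃ p z ^ 2)) ∂μ) :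
    el2 ν c ≤ 2 * (el2 μ (fun p => el2 ν (F₀ p)) + el2 μ (fun p => el2 ν (F₁ p)) +
      (el2 μ (fun p => el2 ν (F₂ p)) + el2 μ (fun p => el2 ν (F₃ p)))) := by
  have hz : ∀ {F : α → β → ℝ≥0∞}, Measurable (Function.uncurry F) → ∀ p,
      Measurable fun z => F p z ^ 2 := fun hF p => (hF.comp measurable_prodMk_left).pow_const 2
  have hl : ∀ {F : α → β → ℝ≥0∞}, Measurable (Function.uncurry F) →
      Measurable fun p => ∫⁻ z, F p z ^ 2 ∂ν := fun hF =>
    (hF.pow_const 2).lintegral_prod_right'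
  have hsum : AEMeasurable (Function.uncurry fun z p =>
      F₀ p z ^ 2 + F₁ p z ^ 2 + (F₂ p z ^ 2 + F₃ p z ^ 2)) (ν.prod μ) :=
    ((((h₀.pow_const 2).add (h₁.pow_const 2)).add ((h₂.pow_const 2).add
      (h₃.pow_const 2))).comp measurable_swap).aemeasurable
  have h2 : ∀ a b : ℝ≥0∞, a ^ 2 + b ^ 2 ≤ (a + b) ^ 2 := fun a b => by
    rw [add_sq']
    exact le_self_add
  rw [el2_le_iff]
  calc ∫⁻ z, c z ^ 2 ∂ν
      ≤ ∫⁻ z, 4 * ∫⁻ p, (F₀ p z ^ 2 + F₁ p z ^ 2 + (F₂ p z ^ 2 + F₃ p z ^ 2)) ∂μ ∂ν :=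
        lintegral_mono hc
    _ = 4 * ∫⁻ p, ∫⁻ z, (F₀ p z ^ 2 + F₁ p z ^ 2 + (F₂ p z ^ 2 + F₃ p z ^ 2)) ∂ν ∂μ := by
        rw [lintegral_const_mul' _ _ (by norm_num), lintegral_lintegral_swap hsum]
    _ = 4 * ∫⁻ p, (∫⁻ z, F₀ p z ^ 2 ∂ν + ∫⁻ z, F₁ p z ^ 2 ∂ν +
          (∫⁻ z, F₂ p z ^ 2 ∂ν + ∫⁻ z, F₃ p z ^ 2 ∂ν)) ∂μ := by
        congr 2
        ext p
        exact lintegral_add_add_add (hz h₀ p) (hz h₁ p) (hz h₂ p)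
    _ = 4 * (∫⁻ p, ∫⁻ z, F₀ p z ^ 2 ∂ν ∂μ + ∫⁻ p, ∫⁻ z, F₁ p z ^ 2 ∂ν ∂μ +
          (∫⁻ p, ∫⁻ z, F₂ p z ^ 2 ∂ν ∂μ + ∫⁻ p, ∫⁻ z, F₃ p z ^ 2 ∂ν ∂μ)) := by
        rw [lintegral_add_add_add (hl h₀) (hl h₁) (hl h₂)]
    _ ≤ _ := by
        simp only [← el2_sq]
        rw [mul_pow]
        refine mul_le_mul' (by norm_num) ?_
        exact (add_le_add (h2 _ _) (h2 _ _)).trans (h2 _ _)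

/-- the weighted Sobolev embedding in the horizontal variables -/
theorem eR_mul_vL2_le (hf : SmoothF f) (n : ℕ) (x y : ℝ) :
    eR x y ^ n * vL2 t (f x y) ≤
      2 * (eL2 t n f + eL2 t n (pdy f) + (eL2 t n (pdx f) + eL2 t n (pdy (pdx f)))) := by
  have e : ∀ {h : ℝ → ℝ → ℝ → ℝ}, SmoothF h → ∀ x y, eR x y ^ n * vL2 t (h x y) =
      el2 volPos fun z => eR x y ^ n * (wt t 1 z * ‖h x y z‖ₑ) := fun {h} hh x y =>
    (el2_const_mul _ (aemeasurable_wt_mul (hh.continuous_z x y) 1)).symm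
  have hR : Measurable fun q : (ℝ × ℝ) × ℝ => eR q.1.1 q.1.2 := measurable_eR.comp measurable_fst
  have hm : ∀ {h : ℝ → ℝ → ℝ → ℝ}, SmoothF h → Measurable (Function.uncurry
      fun (p : ℝ × ℝ) z => eR p.1 p.2 ^ n * (wt t 1 z * ‖h p.1 p.2 z‖ₑ)) := fun hh =>
    (hR.pow_const n).mul (hh.measurable_wt_mul t 1)
  simp only [eL2, e hf, e hf.pdy, e hf.pdx, e hf.pdx.pdy]
  exact el2_le_of_sq_le_lintegral (hm hf) (hm hf.pdy) (hm hf.pdx) (hm hf.pdx.pdy)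
    fun z => eR_mul_wt_mul_enorm_sq_le hf n x y z

end Horizontal

section Link

variable {t : ℝ} {f : ℝ → ℝ → ℝ → ℝ}

theorem volume_restrict_pos_snd_snd :
    (volume : Measure (ℝ × ℝ × ℝ)).restrict {p | 0 < p.2.2} =
      (volume : Measure ℝ).prod ((volume : Measure ℝ).prod volPos) := by
  have h : {p : ℝ × ℝ × ℝ | 0 < p.2.2} = univ ×ˢ (univ ×ˢ Ioi 0) := by ext; simp
  rw [h, Measure.volume_eq_prod, ← Measure.prod_restrict, Measure.volume_eq_prod,
    ← Measure.prod_restrict, Measure.restrict_univ]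

theorem eL2_eq_ofReal_L2w (hf : SmoothF f) (n : ℕ)
    (hI : Integrable (fun p : ℝ × ℝ × ℝ =>
      (thw t 1 p.2.2 * angR p.1 p.2.1 ^ n * f p.1 p.2.1 p.2.2) ^ 2)
      (volume.restrict {p : ℝ × ℝ × ℝ | 0 < p.2.2})) :
    eL2 t n f = ENNReal.ofReal (L2w t 1 n f) := by
  have hm : Measurable fun p : ℝ × ℝ × ℝ =>
      ENNReal.ofReal ((thw t 1 p.2.2 * angR p.1 p.2.1 ^ n * f p.1 p.2.1 p.2.2) ^ 2) := by
    have hc := hf.continuous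
    unfold thw angR
    exact ENNReal.measurable_ofReal.comp (by fun_prop : Continuous _).measurable
  rw [volume_restrict_pos_snd_snd] at hI
  have hint : ∫ x : ℝ, ∫ y : ℝ, ∫ z in Ioi (0 : ℝ), (thw t 1 z * angR x y ^ n * f x y z) ^ 2 =
      ∫ p, (thw t 1 p.2.2 * angR p.1 p.2.1 ^ n * f p.1 p.2.1 p.2.2) ^ 2
        ∂((volume : Measure ℝ).prod ((volume : Measure ℝ).prod volPos)) := by
    rw [integral_prod _ hI]
    refine integral_congr_ae ?_
    filter_upwards [hI.prod_right_ae] with x hx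
    rw [integral_prod _ hx]
  have hsq : ∀ x y z, ENNReal.ofReal ((thw t 1 z * angR x y ^ n * f x y z) ^ 2) =
      (eR x y ^ n) ^ 2 * (wt t 1 z * ‖f x y z‖ₑ) ^ 2 := fun x y z => by
    rw [← Real.enorm_of_nonneg (sq_nonneg _), enorm_pow, enorm_mul, enorm_mul, enorm_pow,
      enorm_thw, enorm_angR]
    ring
  suffices h : eL2 t n f ^ 2 = ENNReal.ofReal (L2w t 1 n f) ^ 2 from
    le_antisymm (ennreal_pow_two_le_pow_two.1 h.le) (ennreal_pow_two_le_pow_two.1 h.ge)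
  rw [L2w, ← ENNReal.ofReal_pow (Real.sqrt_nonneg _), Real.sq_sqrt, hint,
    ofReal_integral_eq_lintegral_ofReal hI (Eventually.of_forall fun _ => sq_nonneg _),
    lintegral_prod _ hm.aemeasurable]
  · have hmm := hf.measurable_eR_mul_vL2 t n
    rw [eL2, el2_sq, Measure.volume_eq_prod, lintegral_prod _ (hmm.pow_const 2).aemeasurable]
    refine lintegral_congr fun x => ?_
    refine Eq.trans ?_
      (lintegral_prod _ (hm.comp (measurable_prodMk_left (x := x))).aemeasurable).symm
    refine lintegral_congr fun y => ?_
    simp only [Function.comp_apply, hsq]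
    rw [lintegral_const_mul' _ _ (ENNReal.pow_ne_top (ENNReal.pow_ne_top (eR_ne_top _ _))),
      mul_pow, vL2, el2_sq]
  · exact integral_nonneg fun x => integral_nonneg fun y => integral_nonneg fun z => sq_nonneg _

theorem enorm_trip_le {F : ℝ → ℝ → ℝ → ℝ} {B : ℝ × ℝ → ℝ≥0∞} (hB : Measurable B)
    (h : ∀ x y, ∫⁻ z in Ioi 0, ‖F x y z‖ₑ ≤ B (x, y)) : ‖trip F‖ₑ ≤ ∫⁻ p, B p := by
  rw [Measure.volume_eq_prod, lintegral_prod _ hB.aemeasurable]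
  refine (enorm_integral_le_lintegral_enorm _).trans (lintegral_mono fun x => ?_)
  refine (enorm_integral_le_lintegral_enorm _).trans (lintegral_mono fun y => ?_)
  exact (enorm_integral_le_lintegral_enorm _).trans (h x y)

end Link

section Slices

variable {t : ℝ} {g : ℝ → ℝ → ℝ → ℝ}

/-- vertical norms of `∂^α g` and `⟨t⟩^{1/4} ∂^α ∂_z g` -/
def vE (t : ℝ) (g : ℝ → ℝ → ℝ → ℝ) (i j : ℕ) (p : ℝ × ℝ) : ℝ≥0∞ :=
  vL2 t (pdh i j g p.1 p.2) + sig t * vL2 t (pdh i j (pdz g) p.1 p.2)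

/-- vertical norms of `∂^α g` and `∂^α (r ∂_r g)` -/
def vH (t : ℝ) (g : ℝ → ℝ → ℝ → ℝ) (i j : ℕ) (p : ℝ × ℝ) : ℝ≥0∞ :=
  vL2 t (pdh i j g p.1 p.2) + vL2 t (pdh i j (rdr g) p.1 p.2)

/-- the Leibniz sum of the products `vE * vH` -/
def vS (t : ℝ) (g : ℝ → ℝ → ℝ → ℝ) (a b : ℕ) (p : ℝ × ℝ) : ℝ≥0∞ :=
  ∑ i ∈ Finset.range (a + 1), ∑ j ∈ Finset.range (b + 1),
    ((a.choose i : ℝ≥0∞) * (b.choose j : ℝ≥0∞)) * (vE t g i j p * vH t g (a - i) (b - j) p)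

/-- the common bound of the nonlinear terms -/
def eJ (t : ℝ) (g : ℝ → ℝ → ℝ → ℝ) (a b : ℕ) : ℝ≥0∞ :=
  ∫⁻ p : ℝ × ℝ, eR p.1 p.2 ^ (2 * (a + b)) * (vS t g a b p * vL2 t (pdh a b g p.1 p.2))

theorem SmoothF.measurable_vE (hg : SmoothF g) (t : ℝ) (i j : ℕ) : Measurable (vE t g i j) :=
  ((hg.pdh i j).measurable_vL2 t).add (((hg.pdz.pdh i j).measurable_vL2 t).const_mul _)

theorem SmoothF.measurable_vH (hg : SmoothF g) (t : ℝ) (i j : ℕ) : Measurable (vH t g i j) :=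
  ((hg.pdh i j).measurable_vL2 t).add ((hg.rdr.pdh i j).measurable_vL2 t)

theorem SmoothF.measurable_vS (hg : SmoothF g) (t : ℝ) (a b : ℕ) : Measurable (vS t g a b) := by
  unfold vS
  refine Finset.measurable_fun_sum _ fun i _ => Finset.measurable_fun_sum _ fun j _ => ?_
  exact ((hg.measurable_vE t i j).mul (hg.measurable_vH t (a - i) (b - j))).const_mul _

theorem measurable_eJ_integrand (hg : SmoothF g) (t : ℝ) (a b : ℕ) : Measurable fun p : ℝ × ℝ =>
    eR p.1 p.2 ^ (2 * (a + b)) * (vS t g a b p * vL2 t (pdh a b g p.1 p.2)) :=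
  (measurable_eR.pow_const _).mul
    ((hg.measurable_vS t a b).mul ((hg.pdh a b).measurable_vL2 t))

theorem seminorm_sum_le {ι : Type*} {N : (ℝ → ℝ) → ℝ≥0∞}
    (hadd : ∀ q k, Continuous q → Continuous k → N (fun z => q z + k z) ≤ N q + N k)
    (hmul : ∀ (c : ℝ) q, Continuous q → N (fun z => c * q z) = ‖c‖ₑ * N q)
    (s : Finset ι) {q : ι → ℝ → ℝ} (hq : ∀ i, Continuous (q i)) :
    N (fun z => ∑ i ∈ s, q i z) ≤ ∑ i ∈ s, N (q i) := by
  classical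
  induction s using Finset.induction_on with
  | empty => simpa using (hmul 0 (fun _ => 0) continuous_const).le
  | insert i s hi ih =>
    simp only [Finset.sum_insert hi]
    exact (hadd _ _ (hq i) (continuous_finsetSum s fun i _ => hq i)).trans (add_le_add le_rfl ih)

theorem seminorm_pdh_mul_le {N : (ℝ → ℝ) → ℝ≥0∞}
    (hadd : ∀ q k, Continuous q → Continuous k → N (fun z => q z + k z) ≤ N q + N k)
    (hmul : ∀ (c : ℝ) q, Continuous q → N (fun z => c * q z) = ‖c‖ₑ * N q)
    {A B : ℝ → ℝ → ℝ → ℝ} (hA : SmoothF A) (hB : SmoothF B) {K : ℝ≥0∞} {x y : ℝ}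
    (h : ∀ i j i' j', N (fun z => pdh i j A x y z * pdh i' j' B x y z) ≤
      K * (vE t g i j (x, y) * vH t g i' j' (x, y))) (a b : ℕ) :
    N (pdh a b (fun x y z => A x y z * B x y z) x y) ≤ K * vS t g a b (x, y) := by
  have hc : ∀ i j i' j', Continuous fun z => pdh i j A x y z * pdh i' j' B x y z :=
    fun i j i' j' => ((hA.pdh i j).continuous_z x y).mul ((hB.pdh i' j').continuous_z x y)
  have e : pdh a b (fun x y z => A x y z * B x y z) x y = fun z =>
      ∑ i ∈ Finset.range (a + 1), ∑ j ∈ Finset.range (b + 1),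
        ((a.choose i : ℝ) * (b.choose j : ℝ)) *
          (pdh i j A x y z * pdh (a - i) (b - j) B x y z) := funext (pdh_mul hA hB a b x y)
  have ecast : ∀ n : ℕ, ‖(n : ℝ)‖ₑ = n := fun n => by
    rw [Real.enorm_of_nonneg n.cast_nonneg, ENNReal.ofReal_natCast]
  rw [e, vS, Finset.mul_sum]
  refine (seminorm_sum_le hadd hmul _ fun i => continuous_finsetSum _ fun j _ =>
    (hc _ _ _ _).const_mul _).trans (Finset.sum_le_sum fun i _ => ?_)
  rw [Finset.mul_sum]
  refine (seminorm_sum_le hadd hmul _ fun j => (hc _ _ _ _).const_mul _).trans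
    (Finset.sum_le_sum fun j _ => ?_)
  rw [hmul _ _ (hc _ _ _ _), enorm_mul, ecast, ecast, mul_left_comm]
  exact mul_le_mul' le_rfl (h _ _ _ _)

theorem enorm_trip_local_le (hg : SmoothF g) {P : ℝ → ℝ → ℝ → ℝ} (hP : ∀ x y, Continuous (P x y))
    {c : ℝ} {K : ℝ≥0∞} (hK : K ≠ ∞) {a b : ℕ}
    (h : ∀ x y, ‖c‖ₑ * vL2 t (P x y) ≤ K * vS t g a b (x, y)) :
    ‖c * trip fun x y z =>
      thw t 2 z * angR x y ^ (2 * (a + b)) * P x y z * pdh a b g x y z‖ₑ ≤ K * eJ t g a b := by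
  have hc : c * trip (fun x y z =>
      thw t 2 z * angR x y ^ (2 * (a + b)) * P x y z * pdh a b g x y z) =
      trip fun x y z =>
        c * (thw t 2 z * angR x y ^ (2 * (a + b)) * P x y z * pdh a b g x y z) := by
    simp only [trip, integral_const_mul]
  rw [hc, eJ, ← lintegral_const_mul' _ _ hK]
  refine enorm_trip_le ((measurable_eJ_integrand hg t a b).const_mul K) fun x y => ?_
  have hp : eR x y ^ (2 * (a + b)) ≠ ∞ := ENNReal.pow_ne_top (eR_ne_top _ _)
  calc ∫⁻ z in Ioi 0,
        ‖c * (thw t 2 z * angR x y ^ (2 * (a + b)) * P x y z * pdh a b g x y z)‖ₑ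
      = ∫⁻ z in Ioi 0, ‖c‖ₑ * eR x y ^ (2 * (a + b)) *
          (wt t 2 z * ‖P x y z‖ₑ * ‖pdh a b g x y z‖ₑ) := by
        refine lintegral_congr fun z => ?_
        simp only [enorm_mul, enorm_pow, enorm_thw, enorm_angR]
        ring
    _ ≤ ‖c‖ₑ * eR x y ^ (2 * (a + b)) * (vL2 t (P x y) * vL2 t (pdh a b g x y)) := by
        rw [lintegral_const_mul' _ _ (ENNReal.mul_ne_top enorm_ne_top hp)]
        exact mul_le_mul' le_rfl
          (lintegral_wt_two_mul_le (hP x y) ((hg.pdh a b).continuous_z x y))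
    _ = eR x y ^ (2 * (a + b)) * (‖c‖ₑ * vL2 t (P x y) * vL2 t (pdh a b g x y)) := by ring
    _ ≤ eR x y ^ (2 * (a + b)) * (K * vS t g a b (x, y) * vL2 t (pdh a b g x y)) :=
        mul_le_mul' le_rfl (mul_le_mul' (h x y) le_rfl)
    _ = _ := by ring

theorem enorm_trip_nonlocal_le (ht : 0 ≤ t) (hg : SmoothF g) {P : ℝ → ℝ → ℝ → ℝ}
    {c : ℝ} {K : ℝ≥0∞} (hK : K ≠ ∞) {a b : ℕ}
    (h : ∀ x y, ‖c‖ₑ * vL1 t (P x y) ≤ K * vS t g a b (x, y)) :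
    ‖c * trip fun x y z =>
      z * thw t 2 z * angR x y ^ (2 * (a + b)) * (∫ s in Ioi z, P x y s) * pdh a b g x y z‖ₑ ≤
        K * eJ t g a b := by
  have hc : c * trip (fun x y z =>
      z * thw t 2 z * angR x y ^ (2 * (a + b)) * (∫ s in Ioi z, P x y s) * pdh a b g x y z) =
      trip fun x y z => c * (z * thw t 2 z * angR x y ^ (2 * (a + b)) *
        (∫ s in Ioi z, P x y s) * pdh a b g x y z) := by
    simp only [trip, integral_const_mul]
  rw [hc, eJ, ← lintegral_const_mul' _ _ hK]
  refine enorm_trip_le ((measurable_eJ_integrand hg t a b).const_mul K) fun x y => ?_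
  have hp : eR x y ^ (2 * (a + b)) ≠ ∞ := ENNReal.pow_ne_top (eR_ne_top _ _)
  calc ∫⁻ z in Ioi 0, ‖c * (z * thw t 2 z * angR x y ^ (2 * (a + b)) *
        (∫ s in Ioi z, P x y s) * pdh a b g x y z)‖ₑ
      ≤ ∫⁻ z in Ioi 0, ‖c‖ₑ * eR x y ^ (2 * (a + b)) *
          (‖z‖ₑ * wt t 2 z * (∫⁻ s in Ioi z, ‖P x y s‖ₑ) * ‖pdh a b g x y z‖ₑ) := by
        refine lintegral_mono fun z => ?_
        have hz := enorm_integral_le_lintegral_enorm (μ := volume.restrict (Ioi z)) (P x y)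
        simp only [enorm_mul, enorm_pow, enorm_thw, enorm_angR]
        calc _ = ‖c‖ₑ * eR x y ^ (2 * (a + b)) * (‖z‖ₑ * wt t 2 z *
              ‖∫ s in Ioi z, P x y s‖ₑ * ‖pdh a b g x y z‖ₑ) := by ring
          _ ≤ _ := mul_le_mul' le_rfl (mul_le_mul' (mul_le_mul' le_rfl hz) le_rfl)
    _ ≤ ‖c‖ₑ * eR x y ^ (2 * (a + b)) * (vL1 t (P x y) * vL2 t (pdh a b g x y)) := by
        rw [lintegral_const_mul' _ _ (ENNReal.mul_ne_top enorm_ne_top hp)]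
        exact mul_le_mul' le_rfl (lintegral_nonlocal_le ht ((hg.pdh a b).continuous_z x y))
    _ = eR x y ^ (2 * (a + b)) * (‖c‖ₑ * vL1 t (P x y) * vL2 t (pdh a b g x y)) := by ring
    _ ≤ eR x y ^ (2 * (a + b)) * (K * vS t g a b (x, y) * vL2 t (pdh a b g x y)) :=
        mul_le_mul' le_rfl (mul_le_mul' (h x y) le_rfl)
    _ = _ := by ring

end Slices

section NonlinearTerms

variable {t : ℝ} {g : ℝ → ℝ → ℝ → ℝ}

theorem const_mul_vL2_add_le (c : ℝ≥0∞) (q k : ℝ → ℝ) (hq : Continuous q) (hk : Continuous k) :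
    c * vL2 t (fun z => q z + k z) ≤ c * vL2 t q + c * vL2 t k := by
  rw [← mul_add]
  exact mul_le_mul' le_rfl (vL2_add_le hq hk)

theorem const_mul_vL2_const_mul (c : ℝ≥0∞) (d : ℝ) (q : ℝ → ℝ) (hq : Continuous q) :
    c * vL2 t (fun z => d * q z) = ‖d‖ₑ * (c * vL2 t q) := by
  rw [vL2_const_mul d hq, mul_left_comm]

theorem const_mul_vL1_add_le (c : ℝ≥0∞) (q k : ℝ → ℝ) (hq : Continuous q) (_ : Continuous k) :
    c * vL1 t (fun z => q z + k z) ≤ c * vL1 t q + c * vL1 t k := by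
  rw [← mul_add]
  exact mul_le_mul' le_rfl (vL1_add_le hq)

theorem const_mul_vL1_const_mul (c : ℝ≥0∞) (d : ℝ) (q : ℝ → ℝ) (_ : Continuous q) :
    c * vL1 t (fun z => d * q z) = ‖d‖ₑ * (c * vL1 t q) := by
  rw [vL1_const_mul d, mul_left_comm]

theorem pdh_ur_apply (hg : SmoothF g) (t : ℝ) (i j : ℕ) (x y z : ℝ) :
    pdh i j (ur t g) x y z = ur1 t (pdh i j g x y) z := by
  rw [pdh_ur hg, ur_eq (hg.pdh i j)]
  rfl

theorem pdh_phiF_apply (hg : SmoothF g) (t : ℝ) (i j : ℕ) (x y z : ℝ) :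
    pdh i j (phiF t g) x y z = phi1 t (pdh i j g x y) z := by
  rw [pdh_phiF hg]
  rfl

theorem pdh_uzv_apply (hg : SmoothF g) (t : ℝ) (i j : ℕ) (x y z : ℝ) :
    pdh i j (uzv t g) x y z = uz1 t (pdh i j g x y) (pdh i j (rdr g) x y) z := by
  rw [pdh_uzv hg]
  rfl

theorem pdh_pdz_z_mul_phiF_apply (hg : SmoothF g) (t : ℝ) (i j : ℕ) (x y z : ℝ) :
    pdh i j (pdz fun x y z => z * phiF t g x y z) x y z = dzphi1 t (pdh i j g x y) z := by
  rw [pdh_pdz_z_mul_phiF hg, ur_eq (hg.pdh i j)]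
  rfl

theorem pdh_pdz_ur_apply (hg : SmoothF g) (t : ℝ) (i j : ℕ) (x y z : ℝ) :
    pdh i j (pdz (ur t g)) x y z =
      dur1 t (pdh i j g x y) (pdh i j (pdz g) x y) z := by
  rw [pdh_pdz_ur hg, ur_eq (hg.pdh i j)]
  rfl

theorem DecaySmooth.tendsto_pdh (hg : DecaySmooth g) (i j : ℕ) (x y : ℝ) :
    Tendsto (pdh i j g x y) atTop (nhds 0) := by
  simpa using hg.2 i j 0 0 x y

theorem SmoothF.hasDerivAt_pdh (hg : SmoothF g) (i j : ℕ) (x y z : ℝ) :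
    HasDerivAt (_root_.pdh i j g x y) (_root_.pdh i j (_root_.pdz g) x y z) z := by
  rw [← pdz_pdh hg]
  exact (hg.pdh i j).hasDerivAt_pdz x y z

theorem enorm_one_div_two_mul_angT_le (ht : 0 ≤ t) :
    ‖1 / (2 * angT t)‖ₑ ≤ ‖(angT t)⁻¹‖ₑ := by
  have hT := angT_pos ht
  rw [Real.enorm_of_nonneg (by positivity), Real.enorm_of_nonneg (by positivity), ← one_div]
  refine ENNReal.ofReal_le_ofReal (one_div_le_one_div_of_le hT ?_)
  linarith

section

variable (ht : 0 ≤ t) (hg : DecaySmooth g) (a b : ℕ)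

include ht hg

theorem enorm_I1_le : ‖I1 t g a b‖ₑ ≤ 18000 * eJ t g a b := by
  have hs : SmoothF g := hg.1
  have hP : SmoothF fun x y z => ur t g x y z * rdr g x y z := (hs.ur t).mul hs.rdr
  rw [I1, ← neg_one_mul]
  refine enorm_trip_local_le hs (fun x y => (hP.pdh a b).continuous_z x y) (by norm_num)
    fun x y => ?_
  refine seminorm_pdh_mul_le (const_mul_vL2_add_le _) (const_mul_vL2_const_mul _) (hs.ur t) hs.rdr
    (fun i j i' j' => ?_) a b
  simp only [pdh_ur_apply hs, enorm_neg, enorm_one, one_mul]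
  refine (vL2_ur1_mul_le (E := vE t g i j (x, y)) (H := vH t g i' j' (x, y)) ht
      ((hs.pdh i j).continuous_z x y) (hs.hasDerivAt_pdh i j x y)
    ((hs.pdz.pdh i j).continuous_z x y) (hg.tendsto_pdh i j x y)
    ((hs.rdr.pdh i' j').continuous_z x y) le_self_add le_add_self le_add_self).trans ?_
  exact mul_le_mul' (by norm_num) le_rfl

theorem enorm_I2_le : ‖I2 t g a b‖ₑ ≤ 18000 * eJ t g a b := by
  have hs : SmoothF g := hg.1
  have hP : SmoothF fun x y z => pdz g x y z * uzv t g x y z := hs.pdz.mul (hs.uzv t)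
  have e : (fun x y z => uzv t g x y z * pdz g x y z) = fun x y z => pdz g x y z * uzv t g x y z :=
    by simp only [mul_comm]
  rw [I2, e, ← neg_one_mul]
  refine enorm_trip_local_le hs (fun x y => (hP.pdh a b).continuous_z x y) (by norm_num)
    fun x y => ?_
  refine seminorm_pdh_mul_le (const_mul_vL2_add_le _) (const_mul_vL2_const_mul _) hs.pdz (hs.uzv t)
    (fun i j i' j' => ?_) a b
  simp only [pdh_uzv_apply hs, enorm_neg, enorm_one, one_mul]
  refine (vL2_deriv_mul_uz1_le (E := vE t g i j (x, y)) (H := vH t g i' j' (x, y)) ht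
      ((hs.pdz.pdh i j).continuous_z x y)
    ((hs.pdh i' j').continuous_z x y) ((hs.rdr.pdh i' j').continuous_z x y)
    le_add_self le_self_add le_add_self).trans ?_
  exact mul_le_mul' (by norm_num) le_rfl

theorem enorm_I3_le : ‖I3 t g a b‖ₑ ≤ 18000 * eJ t g a b := by
  have hs : SmoothF g := hg.1
  have hP : SmoothF fun x y z => ur t g x y z * ur t g x y z := (hs.ur t).mul (hs.ur t)
  simp only [I3, sq]
  rw [← neg_one_mul]
  refine enorm_trip_local_le hs (fun x y => (hP.pdh a b).continuous_z x y) (by norm_num)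
    fun x y => ?_
  refine seminorm_pdh_mul_le (const_mul_vL2_add_le _) (const_mul_vL2_const_mul _) (hs.ur t)
    (hs.ur t) (fun i j i' j' => ?_) a b
  simp only [pdh_ur_apply hs, enorm_neg, enorm_one, one_mul]
  refine (vL2_ur1_mul_ur1_le (E := vE t g i j (x, y)) (H := vH t g i' j' (x, y)) ht
      ((hs.pdh i j).continuous_z x y) (hs.hasDerivAt_pdh i j x y)
    ((hs.pdz.pdh i j).continuous_z x y) (hg.tendsto_pdh i j x y)
    ((hs.pdh i' j').continuous_z x y) le_self_add le_add_self le_self_add).trans ?_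
  exact mul_le_mul' (by norm_num) le_rfl

theorem enorm_I4_le : ‖I4 t g a b‖ₑ ≤ 18000 * eJ t g a b := by
  have hs : SmoothF g := hg.1
  have hz : SmoothF (pdz fun x y z => z * phiF t g x y z) := (hs.phiF t).z_mul.pdz
  have hP : SmoothF fun x y z => (pdz fun x y z => z * phiF t g x y z) x y z * uzv t g x y z :=
    hz.mul (hs.uzv t)
  have e : (fun x y z => uzv t g x y z * pdz (fun x y z => z * phiF t g x y z) x y z) =
      fun x y z => (pdz fun x y z => z * phiF t g x y z) x y z * uzv t g x y z := by
    simp only [mul_comm]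
  rw [I4, e]
  refine enorm_trip_local_le hs (fun x y => (hP.pdh a b).continuous_z x y) (by norm_num)
    fun x y => ?_
  refine seminorm_pdh_mul_le (const_mul_vL2_add_le _) (const_mul_vL2_const_mul _) hz (hs.uzv t)
    (fun i j i' j' => ?_) a b
  simp only [pdh_uzv_apply hs, pdh_pdz_z_mul_phiF_apply hs]
  refine (mul_le_mul' (enorm_one_div_two_mul_angT_le ht) le_rfl).trans
    ((vL2_dzphi1_mul_uz1_le (E := vE t g i j (x, y)) (H := vH t g i' j' (x, y)) ht
        ((hs.pdh i j).continuous_z x y)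
    ((hs.pdh i' j').continuous_z x y) ((hs.rdr.pdh i' j').continuous_z x y)
    le_self_add le_self_add le_add_self).trans ?_)
  exact mul_le_mul' (by norm_num) le_rfl

theorem enorm_I5_le : ‖I5 t g a b‖ₑ ≤ 18000 * eJ t g a b := by
  have hs : SmoothF g := hg.1
  have hP : SmoothF fun x y z => ur t g x y z * phiF t g x y z := (hs.ur t).mul (hs.phiF t)
  have e : ∀ x y z : ℝ, z * thw t 2 z * angR x y ^ (2 * (a + b)) *
      pdh a b (fun x y z => ur t g x y z * phiF t g x y z) x y z = thw t 2 z *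
        angR x y ^ (2 * (a + b)) *
          (z * pdh a b (fun x y z => ur t g x y z * phiF t g x y z) x y z) := fun x y z => by ring
  simp only [I5, e]
  refine enorm_trip_local_le hs (P := fun x y z =>
    z * pdh a b (fun x y z => ur t g x y z * phiF t g x y z) x y z)
    (fun x y => continuous_id.mul ((hP.pdh a b).continuous_z x y)) (by norm_num) fun x y => ?_
  refine seminorm_pdh_mul_le (N := fun q => ‖-(1 / angT t)‖ₑ * vL2 t fun z => z * q z)
    (fun q k hq hk => ?_) (fun c q hq => ?_) (hs.ur t) (hs.phiF t) (fun i j i' j' => ?_) a b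
  · simp only [mul_add]
    exact const_mul_vL2_add_le _ _ _ (continuous_id.mul hq) (continuous_id.mul hk)
  · simp only [mul_left_comm _ c]
    exact const_mul_vL2_const_mul _ c _ (continuous_id.mul hq)
  · simp only [pdh_ur_apply hs, pdh_phiF_apply hs, enorm_neg, one_div]
    refine (vL2_mul_ur1_mul_phi1_le (E := vE t g i j (x, y)) (H := vH t g i' j' (x, y)) ht
        ((hs.pdh i j).continuous_z x y) (hs.hasDerivAt_pdh i j x y)
      ((hs.pdz.pdh i j).continuous_z x y) (hg.tendsto_pdh i j x y)
      ((hs.pdh i' j').continuous_z x y) le_self_add le_add_self le_self_add).trans ?_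
    exact mul_le_mul' (by norm_num) le_rfl

theorem enorm_I6_le : ‖I6 t g a b‖ₑ ≤ 18000 * eJ t g a b := by
  have hs : SmoothF g := hg.1
  simp only [I6, sq]
  refine enorm_trip_nonlocal_le ht hs (by norm_num) fun x y => ?_
  refine seminorm_pdh_mul_le (const_mul_vL1_add_le _) (const_mul_vL1_const_mul _) (hs.ur t)
    (hs.ur t) (fun i j i' j' => ?_) a b
  simp only [pdh_ur_apply hs]
  rw [enorm_neg]
  exact (mul_le_mul' (enorm_one_div_two_mul_angT_le ht) le_rfl).trans
    (vL1_ur1_mul_ur1_le (E := vE t g i j (x, y)) (H := vH t g i' j' (x, y)) ht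
        ((hs.pdh i j).continuous_z x y) ((hs.pdh i' j').continuous_z x y)
      le_self_add le_self_add)

theorem enorm_I7_le : ‖I7 t g a b‖ₑ ≤ 18000 * eJ t g a b := by
  have hs : SmoothF g := hg.1
  rw [I7]
  refine enorm_trip_nonlocal_le ht hs (by norm_num) fun x y => ?_
  refine seminorm_pdh_mul_le (const_mul_vL1_add_le _) (const_mul_vL1_const_mul _) (hs.ur t).pdz
    (hs.uzv t) (fun i j i' j' => ?_) a b
  simp only [pdh_uzv_apply hs, pdh_pdz_ur_apply hs, one_div]
  exact vL1_dur1_mul_uz1_le (E := vE t g i j (x, y)) (H := vH t g i' j' (x, y)) ht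
      ((hs.pdh i j).continuous_z x y)
    ((hs.pdz.pdh i j).continuous_z x y) ((hs.pdh i' j').continuous_z x y)
    ((hs.rdr.pdh i' j').continuous_z x y) le_self_add le_add_self le_self_add le_add_self

theorem enorm_Iall_le : ‖Iall t g a b‖ₑ ≤ 126000 * eJ t g a b := by
  have h : ∀ u v : ℝ, ‖u + v‖ₑ ≤ ‖u‖ₑ + ‖v‖ₑ := enorm_add_le
  calc ‖Iall t g a b‖ₑ ≤ ‖I1 t g a b‖ₑ + ‖I2 t g a b‖ₑ + ‖I3 t g a b‖ₑ + ‖I4 t g a b‖ₑ +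
        ‖I5 t g a b‖ₑ + ‖I6 t g a b‖ₑ + ‖I7 t g a b‖ₑ := by
        have e : ∀ u : ℝ, ‖u‖ₑ = ‖|u|‖ₑ := fun u => by
          rw [Real.enorm_eq_ofReal_abs, Real.enorm_eq_ofReal_abs, abs_abs]
        simp only [e (I1 t g a b), e (I2 t g a b), e (I3 t g a b), e (I4 t g a b),
          e (I5 t g a b), e (I6 t g a b), e (I7 t g a b), Iall]
        iterate 5 refine (h _ _).trans (add_le_add ?_ le_rfl)
        exact h _ _
    _ ≤ 18000 * eJ t g a b + 18000 * eJ t g a b + 18000 * eJ t g a b + 18000 * eJ t g a b +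
        18000 * eJ t g a b + 18000 * eJ t g a b + 18000 * eJ t g a b := by
        gcongr
        · exact enorm_I1_le ht hg a b
        · exact enorm_I2_le ht hg a b
        · exact enorm_I3_le ht hg a b
        · exact enorm_I4_le ht hg a b
        · exact enorm_I5_le ht hg a b
        · exact enorm_I6_le ht hg a b
        · exact enorm_I7_le ht hg a b
    _ = _ := by ring

end

end NonlinearTerms

/-- the sum of a double sequence over the unit square of shifts -/
def hat (u : ℕ → ℕ → ℝ≥0∞) (i j : ℕ) : ℝ≥0∞ :=
  u i j + u i (j + 1) + (u (i + 1) j + u (i + 1) (j + 1))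

/-- the norm `‖θ ⟨r⟩^{|α|} ∂^α_h f‖_{L²}` for `α = (i, j)` -/
def eN (t : ℝ) (f : ℝ → ℝ → ℝ → ℝ) (i j : ℕ) : ℝ≥0∞ := eL2 t (i + j) (pdh i j f)

/-- the combination of norms of `∂^α g` and `⟨t⟩^{1/4} ∂^α ∂_z g` -/
def eE (t : ℝ) (g : ℝ → ℝ → ℝ → ℝ) (i j : ℕ) : ℝ≥0∞ := eN t g i j + sig t * eN t (pdz g) i j

/-- the bound of the norms of `∂^α g` and `∂^α (r ∂_r g)` -/
def eH (t : ℝ) (g : ℝ → ℝ → ℝ → ℝ) (i j : ℕ) : ℝ≥0∞ :=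
  ((i + j : ℕ) + 1 : ℝ≥0∞) * eN t g i j + (eN t g (i + 1) j + eN t g i (j + 1))

/-- the bound of the product of derivatives of orders `(i, j)` and `(k, l)` -/
def eT (t : ℝ) (g : ℝ → ℝ → ℝ → ℝ) (i j k l : ℕ) : ℝ≥0∞ :=
  if i + j ≤ k + l then hat (eE t g) i j * eH t g k l else eE t g i j * hat (eH t g) k l

theorem hat_mono {u v : ℕ → ℕ → ℝ≥0∞} (h : ∀ i j, u i j ≤ v i j) (i j : ℕ) :
    hat u i j ≤ hat v i j := by
  unfold hat
  gcongr <;> exact h _ _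

theorem hat_add (u v : ℕ → ℕ → ℝ≥0∞) (i j : ℕ) :
    hat (fun i j => u i j + v i j) i j = hat u i j + hat v i j := by
  unfold hat
  ring

theorem hat_const_mul (c : ℝ≥0∞) (u : ℕ → ℕ → ℝ≥0∞) (i j : ℕ) :
    hat (fun i j => c * u i j) i j = c * hat u i j := by
  unfold hat
  ring

section Products

variable {t : ℝ} {f g : ℝ → ℝ → ℝ → ℝ}

theorem eR_mul_vL2_pdh_le (hf : SmoothF f) (i j : ℕ) (p : ℝ × ℝ) :
    eR p.1 p.2 ^ (i + j) * vL2 t (pdh i j f p.1 p.2) ≤ 2 * hat (eN t f) i j := by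
  refine (eR_mul_vL2_le (hf.pdh i j) (i + j) p.1 p.2).trans ?_
  rw [pdx_pdh, pdy_pdh hf, pdy_pdh hf]
  unfold hat eN
  gcongr 2 * (_ + ?_ + (?_ + ?_)) <;> exact eL2_mono_exponent (by lia) _

theorem eN_rdr_le (hg : SmoothF g) (i j : ℕ) :
    eN t (rdr g) i j ≤ eN t g (i + 1) j + eN t g i (j + 1) + (i + j : ℕ) * eN t g i j := by
  have hX := (hg.pdh (i + 1) j).measurable_eR_mul_vL2 t (i + 1 + j)
  have hY := (hg.pdh i (j + 1)).measurable_eR_mul_vL2 t (i + (j + 1))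
  have hZ := (hg.pdh i j).measurable_eR_mul_vL2 t (i + j)
  have h : ∀ p : ℝ × ℝ, eR p.1 p.2 ^ (i + j) * vL2 t (pdh i j (rdr g) p.1 p.2) ≤
      eR p.1 p.2 ^ (i + 1 + j) * vL2 t (pdh (i + 1) j g p.1 p.2) +
      eR p.1 p.2 ^ (i + (j + 1)) * vL2 t (pdh i (j + 1) g p.1 p.2) +
      (i + j : ℕ) * (eR p.1 p.2 ^ (i + j) * vL2 t (pdh i j g p.1 p.2)) := fun p => by
    have cx := (hg.pdh (i + 1) j).continuous_z p.1 p.2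
    have cy := (hg.pdh i (j + 1)).continuous_z p.1 p.2
    have cz := (hg.pdh i j).continuous_z p.1 p.2
    have hv : vL2 t (pdh i j (rdr g) p.1 p.2) ≤ ‖p.1‖ₑ * vL2 t (pdh (i + 1) j g p.1 p.2) +
        ‖p.2‖ₑ * vL2 t (pdh i (j + 1) g p.1 p.2) +
        ‖((i : ℝ) + j)‖ₑ * vL2 t (pdh i j g p.1 p.2) := by
      rw [pdh_rdr hg, ← vL2_const_mul _ cx, ← vL2_const_mul _ cy, ← vL2_const_mul _ cz]
      refine (vL2_add_le ((cx.const_mul _).add (cy.const_mul _)) (cz.const_mul _)).trans ?_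
      gcongr
      exact vL2_add_le (cx.const_mul _) (cy.const_mul _)
    have hc : ‖((i : ℝ) + j)‖ₑ = (i + j : ℕ) := by
      rw [← Nat.cast_add, Real.enorm_of_nonneg (Nat.cast_nonneg _), ENNReal.ofReal_natCast]
    calc _ ≤ eR p.1 p.2 ^ (i + j) * (eR p.1 p.2 * vL2 t (pdh (i + 1) j g p.1 p.2) +
          eR p.1 p.2 * vL2 t (pdh i (j + 1) g p.1 p.2) +
          (i + j : ℕ) * vL2 t (pdh i j g p.1 p.2)) := by
          rw [hc] at hv
          refine mul_le_mul' le_rfl (hv.trans ?_)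
          gcongr
          · exact enorm_x_le_eR _ _
          · exact enorm_y_le_eR _ _
      _ = _ := by ring
  refine (el2_mono_ae (Eventually.of_forall h)).trans ?_
  refine (el2_add_le (hX.add hY).aemeasurable (hZ.const_mul _).aemeasurable).trans ?_
  rw [el2_const_mul _ hZ.aemeasurable]
  exact add_le_add (el2_add_le hX.aemeasurable hY.aemeasurable) le_rfl

theorem eN_add_eN_rdr_le (hg : SmoothF g) (i j : ℕ) :
    eN t g i j + eN t (rdr g) i j ≤ eH t g i j := by
  calc _ ≤ eN t g i j + (eN t g (i + 1) j + eN t g i (j + 1) + (i + j : ℕ) * eN t g i j) :=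
        add_le_add le_rfl (eN_rdr_le hg i j)
    _ = _ := by
        unfold eH
        ring

theorem eR_mul_vE_le (hg : SmoothF g) (i j : ℕ) (p : ℝ × ℝ) :
    eR p.1 p.2 ^ (i + j) * vE t g i j p ≤ 2 * hat (eE t g) i j := by
  have e : hat (eE t g) i j = hat (eN t g) i j + sig t * hat (eN t (pdz g)) i j := by
    rw [← hat_const_mul, ← hat_add]
    rfl
  rw [vE, mul_add, mul_left_comm, e, mul_add, mul_left_comm 2]
  exact add_le_add (eR_mul_vL2_pdh_le hg i j p)
    (mul_le_mul' le_rfl (eR_mul_vL2_pdh_le hg.pdz i j p))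

theorem eR_mul_vH_le (hg : SmoothF g) (i j : ℕ) (p : ℝ × ℝ) :
    eR p.1 p.2 ^ (i + j) * vH t g i j p ≤ 2 * hat (eH t g) i j := by
  refine le_trans ?_ (mul_le_mul' le_rfl (hat_mono (eN_add_eN_rdr_le hg) i j))
  rw [vH, mul_add, hat_add, mul_add]
  exact add_le_add (eR_mul_vL2_pdh_le hg i j p) (eR_mul_vL2_pdh_le hg.rdr i j p)

theorem el2_eR_mul_vE_le (hg : SmoothF g) (i j : ℕ) :
    el2 volume (fun p : ℝ × ℝ => eR p.1 p.2 ^ (i + j) * vE t g i j p) ≤ eE t g i j := by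
  have h := (hg.pdh i j).measurable_eR_mul_vL2 t (i + j)
  have hz := (hg.pdz.pdh i j).measurable_eR_mul_vL2 t (i + j)
  simp only [vE, mul_add, mul_left_comm _ (sig t)]
  refine (el2_add_le h.aemeasurable (hz.const_mul _).aemeasurable).trans ?_
  rw [el2_const_mul _ hz.aemeasurable]
  rfl

theorem el2_eR_mul_vH_le (hg : SmoothF g) (i j : ℕ) :
    el2 volume (fun p : ℝ × ℝ => eR p.1 p.2 ^ (i + j) * vH t g i j p) ≤ eH t g i j := by
  refine le_trans ?_ (eN_add_eN_rdr_le hg i j)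
  simp only [vH, mul_add]
  exact el2_add_le ((hg.pdh i j).measurable_eR_mul_vL2 t (i + j)).aemeasurable
    ((hg.rdr.pdh i j).measurable_eR_mul_vL2 t (i + j)).aemeasurable

/-- one factor in `L^∞`, the other two in `L²` -/
theorem lintegral_mul_mul_le {α : Type*} [MeasurableSpace α] {μ : Measure α}
    {A B G : α → ℝ≥0∞} (hB : AEMeasurable B μ) (hG : AEMeasurable G μ) {S K : ℝ≥0∞}
    (hA : ∀ p, A p ≤ S) (hK : el2 μ B ≤ K) : ∫⁻ p, A p * B p * G p ∂μ ≤ S * K * el2 μ G := by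
  calc _ ≤ ∫⁻ p, S * B p * G p ∂μ := lintegral_mono fun p => by gcongr; exact hA p
    _ ≤ el2 μ (fun p => S * B p) * el2 μ G := lintegral_mul_le_el2 (hB.const_mul S) hG
    _ ≤ _ := by
        rw [el2_const_mul _ hB]
        gcongr

theorem lintegral_vE_mul_vH_le (hg : SmoothF g) (i j k l : ℕ) :
    ∫⁻ p : ℝ × ℝ, eR p.1 p.2 ^ (2 * (i + k + (j + l))) *
      (vE t g i j p * vH t g k l p * vL2 t (pdh (i + k) (j + l) g p.1 p.2)) ≤
      2 * eN t g (i + k) (j + l) * eT t g i j k l := by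
  have hG := ((hg.pdh (i + k) (j + l)).measurable_eR_mul_vL2 t (i + k + (j + l))).aemeasurable
    (μ := volume)
  have hE : AEMeasurable (fun p : ℝ × ℝ => eR p.1 p.2 ^ (i + j) * vE t g i j p) volume :=
    ((measurable_eR.pow_const _).mul (hg.measurable_vE t i j)).aemeasurable
  have hH : AEMeasurable (fun p : ℝ × ℝ => eR p.1 p.2 ^ (k + l) * vH t g k l p) volume :=
    ((measurable_eR.pow_const _).mul (hg.measurable_vH t k l)).aemeasurable
  unfold eT
  split_ifs
  · have h := lintegral_mul_mul_le hH hG (eR_mul_vE_le (t := t) hg i j)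
      (el2_eR_mul_vH_le hg k l)
    calc _ = _ := lintegral_congr fun p => by ring
      _ ≤ _ := h
      _ = _ := by
        rw [eN, eL2]
        ring
  · have h := lintegral_mul_mul_le hE hG (eR_mul_vH_le (t := t) hg k l)
      (el2_eR_mul_vE_le hg i j)
    calc _ = _ := lintegral_congr fun p => by ring
      _ ≤ _ := h
      _ = _ := by
        rw [eN, eL2]
        ring

theorem eJ_le (hg : SmoothF g) (a b : ℕ) :
    eJ t g a b ≤ 2 * eN t g a b * ∑ i ∈ Finset.range (a + 1), ∑ j ∈ Finset.range (b + 1),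
      ((a.choose i : ℝ≥0∞) * (b.choose j : ℝ≥0∞)) * eT t g i j (a - i) (b - j) := by
  have hm : ∀ i j, Measurable fun p : ℝ × ℝ => eR p.1 p.2 ^ (2 * (a + b)) *
      (vE t g i j p * vH t g (a - i) (b - j) p * vL2 t (pdh a b g p.1 p.2)) := fun i j =>
    (measurable_eR.pow_const _).mul (((hg.measurable_vE t i j).mul
      (hg.measurable_vH t (a - i) (b - j))).mul ((hg.pdh a b).measurable_vL2 t))
  have e : ∀ p : ℝ × ℝ, eR p.1 p.2 ^ (2 * (a + b)) *
      (vS t g a b p * vL2 t (pdh a b g p.1 p.2)) = ∑ i ∈ Finset.range (a + 1),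
      ∑ j ∈ Finset.range (b + 1), ((a.choose i : ℝ≥0∞) * (b.choose j : ℝ≥0∞)) *
        (eR p.1 p.2 ^ (2 * (a + b)) *
          (vE t g i j p * vH t g (a - i) (b - j) p * vL2 t (pdh a b g p.1 p.2))) := fun p => by
    simp only [vS, Finset.sum_mul, Finset.mul_sum]
    refine Finset.sum_congr rfl fun i _ => Finset.sum_congr rfl fun j _ => ?_
    ring
  simp only [eJ, e]
  rw [lintegral_finsetSum _ fun i _ => Finset.measurable_fun_sum _ fun j _ =>
    (hm i j).const_mul _, Finset.mul_sum]
  refine Finset.sum_le_sum fun i hi => ?_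
  rw [lintegral_finsetSum _ fun j _ => (hm i j).const_mul _, Finset.mul_sum]
  refine Finset.sum_le_sum fun j hj => ?_
  rw [lintegral_const_mul _ (hm i j), mul_left_comm]
  refine mul_le_mul' le_rfl ?_
  have h := lintegral_vE_mul_vH_le (t := t) hg i j (a - i) (b - j)
  rwa [Nat.add_sub_cancel' (Finset.mem_range_succ_iff.1 hi),
    Nat.add_sub_cancel' (Finset.mem_range_succ_iff.1 hj)] at h

end Products

section Weights

theorem choose_mul_choose_le (i j k l : ℕ) :
    (i + k).choose i * (j + l).choose j ≤ (i + j + (k + l)).choose (i + j) := by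
  rw [show i + j + (k + l) = i + k + (j + l) by ring, Nat.add_choose_eq (i + k)]
  exact Finset.single_le_sum (f := fun ij : ℕ × ℕ => (i + k).choose ij.1 * (j + l).choose ij.2)
    (fun _ _ => Nat.zero_le _) (Finset.HasAntidiagonal.mem_antidiagonal.2 rfl : (i, j) ∈ _)

theorem choose_mul_pow_mul_Mfac_le {τ : ℝ} (hτ : 0 < τ) {m n : ℕ} (h : m ≤ n) :
    ((m + n).choose m : ℝ) * (τ ^ (m + n) * Mfac (m + n)) ≤
      16 * (τ ^ m / m.factorial * (τ ^ n * Mfac n)) := by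
  have hm := Nat.cast_pos (α := ℝ).2 m.factorial_pos
  have hn := Nat.cast_pos (α := ℝ).2 n.factorial_pos
  have hmn := Nat.cast_pos (α := ℝ).2 (m + n).factorial_pos
  have e : ((m + n).choose m : ℝ) * m.factorial * n.factorial = (m + n).factorial :=
    mod_cast Nat.choose_symm_add ▸ Nat.add_choose_mul_factorial_mul_factorial m n
  have hp : ((m + n : ℕ) + 1 : ℝ) ^ 4 ≤ 16 * ((n : ℝ) + 1) ^ 4 := by
    calc ((m + n : ℕ) + 1 : ℝ) ^ 4 ≤ (2 * ((n : ℝ) + 1)) ^ 4 := by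
          have : (m : ℝ) ≤ n := mod_cast h
          refine pow_le_pow_left₀ (by positivity) ?_ 4
          push_cast
          linarith
      _ = _ := by ring
  have e' : ((m + n).choose m : ℝ) = (m + n).factorial / (m.factorial * n.factorial) := by
    rw [← e]
    field_simp
  calc _ = τ ^ (m + n) / (m.factorial * n.factorial) * ((m + n : ℕ) + 1 : ℝ) ^ 4 := by
        rw [Mfac, e']
        field_simp
    _ ≤ τ ^ (m + n) / (m.factorial * n.factorial) * (16 * ((n : ℝ) + 1) ^ 4) := by gcongr
    _ = _ := by
        rw [Mfac, pow_add]
        field_simp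

theorem pow_div_factorial_le {τ : ℝ} (hτ : 0 < τ) (n : ℕ) {d : ℕ} (hd : d ≤ 4) :
    τ ^ n / n.factorial ≤ (1 / τ) ^ d * (τ ^ (n + d) * Mfac (n + d)) := by
  have hn := Nat.cast_pos (α := ℝ).2 n.factorial_pos
  have hnd := Nat.cast_pos (α := ℝ).2 (n + d).factorial_pos
  have h : ((n + d).factorial : ℝ) ≤ n.factorial * ((n + d : ℕ) + 1 : ℝ) ^ 4 := by
    have h1 : (n + d).factorial ≤ n.factorial * (n + d + 1) ^ 4 := by
      rw [← Nat.factorial_mul_ascFactorial]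
      refine Nat.mul_le_mul le_rfl ?_
      exact (Nat.ascFactorial_le_pow_add n d).trans
        ((Nat.pow_le_pow_left (by lia) d).trans (Nat.pow_le_pow_right (by lia) hd))
    exact_mod_cast h1
  rw [Mfac, pow_add, one_div, inv_pow]
  rw [show (τ ^ d)⁻¹ * (τ ^ n * τ ^ d * (((n + d : ℕ) + 1 : ℝ) ^ 4 / (n + d).factorial)) =
    τ ^ n * (((n + d : ℕ) + 1 : ℝ) ^ 4 / (n + d).factorial) by field_simp, div_eq_mul_one_div]
  refine mul_le_mul_of_nonneg_left ?_ (by positivity)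
  rw [div_le_div_iff₀ hn hnd]
  linarith

theorem Mfac_nonneg (n : ℕ) : 0 ≤ Mfac n := by
  unfold Mfac
  positivity

theorem Mfac_le_succ (n : ℕ) : Mfac n ≤ ((n : ℝ) + 1) * Mfac (n + 1) := by
  have hn := Nat.cast_pos (α := ℝ).2 n.factorial_pos
  rw [Mfac, Mfac, Nat.factorial_succ]
  push_cast
  rw [show ((n : ℝ) + 1) * (((n : ℝ) + 1 + 1) ^ 4 / (((n : ℝ) + 1) * n.factorial)) =
    ((n : ℝ) + 1 + 1) ^ 4 / n.factorial by field_simp]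
  gcongr
  linarith

/-- the weight `τⁿ Mₙ` -/
def mW (τ : ℝ) (n : ℕ) : ℝ≥0∞ := ENNReal.ofReal (τ ^ n * Mfac n)

/-- the weight `τ^{n-1} n Mₙ` -/
def yW (τ : ℝ) (n : ℕ) : ℝ≥0∞ := ENNReal.ofReal (τ ^ (n - 1) * n * Mfac n)

/-- the weight `τⁿ / n!` -/
def fW (τ : ℝ) (n : ℕ) : ℝ≥0∞ := ENNReal.ofReal (τ ^ n / n.factorial)

variable {τ : ℝ} (hτ : 0 < τ)

include hτ

theorem choose_mul_choose_mul_mW_le {i j k l : ℕ} (h : i + j ≤ k + l) :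
    ((i + k).choose i * (j + l).choose j : ℝ≥0∞) * mW τ (i + k + (j + l)) ≤
      16 * (fW τ (i + j) * mW τ (k + l)) := by
  calc _ ≤ ((i + j + (k + l)).choose (i + j) : ℝ≥0∞) * mW τ (i + j + (k + l)) := by
        rw [show i + k + (j + l) = i + j + (k + l) by ring]
        refine mul_le_mul' ?_ le_rfl
        exact_mod_cast choose_mul_choose_le i j k l
    _ = ENNReal.ofReal (((i + j + (k + l)).choose (i + j) : ℝ) *
          (τ ^ (i + j + (k + l)) * Mfac (i + j + (k + l)))) := by
        rw [ENNReal.ofReal_mul (Nat.cast_nonneg _), ENNReal.ofReal_natCast, mW]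
    _ ≤ _ := ENNReal.ofReal_le_ofReal (choose_mul_pow_mul_Mfac_le hτ h)
    _ = _ := by
        rw [ENNReal.ofReal_mul (by norm_num), ENNReal.ofReal_mul (by positivity), fW, mW]
        norm_num

theorem choose_mul_choose_mul_mW_le' {i j k l : ℕ} (h : k + l ≤ i + j) :
    ((i + k).choose i * (j + l).choose j : ℝ≥0∞) * mW τ (i + k + (j + l)) ≤
      16 * (mW τ (i + j) * fW τ (k + l)) := by
  have := choose_mul_choose_mul_mW_le hτ h
  rwa [add_comm k i, add_comm l j, ← Nat.choose_symm_add, ← Nat.choose_symm_add,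
    mul_comm (fW τ _)] at this

theorem fW_le (n : ℕ) {d : ℕ} (hd : d ≤ 4) :
    fW τ n ≤ ENNReal.ofReal (1 / τ) ^ d * mW τ (n + d) := by
  rw [fW, mW, ← ENNReal.ofReal_pow (by positivity), ← ENNReal.ofReal_mul (by positivity)]
  exact ENNReal.ofReal_le_ofReal (pow_div_factorial_le hτ n hd)

theorem mW_le_yW_succ (n : ℕ) : mW τ n ≤ yW τ (n + 1) := by
  refine ENNReal.ofReal_le_ofReal ?_
  rw [Nat.add_sub_cancel, mul_assoc]
  push_cast
  gcongr
  exact Mfac_le_succ n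

theorem succ_mul_mW (n : ℕ) :
    ((n : ℝ≥0∞) + 1) * mW τ n = mW τ n + ENNReal.ofReal τ * yW τ n := by
  have hM := Mfac_nonneg n
  have h : (n : ℝ≥0∞) * mW τ n = ENNReal.ofReal τ * yW τ n := by
    rw [mW, yW, ← ENNReal.ofReal_natCast, ← ENNReal.ofReal_mul n.cast_nonneg,
      ← ENNReal.ofReal_mul hτ.le]
    congr 1
    rcases n with _ | n
    · simp
    · rw [Nat.add_sub_cancel, pow_succ]
      ring
  rw [add_mul, one_mul, h, add_comm]

end Weights

section Sums

theorem tsum_sum_range_eq (G : ℕ → ℕ → ℝ≥0∞) :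
    ∑' n, ∑ a ∈ Finset.range (n + 1), G a (n - a) = ∑' a, ∑' b, G a b := by
  have e : ∀ n, ∑ a ∈ Finset.range (n + 1), G a (n - a) =
      ∑ p ∈ Finset.HasAntidiagonal.antidiagonal n, G p.1 p.2 := fun n =>
    (Finset.Nat.sum_antidiagonal_eq_sum_range_succ G n).symm
  rw [← ENNReal.tsum_prod (f := G),
    ← (Finset.HasAntidiagonal.sigmaAntidiagonalEquivProd (A := ℕ)).tsum_eq,
    ENNReal.tsum_sigma']
  refine tsum_congr fun n => ?_
  rw [e, tsum_fintype, ← Finset.sum_coe_sort]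
  rfl

theorem tsum_sum_range_convolution (F : ℕ → ℕ → ℕ → ℕ → ℝ≥0∞) :
    ∑' a, ∑' b, ∑ i ∈ Finset.range (a + 1), ∑ j ∈ Finset.range (b + 1),
      F i j (a - i) (b - j) = ∑' i, ∑' j, ∑' k, ∑' l, F i j k l := by
  have h : ∀ a, ∑' b, ∑ i ∈ Finset.range (a + 1), ∑ j ∈ Finset.range (b + 1),
      F i j (a - i) (b - j) = ∑ i ∈ Finset.range (a + 1), ∑' j, ∑' l, F i j (a - i) l := fun a => by
    rw [Summable.tsum_finsetSum fun _ _ => ENNReal.summable]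
    exact Finset.sum_congr rfl fun i _ => tsum_sum_range_eq fun j l => F i j (a - i) l
  simp only [h]
  rw [tsum_sum_range_eq fun i k => ∑' j, ∑' l, F i j k l]
  exact tsum_congr fun i => ENNReal.tsum_comm

theorem tsum_tsum_mul (u v : ℕ → ℕ → ℝ≥0∞) :
    ∑' i, ∑' j, ∑' k, ∑' l, u i j * v k l = (∑' i, ∑' j, u i j) * ∑' k, ∑' l, v k l := by
  simp only [ENNReal.tsum_mul_left, ENNReal.tsum_mul_right]

theorem tsum_tsum_shift_le (u : ℕ → ℕ → ℝ≥0∞) (p q : ℕ) :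
    ∑' i, ∑' j, u (i + p) (j + q) ≤ ∑' i, ∑' j, u i j :=
  (ENNReal.tsum_le_tsum fun i => ENNReal.tsum_comp_le_tsum_of_injective
    (add_left_injective q) (u (i + p))).trans
    (ENNReal.tsum_comp_le_tsum_of_injective (add_left_injective p) fun i => ∑' j, u i j)

theorem tsum_tsum_fW_mul_shift_le {τ : ℝ} (hτ : 0 < τ) (u : ℕ → ℕ → ℝ≥0∞) (p q : ℕ)
    (h : p + q ≤ 4) : ∑' i, ∑' j, fW τ (i + j) * u (i + p) (j + q) ≤
      ENNReal.ofReal (1 / τ) ^ (p + q) * ∑' i, ∑' j, mW τ (i + j) * u i j := by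
  refine le_trans ?_ (mul_le_mul' le_rfl
    (tsum_tsum_shift_le (fun i j => mW τ (i + j) * u i j) p q))
  simp only [← ENNReal.tsum_mul_left]
  refine ENNReal.tsum_le_tsum fun i => ENNReal.tsum_le_tsum fun j => ?_
  rw [← mul_assoc, show i + p + (j + q) = i + j + (p + q) by ring]
  exact mul_le_mul' (fW_le hτ _ h) le_rfl

theorem tsum_tsum_fW_mul_hat_le {τ : ℝ} (hτ : 0 < τ) (u : ℕ → ℕ → ℝ≥0∞) :
    ∑' i, ∑' j, fW τ (i + j) * hat u i j ≤
      (1 + ENNReal.ofReal (1 / τ)) ^ 2 * ∑' i, ∑' j, mW τ (i + j) * u i j := by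
  have h := tsum_tsum_fW_mul_shift_le hτ u
  simp only [hat, mul_add, ENNReal.tsum_add]
  refine (add_le_add (add_le_add (h 0 0 (by norm_num)) (h 0 1 (by norm_num)))
    (add_le_add (h 1 0 (by norm_num)) (h 1 1 (by norm_num)))).trans_eq ?_
  ring

variable {t τ : ℝ} {g : ℝ → ℝ → ℝ → ℝ}

theorem tsum_tsum_mW_mul_eH_le (hτ : 0 < τ) :
    ∑' i, ∑' j, mW τ (i + j) * eH t g i j ≤ ∑' i, ∑' j, mW τ (i + j) * eN t g i j +
      (2 + ENNReal.ofReal τ) * ∑' i, ∑' j, yW τ (i + j) * eN t g i j := by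
  have e : ∀ i j, mW τ (i + j) * (((i + j : ℕ) + 1 : ℝ≥0∞) * eN t g i j) =
      mW τ (i + j) * eN t g i j + ENNReal.ofReal τ * (yW τ (i + j) * eN t g i j) := fun i j => by
    rw [mul_left_comm, ← mul_assoc, succ_mul_mW hτ, add_mul, mul_assoc (ENNReal.ofReal τ)]
  have hx : ∑' i, ∑' j, mW τ (i + j) * eN t g (i + 1) j ≤
      ∑' i, ∑' j, yW τ (i + j) * eN t g i j := by
    refine le_trans ?_ (tsum_tsum_shift_le (fun i j => yW τ (i + j) * eN t g i j) 1 0)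
    refine ENNReal.tsum_le_tsum fun i => ENNReal.tsum_le_tsum fun j => ?_
    rw [add_zero, add_right_comm]
    exact mul_le_mul' (mW_le_yW_succ hτ _) le_rfl
  have hy : ∑' i, ∑' j, mW τ (i + j) * eN t g i (j + 1) ≤
      ∑' i, ∑' j, yW τ (i + j) * eN t g i j := by
    refine le_trans ?_ (tsum_tsum_shift_le (fun i j => yW τ (i + j) * eN t g i j) 0 1)
    refine ENNReal.tsum_le_tsum fun i => ENNReal.tsum_le_tsum fun j => ?_
    rw [add_zero, ← add_assoc]
    exact mul_le_mul' (mW_le_yW_succ hτ _) le_rfl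
  simp only [eH, mul_add, e, ENNReal.tsum_add, ENNReal.tsum_mul_left]
  refine (add_le_add le_rfl (add_le_add hx hy)).trans_eq ?_
  ring

theorem choose_mul_choose_mul_mW_mul_eT_le (hτ : 0 < τ) (i j k l : ℕ) :
    ((i + k).choose i * (j + l).choose j : ℝ≥0∞) * (mW τ (i + k + (j + l)) * eT t g i j k l) ≤
      16 * ((fW τ (i + j) * hat (eE t g) i j) * (mW τ (k + l) * eH t g k l) +
        (mW τ (i + j) * eE t g i j) * (fW τ (k + l) * hat (eH t g) k l)) := by
  rw [← mul_assoc, eT]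
  split_ifs with h
  · calc _ ≤ 16 * (fW τ (i + j) * mW τ (k + l)) * (hat (eE t g) i j * eH t g k l) :=
          mul_le_mul' (choose_mul_choose_mul_mW_le hτ h) le_rfl
      _ = 16 * ((fW τ (i + j) * hat (eE t g) i j) * (mW τ (k + l) * eH t g k l)) := by ring
      _ ≤ _ := mul_le_mul' le_rfl le_self_add
  · calc _ ≤ 16 * (mW τ (i + j) * fW τ (k + l)) * (eE t g i j * hat (eH t g) k l) :=
          mul_le_mul' (choose_mul_choose_mul_mW_le' hτ (not_le.1 h).le) le_rfl
      _ = 16 * ((mW τ (i + j) * eE t g i j) * (fW τ (k + l) * hat (eH t g) k l)) := by ring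
      _ ≤ _ := mul_le_mul' le_rfl le_add_self

theorem tsum_sum_mW_mul_eT_le (hτ : 0 < τ) :
    ∑' n, ∑ a ∈ Finset.range (n + 1), mW τ (a + (n - a)) *
      ∑ i ∈ Finset.range (a + 1), ∑ j ∈ Finset.range (n - a + 1),
        ((a.choose i : ℝ≥0∞) * ((n - a).choose j : ℝ≥0∞)) * eT t g i j (a - i) (n - a - j) ≤
      32 * (1 + ENNReal.ofReal (1 / τ)) ^ 2 * ((∑' i, ∑' j, mW τ (i + j) * eE t g i j) *
        ∑' i, ∑' j, mW τ (i + j) * eH t g i j) := by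
  rw [tsum_sum_range_eq fun a b => mW τ (a + b) *
    ∑ i ∈ Finset.range (a + 1), ∑ j ∈ Finset.range (b + 1),
      ((a.choose i : ℝ≥0∞) * (b.choose j : ℝ≥0∞)) * eT t g i j (a - i) (b - j)]
  calc _ = ∑' a, ∑' b, ∑ i ∈ Finset.range (a + 1), ∑ j ∈ Finset.range (b + 1),
        (fun i j k l => ((i + k).choose i * (j + l).choose j : ℝ≥0∞) *
          (mW τ (i + k + (j + l)) * eT t g i j k l)) i j (a - i) (b - j) := by
        refine tsum_congr fun a => tsum_congr fun b => ?_
        simp only [Finset.mul_sum]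
        refine Finset.sum_congr rfl fun i hi => Finset.sum_congr rfl fun j hj => ?_
        rw [Nat.add_sub_cancel' (Finset.mem_range_succ_iff.1 hi),
          Nat.add_sub_cancel' (Finset.mem_range_succ_iff.1 hj), mul_left_comm]
    _ = ∑' i, ∑' j, ∑' k, ∑' l, ((i + k).choose i * (j + l).choose j : ℝ≥0∞) *
          (mW τ (i + k + (j + l)) * eT t g i j k l) := tsum_sum_range_convolution
        fun i j k l => ((i + k).choose i * (j + l).choose j : ℝ≥0∞) *
          (mW τ (i + k + (j + l)) * eT t g i j k l)
    _ ≤ ∑' i, ∑' j, ∑' k, ∑' l,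
        16 * ((fW τ (i + j) * hat (eE t g) i j) * (mW τ (k + l) * eH t g k l) +
          (mW τ (i + j) * eE t g i j) * (fW τ (k + l) * hat (eH t g) k l)) := by
        refine ENNReal.tsum_le_tsum fun i => ENNReal.tsum_le_tsum fun j =>
          ENNReal.tsum_le_tsum fun k => ENNReal.tsum_le_tsum fun l => ?_
        exact choose_mul_choose_mul_mW_mul_eT_le hτ i j k l
    _ = 16 * ((∑' i, ∑' j, fW τ (i + j) * hat (eE t g) i j) *
          (∑' k, ∑' l, mW τ (k + l) * eH t g k l) +
          (∑' i, ∑' j, mW τ (i + j) * eE t g i j) *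
          ∑' k, ∑' l, fW τ (k + l) * hat (eH t g) k l) := by
        simp only [ENNReal.tsum_mul_left, ENNReal.tsum_add]
        rw [← tsum_tsum_mul, ← tsum_tsum_mul]
        simp only [ENNReal.tsum_mul_left, ENNReal.tsum_mul_right]
    _ ≤ _ := (mul_le_mul' le_rfl (add_le_add
        (mul_le_mul' (tsum_tsum_fW_mul_hat_le hτ _) le_rfl)
        (mul_le_mul' le_rfl (tsum_tsum_fW_mul_hat_le hτ _)))).trans_eq (by ring)

end Sums

section Final

variable {t τ : ℝ} {g : ℝ → ℝ → ℝ → ℝ}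

theorem L2w_nonneg (t lam : ℝ) (n : ℕ) (f : ℝ → ℝ → ℝ → ℝ) : 0 ≤ L2w t lam n f :=
  Real.sqrt_nonneg _

theorem eN_eq_ofReal (hg : DecaySmooth g) (hX : L2cond t g) (i j : ℕ) :
    eN t g i j = ENNReal.ofReal (L2w t 1 (i + j) (pdh i j g)) :=
  eL2_eq_ofReal_L2w (SmoothF.pdh hg.1 i j) _ (hX i j)

theorem eN_pdz_eq_ofReal (hg : DecaySmooth g) (hZ : L2condZ t g) (i j : ℕ) :
    eN t (pdz g) i j = ENNReal.ofReal (L2w t 1 (i + j) (pdh i j (pdz g))) :=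
  eL2_eq_ofReal_L2w (SmoothF.pdh (SmoothF.pdz hg.1) i j) _ (hZ i j)

theorem Xel_nonneg (hτ : 0 < τ) (n : ℕ) : 0 ≤ Xel t τ g n :=
  mul_nonneg (mul_nonneg (Finset.sum_nonneg fun _ _ => L2w_nonneg _ _ _ _) (by positivity))
    (Mfac_nonneg n)

theorem Yel_nonneg (hτ : 0 < τ) (n : ℕ) : 0 ≤ Yel t τ g n :=
  mul_nonneg (mul_nonneg (mul_nonneg (Finset.sum_nonneg fun _ _ => L2w_nonneg _ _ _ _)
    (by positivity)) n.cast_nonneg) (Mfac_nonneg n)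

theorem Del_nonneg (hτ : 0 < τ) (n : ℕ) : 0 ≤ Del t τ g n :=
  Xel_nonneg hτ n

/-- a weighted sum over multi-indices as a sum over total orders -/
theorem tsum_tsum_mul_eq_ofReal_tsum {u : ℕ → ℕ → ℝ} (hu : ∀ i j, 0 ≤ u i j) {c : ℕ → ℝ}
    (hc : ∀ n, 0 ≤ c n)
    (hs : Summable fun n => (∑ a ∈ Finset.range (n + 1), u a (n - a)) * c n) :
    ∑' i, ∑' j, ENNReal.ofReal (c (i + j)) * ENNReal.ofReal (u i j) =
      ENNReal.ofReal (∑' n, (∑ a ∈ Finset.range (n + 1), u a (n - a)) * c n) := by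
  rw [ENNReal.ofReal_tsum_of_nonneg
    (fun n => mul_nonneg (Finset.sum_nonneg fun _ _ => hu _ _) (hc n)) hs,
    ← tsum_sum_range_eq fun i j => ENNReal.ofReal (c (i + j)) * ENNReal.ofReal (u i j)]
  refine tsum_congr fun n => ?_
  rw [Finset.sum_mul, ENNReal.ofReal_sum_of_nonneg fun _ _ => mul_nonneg (hu _ _) (hc n)]
  refine Finset.sum_congr rfl fun a ha => ?_
  rw [Nat.add_sub_cancel' (Finset.mem_range_succ_iff.1 ha), mul_comm,
    ENNReal.ofReal_mul (hu _ _)]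

theorem Xel_eq (t τ : ℝ) (g : ℝ → ℝ → ℝ → ℝ) : Xel t τ g = fun n =>
    (∑ a ∈ Finset.range (n + 1), L2w t 1 (a + (n - a)) (pdh a (n - a) g)) *
      (τ ^ n * Mfac n) := by
  funext n
  rw [Xel, mul_assoc]
  congr 1
  refine Finset.sum_congr rfl fun a ha => ?_
  rw [Nat.add_sub_cancel' (Finset.mem_range_succ_iff.1 ha)]

theorem Yel_eq (t τ : ℝ) (g : ℝ → ℝ → ℝ → ℝ) : Yel t τ g = fun n =>
    (∑ a ∈ Finset.range (n + 1), L2w t 1 (a + (n - a)) (pdh a (n - a) g)) *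
      (τ ^ (n - 1) * n * Mfac n) := by
  funext n
  rw [Yel, mul_assoc, mul_assoc, ← mul_assoc (τ ^ (n - 1))]
  congr 1
  refine Finset.sum_congr rfl fun a ha => ?_
  rw [Nat.add_sub_cancel' (Finset.mem_range_succ_iff.1 ha)]

theorem tsum_mW_mul_eN (hτ : 0 < τ) (hg : DecaySmooth g) (hX : L2cond t g)
    (hs : Summable (Xel t τ g)) :
    ∑' i, ∑' j, mW τ (i + j) * eN t g i j = ENNReal.ofReal (Xnrm t τ g) := by
  simp only [eN_eq_ofReal hg hX, Xnrm]
  rw [Xel_eq] at hs ⊢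
  exact tsum_tsum_mul_eq_ofReal_tsum (u := fun i j => L2w t 1 (i + j) (pdh i j g))
    (fun _ _ => L2w_nonneg _ _ _ _) (fun n => mul_nonneg (by positivity) (Mfac_nonneg n)) hs

theorem tsum_mW_mul_eN_pdz (hτ : 0 < τ) (hg : DecaySmooth g) (hZ : L2condZ t g)
    (hs : Summable (Del t τ g)) :
    ∑' i, ∑' j, mW τ (i + j) * eN t (pdz g) i j = ENNReal.ofReal (Dnrm t τ g) := by
  have e : Del t τ g = Xel t τ (pdz g) := rfl
  simp only [eN_pdz_eq_ofReal hg hZ, Dnrm]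
  rw [e, Xel_eq] at hs ⊢
  exact tsum_tsum_mul_eq_ofReal_tsum (u := fun i j => L2w t 1 (i + j) (pdh i j (pdz g)))
    (fun _ _ => L2w_nonneg _ _ _ _) (fun n => mul_nonneg (by positivity) (Mfac_nonneg n)) hs

theorem tsum_yW_mul_eN (hτ : 0 < τ) (hg : DecaySmooth g) (hX : L2cond t g)
    (hs : Summable (Yel t τ g)) :
    ∑' i, ∑' j, yW τ (i + j) * eN t g i j = ENNReal.ofReal (Ynrm t τ g) := by
  simp only [eN_eq_ofReal hg hX, Ynrm]
  rw [Yel_eq] at hs ⊢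
  exact tsum_tsum_mul_eq_ofReal_tsum (u := fun i j => L2w t 1 (i + j) (pdh i j g))
    (fun _ _ => L2w_nonneg _ _ _ _) (fun n => mul_nonneg (by positivity) (Mfac_nonneg n)) hs

theorem ofReal_quotient_le (ht : 0 ≤ t) (hg : DecaySmooth g) (hX : L2cond t g)
    (a b : ℕ) :
    ENNReal.ofReal (|Iall t g a b| * τ ^ (a + b) * Mfac (a + b) / L2w t 1 (a + b) (pdh a b g)) ≤
      252000 * (mW τ (a + b) * ∑ i ∈ Finset.range (a + 1), ∑ j ∈ Finset.range (b + 1),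
        ((a.choose i : ℝ≥0∞) * (b.choose j : ℝ≥0∞)) * eT t g i j (a - i) (b - j)) := by
  rcases (L2w_nonneg t 1 (a + b) (pdh a b g)).eq_or_lt with h0 | h0
  · simp [← h0]
  rw [ENNReal.ofReal_div_of_pos h0, ← eN_eq_ofReal hg hX]
  refine ENNReal.div_le_of_le_mul ?_
  rw [mul_assoc, ENNReal.ofReal_mul (abs_nonneg _), ← Real.enorm_eq_ofReal_abs]
  refine (mul_le_mul' ((enorm_Iall_le ht hg a b).trans
    (mul_le_mul' le_rfl (eJ_le hg.1 a b))) le_rfl).trans_eq ?_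
  rw [mW]
  ring

theorem sum_ofReal_Qterm_le (ht : 0 ≤ t) (hτ : 0 < τ) (hg : DecaySmooth g) (hX : L2cond t g)
    (N : ℕ) :
    ENNReal.ofReal (∑ n ∈ Finset.range N, Qterm t τ g (Iall t g) n) ≤
      8064000 * (1 + ENNReal.ofReal (1 / τ)) ^ 2 * ((∑' i, ∑' j, mW τ (i + j) * eE t g i j) *
        ∑' i, ∑' j, mW τ (i + j) * eH t g i j) := by
  have hQ : ∀ n a, 0 ≤
      |Iall t g a (n - a)| * τ ^ n * Mfac n / L2w t 1 n (pdh a (n - a) g) := fun n a =>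
    div_nonneg (mul_nonneg (by positivity) (Mfac_nonneg n)) (L2w_nonneg _ _ _ _)
  unfold Qterm
  rw [ENNReal.ofReal_sum_of_nonneg fun n _ => Finset.sum_nonneg fun a _ => hQ n a]
  refine (ENNReal.sum_le_tsum _).trans ?_
  calc _ ≤ ∑' n, ∑ a ∈ Finset.range (n + 1), 252000 * (mW τ (a + (n - a)) *
      ∑ i ∈ Finset.range (a + 1), ∑ j ∈ Finset.range (n - a + 1),
        ((a.choose i : ℝ≥0∞) * ((n - a).choose j : ℝ≥0∞)) *
          eT t g i j (a - i) (n - a - j)) := by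
        refine ENNReal.tsum_le_tsum fun n => ?_
        rw [ENNReal.ofReal_sum_of_nonneg fun a _ => hQ n a]
        refine Finset.sum_le_sum fun a ha => ?_
        have h := ofReal_quotient_le (τ := τ) ht hg hX a (n - a)
        rw [Nat.add_sub_cancel' (Finset.mem_range_succ_iff.1 ha)] at h ⊢
        exact h
    _ ≤ 252000 * (32 * (1 + ENNReal.ofReal (1 / τ)) ^ 2 *
        ((∑' i, ∑' j, mW τ (i + j) * eE t g i j) *
          ∑' i, ∑' j, mW τ (i + j) * eH t g i j)) := by
        simp only [← Finset.mul_sum, ENNReal.tsum_mul_left]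
        exact mul_le_mul' le_rfl (tsum_sum_mW_mul_eT_le hτ)
    _ = _ := by ring

theorem sum_Qterm_le (ht : 0 ≤ t) (hτ : 0 < τ) (hg : DecaySmooth g) (hX : L2cond t g)
    (hZ : L2condZ t g) (hsX : Summable (Xel t τ g)) (hsD : Summable (Del t τ g))
    (hsY : Summable (Yel t τ g)) (N : ℕ) :
    ∑ n ∈ Finset.range N, Qterm t τ g (Iall t g) n ≤
      8064000 * (1 + 1 / τ) ^ 2 * ((Xnrm t τ g + angT t ^ ((1 : ℝ) / 4) * Dnrm t τ g) *
        (Xnrm t τ g + (2 + τ) * Ynrm t τ g)) := by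
  have hXn : 0 ≤ Xnrm t τ g := tsum_nonneg fun n => Xel_nonneg hτ n
  have hDn : 0 ≤ Dnrm t τ g := tsum_nonneg fun n => Del_nonneg hτ n
  have hYn : 0 ≤ Ynrm t τ g := tsum_nonneg fun n => Yel_nonneg hτ n
  have hS : 0 ≤ angT t ^ ((1 : ℝ) / 4) := Real.rpow_nonneg (angT_pos ht).le _
  have hE : ∑' i, ∑' j, mW τ (i + j) * eE t g i j =
      ENNReal.ofReal (Xnrm t τ g + angT t ^ ((1 : ℝ) / 4) * Dnrm t τ g) := by
    simp only [eE, mul_add, mul_left_comm _ (sig t), ENNReal.tsum_add, ENNReal.tsum_mul_left]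
    rw [tsum_mW_mul_eN hτ hg hX hsX, tsum_mW_mul_eN_pdz hτ hg hZ hsD,
      ENNReal.ofReal_add hXn (by positivity), ENNReal.ofReal_mul hS, sig]
  have hH : ∑' i, ∑' j, mW τ (i + j) * eH t g i j ≤
      ENNReal.ofReal (Xnrm t τ g + (2 + τ) * Ynrm t τ g) := by
    refine (tsum_tsum_mW_mul_eH_le hτ).trans_eq ?_
    rw [tsum_mW_mul_eN hτ hg hX hsX, tsum_yW_mul_eN hτ hg hX hsY,
      ENNReal.ofReal_add hXn (by positivity), ENNReal.ofReal_mul (by positivity),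
      ENNReal.ofReal_add (by norm_num) hτ.le]
    norm_num
  rw [← ENNReal.ofReal_le_ofReal_iff (by positivity)]
  refine (sum_ofReal_Qterm_le ht hτ hg hX N).trans ?_
  rw [hE, ENNReal.ofReal_mul (by positivity), ENNReal.ofReal_mul (by norm_num),
    ENNReal.ofReal_mul (add_nonneg hXn (mul_nonneg hS hDn)), ENNReal.ofReal_pow (by positivity),
    ENNReal.ofReal_add zero_le_one (by positivity), ENNReal.ofReal_one]
  exact mul_le_mul' (mul_le_mul' (by norm_num) le_rfl) (mul_le_mul' le_rfl hH)

end Final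

/-- combined estimate of the nonlinear terms. -/
theorem estimate_nonlinear_combined (τ₀ : ℝ) (hτ₀ : 0 < τ₀) :
    ∃ C : ℝ, 0 < C ∧
      ∀ t : ℝ, 0 ≤ t → ∀ g : ℝ → ℝ → ℝ → ℝ, DecaySmooth g → L2cond t g → L2condZ t g →
        ∀ τ : ℝ, 0 < τ → τ ≤ τ₀ →
          Summable (Xel t τ g) → Summable (Del t τ g) → Summable (Yel t τ g) →
          ∀ N : ℕ,
            (∑ n ∈ Finset.range N, Qterm t τ g (Iall t g) n) ≤
              C / τ ^ 2 * (Xnrm t τ g + angT t ^ ((1 : ℝ) / 4) * Dnrm t τ g) * Ynrm t τ g +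
              C / τ ^ 2 * (Xnrm t τ g + angT t ^ ((1 : ℝ) / 4) * Dnrm t τ g) * Xnrm t τ g := by
  refine ⟨8064000 * (1 + τ₀) ^ 2 * (2 + τ₀), by positivity, ?_⟩
  intro t ht g hg hX hZ τ hτ hττ₀ hsX hsD hsY N
  have hXn : 0 ≤ Xnrm t τ g := tsum_nonneg fun n => Xel_nonneg hτ n
  have hDn : 0 ≤ Dnrm t τ g := tsum_nonneg fun n => Del_nonneg hτ n
  have hYn : 0 ≤ Ynrm t τ g := tsum_nonneg fun n => Yel_nonneg hτ n
  have hS : 0 ≤ angT t ^ ((1 : ℝ) / 4) := Real.rpow_nonneg (angT_pos ht).le _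
  have hC : (1 + 1 / τ) ^ 2 ≤ (1 + τ₀) ^ 2 / τ ^ 2 := by
    rw [← div_pow]
    refine pow_le_pow_left₀ (by positivity) ?_ 2
    rw [le_div_iff₀ hτ, add_mul, one_div_mul_cancel hτ.ne']
    linarith
  have hXY : Xnrm t τ g + (2 + τ) * Ynrm t τ g ≤ (2 + τ₀) * (Ynrm t τ g + Xnrm t τ g) := by
    nlinarith
  calc _ ≤ _ := sum_Qterm_le ht hτ hg hX hZ hsX hsD hsY N
    _ ≤ 8064000 * ((1 + τ₀) ^ 2 / τ ^ 2) *
        ((Xnrm t τ g + angT t ^ ((1 : ℝ) / 4) * Dnrm t τ g) *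
          ((2 + τ₀) * (Ynrm t τ g + Xnrm t τ g))) := by gcongr
    _ = _ := by ring
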